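/- arXiv:1811.11904 — 6 statements merged into one kernel-verified Lean document; each statement's English description precedes it below -/
import Mathlib

section
/- Let X be a complex Hilbert space, D ⊆ X a linear subspace, H : D → X linear, and let S : [0,∞) → B(X) satisfy S(0) = Id, S(s+t) = S(s)S(t), ‖S(t)‖ ≤ 1, and for every f ∈ D: S(t)f ∈ D, t ↦ S(t)f is differentiable with d/dt S(t)f = −H(S(t)f). Suppose Ψ ≥ 0 satisfies ‖Hg − iλg‖ ≥ Ψ‖g‖ for all g ∈ D, λ ∈ ℝ. Then for every f ∈ D, every l > 0, and every continuously differentiable function χ : [0,l] → ℝ with χ(0) = χ(l) = 0, one has ∫₀^l χ'(s)² ‖S(s)f‖² ds ≥ Ψ² ∫₀^l χ(s)² ‖S(s)f‖² ds. -/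
open MeasureTheory Set Filter Topology
open scoped FourierTransform ContDiff SchwartzMap

section Plancherel

variable {X : Type*} [NormedAddCommGroup X] [InnerProductSpace ℂ X] [CompleteSpace X]

/-- The Fourier transform on `L²` is given by the Fourier integral on `L¹ ∩ L²`. -/
theorem fourier_toLp_ae_eq {F : ℝ → X} (hF : Integrable F) (hF2 : MemLp F 2) :
    (𝓕 (hF2.toLp F) : Lp X 2 (volume : Measure ℝ)) =ᵐ[volume] 𝓕 F := by
  have hcont : Continuous (𝓕 F) :=
    VectorFourier.fourierIntegral_continuous Real.continuous_fourierChar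
      (L := innerₗ ℝ) continuous_inner hF
  refine ae_eq_of_integral_contDiff_smul_eq ((Lp.memLp _).locallyIntegrable (by norm_num))
    hcont.locallyIntegrable fun g g_smooth g_cpt => ?_
  have hg₁ : HasCompactSupport (Complex.ofRealCLM ∘ g) := g_cpt.comp_left rfl
  have hg₂ : ContDiff ℝ ∞ (Complex.ofRealCLM ∘ g) := by fun_prop
  set φ : 𝓢(ℝ, ℂ) := hg₁.toSchwartzMap hg₂ with hφ
  have hval : ∀ x, φ x = (g x : ℂ) := fun x => by simp [hφ]
  calc ∫ x, g x • (𝓕 (hF2.toLp F) : Lp X 2 (volume : Measure ℝ)) x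
      = ((𝓕 (hF2.toLp F) : Lp X 2 (volume : Measure ℝ)) : 𝓢'(ℝ, X)) φ := by
        simp [hval]
    _ = ∫ x, 𝓕 φ x • (hF2.toLp F) x := by
        rw [← Lp.fourier_toTemperedDistribution_eq, TemperedDistribution.fourier_apply,
          Lp.toTemperedDistribution_apply]
    _ = ∫ x, 𝓕 φ x • F x := by
        refine integral_congr_ae ?_
        filter_upwards [hF2.coeFn_toLp] with x hx
        rw [hx]
    _ = ∫ x, φ x • 𝓕 F x := by
        simpa using! VectorFourier.integral_fourierIntegral_smul_eq_flip (L := innerₗ ℝ)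
          Real.continuous_fourierChar continuous_inner φ.integrable hF
    _ = ∫ x, g x • 𝓕 F x := by simp [hval]

theorem memLp_fourier {F : ℝ → X} (hF : Integrable F) (hF2 : MemLp F 2) :
    MemLp (𝓕 F) 2 :=
  (memLp_congr_ae (fourier_toLp_ae_eq hF hF2)).1 (Lp.memLp _)

/-- **Plancherel's theorem** on `L¹ ∩ L²`. -/
theorem integral_norm_sq_fourier_eq {F : ℝ → X} (hF : Integrable F) (hF2 : MemLp F 2) :
    ∫ w, ‖𝓕 F w‖ ^ 2 = ∫ x, ‖F x‖ ^ 2 := by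
  have key : ∀ u : Lp X 2 (volume : Measure ℝ), ‖u‖ ^ 2 = ∫ x, ‖u x‖ ^ 2 := fun u => by
    have h := congr_arg Complex.re (L2.inner_def (𝕜 := ℂ) u u)
    rw [inner_self_eq_norm_sq_to_K] at h
    have h2 : ∀ x, inner ℂ (u x) (u x) = ((‖u x‖ ^ 2 : ℝ) : ℂ) := fun x => by
      rw [inner_self_eq_norm_sq_to_K]; norm_cast
    simp_rw [h2] at h
    rw [show ∫ x, ((‖u x‖ ^ 2 : ℝ) : ℂ) = ((∫ x, ‖u x‖ ^ 2 : ℝ) : ℂ) from integral_ofReal] at h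
    exact_mod_cast h
  have h := congr_arg (· ^ 2) (Lp.norm_fourier_eq (hF2.toLp F))
  simp only [key] at h
  refine Eq.trans (integral_congr_ae ?_) (h.trans (integral_congr_ae ?_))
  · filter_upwards [fourier_toLp_ae_eq hF hF2] with x hx
    rw [hx]
  · filter_upwards [hF2.coeFn_toLp] with x hx
    rw [hx]

/-- A pointwise bound between the Fourier transforms of two functions on an interval gives the
corresponding bound between their `L²` norms. -/
theorem mul_integral_norm_sq_le_of_fourier_le {u v : ℝ → X} {a b : ℝ} (hab : a ≤ b)
    (hu : ContinuousOn u (Icc a b)) (hv : ContinuousOn v (Icc a b)) {Ψ : ℝ} (hΨ : 0 ≤ Ψ)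
    (h : ∀ w : ℝ, Ψ * ‖∫ s in a..b, Complex.exp (-(2 * Real.pi * w * Complex.I) * s) • u s‖ ≤
      ‖∫ s in a..b, Complex.exp (-(2 * Real.pi * w * Complex.I) * s) • v s‖) :
    Ψ ^ 2 * ∫ s in a..b, ‖u s‖ ^ 2 ≤ ∫ s in a..b, ‖v s‖ ^ 2 := by
  have mem : ∀ y : ℝ → X, ContinuousOn y (Icc a b) → ∀ p : ENNReal,
      MemLp ((Ioc a b).indicator y) p := fun y hy p => by
    rw [memLp_indicator_iff_restrict measurableSet_Ioc]
    obtain ⟨C, hC⟩ := isCompact_Icc.exists_bound_of_continuousOn hy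
    refine MemLp.of_bound ((hy.mono Ioc_subset_Icc_self).aestronglyMeasurable measurableSet_Ioc)
      C ?_
    exact (ae_restrict_iff' measurableSet_Ioc).2
      (Eventually.of_forall fun s hs => hC s (Ioc_subset_Icc_self hs))
  have four : ∀ (y : ℝ → X) (w : ℝ), 𝓕 ((Ioc a b).indicator y) w =
      ∫ s in a..b, Complex.exp (-(2 * Real.pi * w * Complex.I) * s) • y s := fun y w => by
    rw [Real.fourier_eq', intervalIntegral.integral_of_le hab,
      ← integral_indicator measurableSet_Ioc]
    refine integral_congr_ae (Eventually.of_forall fun s => ?_)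
    by_cases hs : s ∈ Ioc a b
    · simp only [indicator_of_mem hs, RCLike.inner_apply, conj_trivial]
      congr 2
      push_cast
      ring
    · simp [indicator_of_notMem hs]
  have norm : ∀ y : ℝ → X, ContinuousOn y (Icc a b) →
      ∫ s in a..b, ‖y s‖ ^ 2 = ∫ w, ‖𝓕 ((Ioc a b).indicator y) w‖ ^ 2 := fun y hy => by
    rw [integral_norm_sq_fourier_eq (memLp_one_iff_integrable.1 (mem y hy 1)) (mem y hy 2),
      intervalIntegral.integral_of_le hab, ← integral_indicator measurableSet_Ioc]
    refine integral_congr_ae (Eventually.of_forall fun s => ?_)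
    by_cases hs : s ∈ Ioc a b <;> simp [hs]
  have int : ∀ y : ℝ → X, ContinuousOn y (Icc a b) →
      Integrable fun w => ‖𝓕 ((Ioc a b).indicator y) w‖ ^ 2 := fun y hy =>
    (memLp_fourier (memLp_one_iff_integrable.1 (mem y hy 1)) (mem y hy 2)).integrable_norm_pow
      two_ne_zero
  rw [norm u hu, norm v hv, ← integral_const_mul]
  refine integral_mono ((int u hu).const_mul _) (int v hv) fun w => ?_
  simp only [four, ← mul_pow]
  exact pow_le_pow_left₀ (by positivity) (h w) 2

end Plancherel

section Graph

variable {X : Type*} [NormedAddCommGroup X] [NormedSpace ℂ X] [CompleteSpace X]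

theorem Submodule.intervalIntegral_mem_of_isClosed {V : Submodule ℂ X} (hV : IsClosed (V : Set X))
    {a b : ℝ} (hab : a < b) {k : ℝ → X} (hk : ContinuousOn k (Icc a b))
    (hmem : ∀ s ∈ Icc a b, k s ∈ V) : ∫ s in a..b, k s ∈ V := by
  have h := (V.restrictScalars ℝ).convex.set_average_mem (μ := volume) (t := Icc a b) hV
    (by simpa using hab) (by simp)
    ((ae_restrict_iff' measurableSet_Icc).2 (Eventually.of_forall hmem)) hk.integrableOn_Icc
  rw [setAverage_eq] at h
  have h' := (V.restrictScalars ℝ).smul_mem (volume.real (Icc a b)) h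
  rw [smul_inv_smul₀ (by simp [hab.le, sub_ne_zero, hab.ne'])] at h'
  rw [intervalIntegral.integral_of_le hab.le, ← integral_Icc_eq_integral_Ioc]
  exact h'

/-- A lower bound for `H - iλ` passes to integrals of curves in the graph of `H`. -/
theorem mul_norm_integral_le_of_graph {D : Submodule ℂ X} {H : X → X}
    (hHadd : ∀ f ∈ D, ∀ g ∈ D, H (f + g) = H f + H g)
    (hHsmul : ∀ (c : ℂ), ∀ f ∈ D, H (c • f) = c • H f) {Ψ : ℝ} {z : ℂ}
    (hres : ∀ g ∈ D, Ψ * ‖g‖ ≤ ‖H g - z • g‖)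
    {a b : ℝ} (hab : a < b) {u : ℝ → X} (hu : ContinuousOn u (Icc a b))
    (hHu : ContinuousOn (fun s => H (u s)) (Icc a b)) (hD : ∀ s ∈ Icc a b, u s ∈ D) :
    Ψ * ‖∫ s in a..b, u s‖ ≤ ‖(∫ s in a..b, H (u s)) - z • ∫ s in a..b, u s‖ := by
  let G : Submodule ℂ (X × X) :=
    { carrier := {p | p.1 ∈ D ∧ p.2 = H p.1}
      add_mem' := fun {p q} hp hq =>
        ⟨D.add_mem hp.1 hq.1, by simp [hHadd _ hp.1 _ hq.1, hp.2, hq.2]⟩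
      zero_mem' := ⟨D.zero_mem, by simpa using (hHsmul 0 0 D.zero_mem).symm⟩
      smul_mem' := fun c p hp => ⟨D.smul_mem c hp.1, by simp [hHsmul c _ hp.1, hp.2]⟩ }
  have hk : ContinuousOn (fun s => (u s, H (u s))) (Icc a b) := hu.prodMk hHu
  have hmem := G.topologicalClosure.intervalIntegral_mem_of_isClosed
    G.isClosed_topologicalClosure hab hk
    fun s hs => G.le_topologicalClosure ⟨hD s hs, rfl⟩
  have hsub : (G.topologicalClosure : Set (X × X)) ⊆ {p | Ψ * ‖p.1‖ ≤ ‖p.2 - z • p.1‖} := by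
    rw [Submodule.topologicalClosure_coe]
    refine closure_minimal ?_ (isClosed_le (by fun_prop) (by fun_prop))
    rintro ⟨x, y⟩ ⟨hx, rfl : y = H x⟩
    exact hres x hx
  have h := hsub hmem
  have hint : IntegrableOn (fun s => (u s, H (u s))) (Ioc a b) :=
    hk.integrableOn_Icc.mono_set Ioc_subset_Icc_self
  simp only [intervalIntegral.integral_of_le hab.le] at h ⊢
  simpa only [mem_ofPred_eq, fst_integral hint, snd_integral hint] using h

end Graph

section Semigroup

variable {X : Type*} [NormedAddCommGroup X] [NormedSpace ℂ X]

theorem continuousOn_orbit_of_mem_closure {S : ℝ → X →L[ℂ] X}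
    (hS : ∀ t : ℝ, 0 ≤ t → ‖S t‖ ≤ 1) {D : Set X}
    (hD : ∀ g ∈ D, ContinuousOn (fun t => S t g) (Ici 0)) {y : X} (hy : y ∈ closure D) :
    ContinuousOn (fun t => S t y) (Ici 0) := by
  refine continuousOn_of_uniform_approx_of_continuousOn fun v hv => ?_
  obtain ⟨ε, hε, hεv⟩ := Metric.mem_uniformity_dist.1 hv
  obtain ⟨g, hg, hdist⟩ := Metric.mem_closure_iff.1 hy ε hε
  refine ⟨fun t => S t g, hD g hg, fun t ht => hεv ?_⟩
  rw [dist_eq_norm, ← map_sub]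
  calc ‖S t (y - g)‖ ≤ 1 * ‖y - g‖ := (S t).le_of_opNorm_le (hS t ht) _
    _ < ε := by rwa [one_mul, ← dist_eq_norm]

/-- The generator commutes with the semigroup. -/
theorem generator_apply_semigroup {S : ℝ → X →L[ℂ] X} {H : X → X} {f : X} {t : ℝ} (ht : 0 ≤ t)
    (hS0 : S 0 = ContinuousLinearMap.id ℂ X)
    (hSadd : ∀ s t : ℝ, 0 ≤ s → 0 ≤ t → S (s + t) = (S s).comp (S t))
    (hderiv : ∀ t : ℝ, 0 ≤ t → HasDerivWithinAt (fun s => S s f) (-(H (S t f))) (Ici 0) t) :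
    H (S t f) = S t (H f) := by
  have h0 : HasDerivWithinAt (fun s => S s f) (-(H f)) (Ici 0) 0 := by
    simpa [hS0] using hderiv 0 le_rfl
  have h1 : HasDerivWithinAt (fun s => S t (S s f)) (S t (-(H f))) (Ici 0) 0 :=
    ((S t).restrictScalars ℝ).hasFDerivAt.comp_hasDerivWithinAt (0 : ℝ) h0
  have h2 : HasDerivWithinAt (fun s => S (t + s) f) (-(H (S t f))) (Ici 0) 0 := by
    have ha : HasDerivWithinAt (fun s : ℝ => t + s) 1 (Ici 0) 0 :=
      ((hasDerivAt_id (0 : ℝ)).const_add t).hasDerivWithinAt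
    have hb := hderiv t ht
    rw [← add_zero t] at hb
    have hc := HasDerivWithinAt.scomp (h := fun s : ℝ => t + s) (0 : ℝ) hb ha
      fun s hs => add_nonneg ht hs
    simpa [Function.comp_def] using hc
  have h3 := h2.congr (f₁ := fun s => S t (S s f)) (fun s hs => by simp [hSadd t s ht hs])
    (by simp [hS0])
  have := (uniqueDiffOn_Ici (0 : ℝ) 0 self_mem_Ici).eq_deriv _ h3 h1
  simpa using this

theorem generator_mem_closure {S : ℝ → X →L[ℂ] X} {H : X → X} {D : Submodule ℂ X} {f : X}
    (hSD : ∀ t : ℝ, 0 ≤ t → S t f ∈ D)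
    (hderiv : HasDerivWithinAt (fun s => S s f) (-(H f)) (Ici 0) 0) :
    H f ∈ closure (D : Set X) := by
  have h := hasDerivWithinAt_iff_tendsto_slope.1 hderiv
  rw [Ici_sdiff_left] at h
  have h' : -(H f) ∈ D.topologicalClosure := by
    refine mem_closure_of_tendsto h ?_
    filter_upwards [self_mem_nhdsWithin] with t ht
    rw [slope_def_module]
    exact (D.restrictScalars ℝ).smul_mem _
      (D.sub_mem (hSD t (le_of_lt ht)) (hSD 0 le_rfl))
  exact neg_mem_iff.1 h'

end Semigroup


/-- Key inequality in the proof of the sharp Gearhart–Prüss theorem: if the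
semigroup `S t = e^{-tH}` is generated by `-H` and `‖(H - iλ)g‖ ≥ Ψ‖g‖` on the
domain `D`, then for every `f ∈ D` and every `C¹` function `χ` on `[0, l]`
vanishing at the endpoints, `∫₀^l χ'(s)²‖S s f‖² ds ≥ Ψ² ∫₀^l χ(s)²‖S s f‖² ds`. -/
theorem stmt_1 {X : Type*} [NormedAddCommGroup X] [InnerProductSpace ℂ X] [CompleteSpace X]
    (D : Set X) (hD0 : (0 : X) ∈ D)
    (hDadd : ∀ f ∈ D, ∀ g ∈ D, f + g ∈ D)
    (hDsmul : ∀ (c : ℂ), ∀ f ∈ D, c • f ∈ D)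
    (H : X → X)
    (hHadd : ∀ f ∈ D, ∀ g ∈ D, H (f + g) = H f + H g)
    (hHsmul : ∀ (c : ℂ), ∀ f ∈ D, H (c • f) = c • H f)
    (S : ℝ → X →L[ℂ] X)
    (hS0 : S 0 = ContinuousLinearMap.id ℂ X)
    (hSadd : ∀ s t : ℝ, 0 ≤ s → 0 ≤ t → S (s + t) = (S s).comp (S t))
    (hScontr : ∀ t : ℝ, 0 ≤ t → ‖S t‖ ≤ 1)
    (hSD : ∀ f ∈ D, ∀ t : ℝ, 0 ≤ t → S t f ∈ D)
    (hSderiv : ∀ f ∈ D, ∀ t : ℝ, 0 ≤ t →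
      HasDerivWithinAt (fun s => S s f) (-(H (S t f))) (Set.Ici 0) t)
    (Ψ : ℝ) (hΨ : 0 ≤ Ψ)
    (hres : ∀ g ∈ D, ∀ lam : ℝ, Ψ * ‖g‖ ≤ ‖H g - ((lam : ℂ) * Complex.I) • g‖) :
    ∀ f ∈ D, ∀ l : ℝ, 0 < l → ∀ χ χ' : ℝ → ℝ,
      (∀ s ∈ Set.Icc (0 : ℝ) l, HasDerivWithinAt χ (χ' s) (Set.Icc (0 : ℝ) l) s) →
      ContinuousOn χ' (Set.Icc (0 : ℝ) l) →
      χ 0 = 0 → χ l = 0 →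
      Ψ ^ 2 * ∫ s in (0 : ℝ)..l, (χ s) ^ 2 * ‖S s f‖ ^ 2 ≤
        ∫ s in (0 : ℝ)..l, (χ' s) ^ 2 * ‖S s f‖ ^ 2 := by
  intro f hf l hl χ χ' hχ hχ' hχ0 hχl
  let D' : Submodule ℂ X :=
    { carrier := D
      add_mem' := fun {a b} ha hb => hDadd a ha b hb
      zero_mem' := hD0
      smul_mem' := fun c x hx => hDsmul c x hx }
  have hSc : ∀ g ∈ D, ContinuousOn (fun s => S s g) (Ici 0) := fun g hg t ht =>
    (hSderiv g hg t ht).continuousWithinAt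
  have hcomm : ∀ t : ℝ, 0 ≤ t → H (S t f) = S t (H f) := fun t ht =>
    generator_apply_semigroup ht hS0 hSadd (hSderiv f hf)
  have hHc : ContinuousOn (fun s => S s (H f)) (Ici 0) :=
    continuousOn_orbit_of_mem_closure hScontr hSc <|
      generator_mem_closure (D := D') (hSD f hf) <| by
        simpa [hS0] using hSderiv f hf 0 le_rfl
  have hsub : Icc 0 l ⊆ Ici (0 : ℝ) := Icc_subset_Ici_self
  have hSf : ContinuousOn (fun s => S s f) (Icc 0 l) := (hSc f hf).mono hsub
  have hSHf : ContinuousOn (fun s => S s (H f)) (Icc 0 l) := hHc.mono hsub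
  have hχc : ContinuousOn χ (Icc 0 l) := fun s hs => (hχ s hs).continuousWithinAt
  have hχC : ContinuousOn (fun s => (χ s : ℂ)) (Icc 0 l) :=
    Complex.continuous_ofReal.comp_continuousOn hχc
  have hχC' : ContinuousOn (fun s => (χ' s : ℂ)) (Icc 0 l) :=
    Complex.continuous_ofReal.comp_continuousOn hχ'
  have hmain := mul_integral_norm_sq_le_of_fourier_le hl.le (hχC.smul hSf) (hχC'.smul hSf) hΨ
    fun w => ?_
  · simpa [norm_smul, mul_pow] using hmain
  set z : ℂ := -(2 * Real.pi * w * Complex.I) with hz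
  have hzw : z = ((-(2 * Real.pi * w) : ℝ) : ℂ) * Complex.I := by rw [hz]; push_cast; ring
  clear_value z
  have he : Continuous fun s : ℝ => Complex.exp (z * s) := by fun_prop
  have hHu : ∀ s ∈ Icc 0 l, H (Complex.exp (z * s) • (χ s : ℂ) • S s f) =
      Complex.exp (z * s) • (χ s : ℂ) • S s (H f) := fun s hs => by
    have hs' := hSD f hf s hs.1
    rw [hHsmul _ _ (hDsmul _ _ hs'), hHsmul _ _ hs', hcomm s hs.1]
  have hcu : ContinuousOn (fun s : ℝ => Complex.exp (z * s) • (χ s : ℂ) • S s f) (Icc 0 l) :=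
    he.continuousOn.smul (hχC.smul hSf)
  have hcu' : ContinuousOn (fun s : ℝ => Complex.exp (z * s) • (χ' s : ℂ) • S s f) (Icc 0 l) :=
    he.continuousOn.smul (hχC'.smul hSf)
  have hcH : ContinuousOn (fun s : ℝ => Complex.exp (z * s) • (χ s : ℂ) • S s (H f)) (Icc 0 l) :=
    he.continuousOn.smul (hχC.smul hSHf)
  have hgraph := mul_norm_integral_le_of_graph (D := D') hHadd hHsmul (z := z)
    (fun g hg => by rw [hzw]; exact hres g hg _) hl hcu (hcH.congr hHu)
    fun s hs => hDsmul _ _ (hDsmul _ _ (hSD f hf s hs.1))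
  rw [← uIcc_of_le hl.le] at hHu
  rw [intervalIntegral.integral_congr hHu] at hgraph
  have hderiv : ∀ s ∈ Ioo 0 l, HasDerivAt (fun s : ℝ => Complex.exp (z * s) • (χ s : ℂ) • S s f)
      (z • (Complex.exp (z * s) • (χ s : ℂ) • S s f) + Complex.exp (z * s) • (χ' s : ℂ) • S s f
        - Complex.exp (z * s) • (χ s : ℂ) • S s (H f)) s := fun s hs => by
    have h1 : HasDerivAt (fun s : ℝ => Complex.exp (z * s)) (Complex.exp (z * s) * z) s := by
      have := ((hasDerivAt_id s).ofReal_comp.const_mul z).cexp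
      simpa using this
    have h2 : HasDerivAt (fun s : ℝ => (χ s : ℂ)) (χ' s : ℂ) s :=
      ((hχ s (Ioo_subset_Icc_self hs)).hasDerivAt (Icc_mem_nhds hs.1 hs.2)).ofReal_comp
    have h3 : HasDerivAt (fun s : ℝ => S s f) (-(S s (H f))) s := by
      rw [← hcomm s hs.1.le]
      exact (hSderiv f hf s hs.1.le).hasDerivAt (Ici_mem_nhds hs.1)
    refine (h1.smul (h2.smul h3)).congr_deriv ?_
    simp only [Pi.smul_apply']
    module
  have i1 : IntervalIntegrable
      (fun s : ℝ => z • (Complex.exp (z * s) • (χ s : ℂ) • S s f)) volume 0 l :=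
    (hcu.const_smul z).intervalIntegrable_of_Icc hl.le
  have i2 := hcu'.intervalIntegrable_of_Icc (μ := volume) hl.le
  have i3 := hcH.intervalIntegrable_of_Icc (μ := volume) hl.le
  have hftc := intervalIntegral.integral_eq_sub_of_hasDerivAt_of_le hl.le hcu hderiv
    ((i1.add i2).sub i3)
  rw [intervalIntegral.integral_sub (i1.add i2) i3,
    intervalIntegral.integral_add i1 i2, intervalIntegral.integral_smul] at hftc
  simp only [hχ0, hχl, Complex.ofReal_zero, zero_smul, smul_zero, sub_zero] at hftc
  refine hgraph.trans_eq (congr_arg norm ?_)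
  rw [sub_eq_iff_eq_add']
  exact (sub_eq_zero.1 hftc).symm
end

section
/- Let Ψ > 0 and t > π/(2Ψ). Set t₁ = π/(4Ψ), t₂ = t − π/(4Ψ), t₃ = t + π/(4Ψ), l = t + π/(2Ψ), and define h : [0,l] → ℝ by h(s) = Ψ² cos(2Ψs) for 0 ≤ s ≤ t₁, h(s) = 0 for t₁ ≤ s ≤ t₂, and h(s) = Ψ² e^{2Ψl − 2π} cos(2Ψ(l − s)) for t₂ ≤ s ≤ l. Then for every nonincreasing nonnegative function g : [0,l] → ℝ one has ∫₀^l h(s) g(s) ds ≤ (Ψ/2) g(0) − (Ψ/2) e^{2Ψl − 2π} g(t). In particular, if in addition ∫₀^l h(s) g(s) ds ≥ 0, then g(t) ≤ e^{−2Ψl + 2π} g(0). -/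
open MeasureTheory in
/-- If `h` agrees on `[a, b]` with the cosine `A cos (ω (c - s))` and `h g ≤ h m` there for a constant
`m`, then the integral of `h g` over `[a, b]` is at most `m` times that of the cosine. -/
lemma integral_mul_le_of_eqOn_cos {a b A ω c m : ℝ} {h g : ℝ → ℝ} (hab : a ≤ b) (hω : ω ≠ 0)
    (hh : ∀ s ∈ Set.Icc a b, h s = A * Real.cos (ω * (c - s)))
    (hg : AntitoneOn g (Set.Icc a b))
    (hle : ∀ s ∈ Set.Icc a b,
      A * Real.cos (ω * (c - s)) * g s ≤ A * Real.cos (ω * (c - s)) * m) :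
    IntervalIntegrable (fun s => h s * g s) volume a b ∧
      ∫ s in a..b, h s * g s ≤
        A * (Real.sin (ω * (c - a)) - Real.sin (ω * (c - b))) / ω * m := by
  have hcos : Continuous fun s => A * Real.cos (ω * (c - s)) := by fun_prop
  have hint : IntervalIntegrable (fun s => h s * g s) volume a b := by
    have hg' : IntervalIntegrable g volume a b := by
      apply AntitoneOn.intervalIntegrable
      rwa [Set.uIcc_of_le hab]
    refine (hg'.continuousOn_mul hcos.continuousOn).congr fun s hs => ?_
    rw [Set.uIoc_of_le hab] at hs
    simp only [hh s (Set.Ioc_subset_Icc_self hs)]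
  have hprim : ∫ s in a..b, A * Real.cos (ω * (c - s)) =
      A * (Real.sin (ω * (c - a)) - Real.sin (ω * (c - b))) / ω := by
    have hderiv : ∀ s ∈ Set.uIcc a b, HasDerivAt (fun s => -(A * Real.sin (ω * (c - s)) / ω))
        (A * Real.cos (ω * (c - s))) s := by
      intro s _
      have hinner : HasDerivAt (fun s => ω * (c - s)) (ω * (-1)) s :=
        ((hasDerivAt_id s).const_sub c).const_mul ω
      refine (((hinner.sin.const_mul A).div_const ω).neg).congr_deriv ?_
      field_simp
    rw [intervalIntegral.integral_eq_sub_of_hasDerivAt hderiv (hcos.intervalIntegrable a b)]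
    ring
  refine ⟨hint, ?_⟩
  rw [← hprim, ← intervalIntegral.integral_mul_const]
  refine intervalIntegral.integral_mono_on hab hint
    ((hcos.mul continuous_const).intervalIntegrable a b) fun s hs => ?_
  rw [hh s hs]
  exact hle s hs


/-- The elementary real-variable estimate in the proof of the sharp
Gearhart–Prüss theorem: for the piecewise weight `h` built from
`χ' ² - Ψ²χ²` and any nonincreasing nonnegative `g` on `[0, l]`,
`∫₀^l h g ≤ (Ψ/2) g(0) - (Ψ/2) e^{2Ψl - 2π} g(t)`; in particular if the
integral is nonnegative then `g(t) ≤ e^{-2Ψl + 2π} g(0)`. -/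
theorem stmt_2 (Ψ t : ℝ) (hΨ : 0 < Ψ) (ht : Real.pi / (2 * Ψ) < t)
    (t₁ t₂ t₃ l : ℝ)
    (ht₁ : t₁ = Real.pi / (4 * Ψ)) (ht₂ : t₂ = t - Real.pi / (4 * Ψ))
    (ht₃ : t₃ = t + Real.pi / (4 * Ψ)) (hl : l = t + Real.pi / (2 * Ψ))
    (h : ℝ → ℝ)
    (hh1 : ∀ s ∈ Set.Icc (0 : ℝ) t₁, h s = Ψ ^ 2 * Real.cos (2 * Ψ * s))
    (hh2 : ∀ s ∈ Set.Icc t₁ t₂, h s = 0)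
    (hh3 : ∀ s ∈ Set.Icc t₂ l,
      h s = Ψ ^ 2 * Real.exp (2 * Ψ * l - 2 * Real.pi) * Real.cos (2 * Ψ * (l - s)))
    (g : ℝ → ℝ) (hg_anti : AntitoneOn g (Set.Icc (0 : ℝ) l))
    (hg_nonneg : ∀ s ∈ Set.Icc (0 : ℝ) l, 0 ≤ g s) :
    ((∫ s in (0 : ℝ)..l, h s * g s) ≤
        Ψ / 2 * g 0 - Ψ / 2 * Real.exp (2 * Ψ * l - 2 * Real.pi) * g t) ∧
      (0 ≤ (∫ s in (0 : ℝ)..l, h s * g s) →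
        g t ≤ Real.exp (-2 * Ψ * l + 2 * Real.pi) * g 0) := by
  have hπ := Real.pi_pos
  obtain ⟨p, hp⟩ : ∃ p, p = Real.pi / (4 * Ψ) := ⟨_, rfl⟩
  have hp0 : 0 < p := hp ▸ by positivity
  have hpΨ : Real.pi = 4 * (Ψ * p) := by rw [hp]; field_simp
  have h2p : Real.pi / (2 * Ψ) = 2 * p := by rw [hp]; field_simp; norm_num
  rw [← hp] at ht₁ ht₂ ht₃
  rw [h2p] at ht hl
  have hω : 2 * Ψ ≠ 0 := by positivity
  set E := Real.exp (2 * Ψ * l - 2 * Real.pi) with hE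
  have hE0 : 0 < E := Real.exp_pos _
  have hA : 0 ≤ Ψ ^ 2 * E := by positivity
  have hmono {a b : ℝ} (ha : 0 ≤ a) (hb : b ≤ l) : AntitoneOn g (Set.Icc a b) :=
    hg_anti.mono (Set.Icc_subset_Icc ha hb)
  have hcos_nonneg : ∀ x, -p ≤ x → x ≤ p → 0 ≤ Real.cos (2 * Ψ * x) := fun x h1 h2 =>
    Real.cos_nonneg_of_neg_pi_div_two_le_of_le (by nlinarith) (by nlinarith)
  have hcos_nonpos : ∀ x, p ≤ x → x ≤ 3 * p → Real.cos (2 * Ψ * x) ≤ 0 := fun x h1 h2 =>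
    Real.cos_nonpos_of_pi_div_two_le_of_le (by nlinarith) (by nlinarith)
  -- On `[0, t₁]` the weight is nonnegative and `g ≤ g 0`.
  obtain ⟨i₁, b₁⟩ := integral_mul_le_of_eqOn_cos (a := 0) (b := t₁) (A := Ψ ^ 2) (ω := 2 * Ψ)
    (c := 0) (m := g 0) (h := h) (g := g) (by linarith) hω
    (fun s hs => by rw [hh1 s hs, ← Real.cos_neg]; ring_nf) (hmono le_rfl (by linarith))
    (fun s hs => by
      obtain ⟨h1, h2⟩ := hs
      refine mul_le_mul_of_nonneg_left
        (hg_anti ⟨le_rfl, by linarith⟩ ⟨h1, by linarith⟩ h1) ?_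
      exact mul_nonneg (sq_nonneg _) (hcos_nonneg _ (by linarith) (by linarith)))
  -- On `[t₁, t₂]` the weight vanishes.
  obtain ⟨i₂, b₂⟩ := integral_mul_le_of_eqOn_cos (a := t₁) (b := t₂) (A := 0) (ω := 2 * Ψ)
    (c := 0) (m := 0) (h := h) (g := g) (by linarith) hω
    (fun s hs => by rw [hh2 s hs, zero_mul]) (hmono (by linarith) (by linarith))
    (fun s _ => by simp)
  -- On `[t₂, t]` the weight is nonpositive and `g ≥ g t`.
  obtain ⟨i₃, b₃⟩ := integral_mul_le_of_eqOn_cos (a := t₂) (b := t) (A := Ψ ^ 2 * E)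
    (ω := 2 * Ψ) (c := l) (m := g t) (h := h) (g := g) (by linarith) hω
    (fun s hs => hh3 s ⟨hs.1, by linarith [hs.2]⟩) (hmono (by linarith) (by linarith))
    (fun s hs => by
      obtain ⟨h1, h2⟩ := hs
      refine mul_le_mul_of_nonpos_left
        (hg_anti ⟨by linarith, by linarith⟩ ⟨by linarith, by linarith⟩ h2) ?_
      exact mul_nonpos_of_nonneg_of_nonpos hA (hcos_nonpos _ (by linarith) (by linarith)))
  -- On `[t, l]` the weight has integral zero and changes sign at `t₃`.
  obtain ⟨i₄, b₄⟩ := integral_mul_le_of_eqOn_cos (a := t) (b := l) (A := Ψ ^ 2 * E)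
    (ω := 2 * Ψ) (c := l) (m := g t₃) (h := h) (g := g) (by linarith) hω
    (fun s hs => hh3 s ⟨by linarith [hs.1], hs.2⟩) (hmono (by linarith) le_rfl)
    (fun s hs => by
      obtain ⟨h1, h2⟩ := hs
      rcases le_total s t₃ with h3 | h3
      · refine mul_le_mul_of_nonpos_left
          (hg_anti ⟨by linarith, by linarith⟩ ⟨by linarith, by linarith⟩ h3) ?_
        exact mul_nonpos_of_nonneg_of_nonpos hA (hcos_nonpos _ (by linarith) (by linarith))
      · refine mul_le_mul_of_nonneg_left
          (hg_anti ⟨by linarith, by linarith⟩ ⟨by linarith, by linarith⟩ h3) ?_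
        exact mul_nonneg hA (hcos_nonneg _ (by linarith) (by linarith)))
  have v₁ : Real.sin (2 * Ψ * (0 - t₁)) = -1 := by
    rw [show 2 * Ψ * (0 - t₁) = -(Real.pi / 2) by rw [hpΨ, ht₁]; ring, Real.sin_neg,
      Real.sin_pi_div_two]
  have v₂ : Real.sin (2 * Ψ * (l - t₂)) = -1 := by
    rw [show 2 * Ψ * (l - t₂) = Real.pi / 2 + Real.pi by rw [hpΨ, ht₂, hl]; ring,
      Real.sin_add_pi, Real.sin_pi_div_two]
  have v₃ : Real.sin (2 * Ψ * (l - t)) = 0 := by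
    rw [show 2 * Ψ * (l - t) = Real.pi by rw [hpΨ, hl]; ring, Real.sin_pi]
  rw [v₁, sub_zero, mul_zero, Real.sin_zero] at b₁
  rw [v₂, v₃] at b₃
  rw [v₃, sub_self, mul_zero, Real.sin_zero] at b₄
  have e₁ : Ψ ^ 2 * (0 - -1) / (2 * Ψ) * g 0 = Ψ / 2 * g 0 := by field_simp; ring
  have e₃ : Ψ ^ 2 * E * (-1 - 0) / (2 * Ψ) * g t = -(Ψ / 2 * E * g t) := by field_simp; ring
  rw [e₁] at b₁
  rw [e₃] at b₃
  have hbound : (∫ s in (0 : ℝ)..l, h s * g s) ≤ Ψ / 2 * g 0 - Ψ / 2 * E * g t := by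
    rw [← intervalIntegral.integral_add_adjacent_intervals ((i₁.trans i₂).trans i₃) i₄,
      ← intervalIntegral.integral_add_adjacent_intervals (i₁.trans i₂) i₃,
      ← intervalIntegral.integral_add_adjacent_intervals i₁ i₂]
    simp only [sub_self, mul_zero, zero_div, zero_mul] at b₂ b₄
    linarith
  refine ⟨hbound, fun hpos => ?_⟩
  have hgt : E * g t ≤ g 0 := by
    have : 0 ≤ Ψ / 2 * (g 0 - E * g t) := by linarith
    linarith [nonneg_of_mul_nonneg_right this (half_pos hΨ)]
  have hinv : Real.exp (-2 * Ψ * l + 2 * Real.pi) = E⁻¹ := by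
    rw [hE, ← Real.exp_neg]; ring_nf
  rwa [hinv, ← div_eq_inv_mul, le_div_iff₀' hE0]
end

section
/- Let d ≥ 1, let u : ℝ^d → ℝ^d be continuously differentiable, 2π-periodic in each coordinate, with div u = 0. Let λ ∈ ℝ and let φ₀ : ℝ^d → ℂ be continuously differentiable, 2π-periodic in each coordinate, nonconstant, with ∫_{[0,2π]^d} |φ₀|² dx = 1 and u · ∇φ₀ = iλ φ₀. Let A ∈ ℝ and let φ : [0,∞) × ℝ^d → ℂ be 2π-periodic in each space coordinate, continuously differentiable in t, twice continuously differentiable in x, satisfying ∂ₜφ + A u·∇φ = Δφ and φ(0,·) = φ₀. Set τ = (2 ∫_{[0,2π]^d} |∇φ₀|² dx)^{−1}. Then for every 0 ≤ t ≤ τ one has |∫_{[0,2π]^d} φ(t,x) \overline{φ₀(x)} dx| ≥ 1/2; in particular (∫_{[0,2π]^d} |φ(t,x)|² dx)^{1/2} ≥ 1/2, uniformly in A. -/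
open MeasureTheory

/-- The `j`-th standard basis vector of `ℝ^d`. -/
noncomputable def stdBasis (d : ℕ) (j : Fin d) : EuclideanSpace ℝ (Fin d) :=
  EuclideanSpace.single j 1

/-- The fundamental cube `[0, 2π]^d`. -/
def cube (d : ℕ) : Set (EuclideanSpace ℝ (Fin d)) :=
  {x | ∀ j, x j ∈ Set.Icc (0 : ℝ) (2 * Real.pi)}

/-- The Laplacian `Δf = Σⱼ ∂²f/∂xⱼ²` of `f : ℝ^d → ℂ`. -/
noncomputable def laplacian (d : ℕ) (f : EuclideanSpace ℝ (Fin d) → ℂ)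
    (x : EuclideanSpace ℝ (Fin d)) : ℂ :=
  ∑ j, fderiv ℝ (fun y => fderiv ℝ f y (stdBasis d j)) x (stdBasis d j)

/-- A function on `ℝ^d` that is `2π`-periodic in each coordinate. -/
def IsPeriodic {d : ℕ} {α : Type*} (f : EuclideanSpace ℝ (Fin d) → α) : Prop :=
  ∀ x j, f (x + (2 * Real.pi) • stdBasis d j) = f x

lemma IsPeriodic.add_int_combination {d : ℕ} {α : Type*} {f : EuclideanSpace ℝ (Fin d) → α}
    (hf : IsPeriodic f) (n : Fin d → ℤ) (x : EuclideanSpace ℝ (Fin d)) :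
    f (x + ∑ j, n j • ((2 * Real.pi) • stdBasis d j)) = f x := by
  have h : Function.Periodic f (∑ j, n j • ((2 * Real.pi) • stdBasis d j)) :=
    Finset.sum_induction _ (Function.Periodic f) (fun a b ha hb => ha.add_period hb)
      (fun x => by simp) (fun j _ => Function.Periodic.zsmul (fun x => hf x j) (n j))
  exact h x

lemma int_combination_apply {d : ℕ} (n : Fin d → ℤ) (i : Fin d) :
    (∑ j, n j • ((2 * Real.pi) • stdBasis d j)) i = n i * (2 * Real.pi) := by
  simp [stdBasis, Pi.single_apply, mul_comm]

/-- Every point is congruent to a point of the fundamental cube. -/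
lemma exists_mem_cube_congr {d : ℕ} (x : EuclideanSpace ℝ (Fin d)) :
    ∃ n : Fin d → ℤ, x + ∑ j, n j • ((2 * Real.pi) • stdBasis d j) ∈ cube d := by
  have hpi : 0 < 2 * Real.pi := Real.two_pi_pos
  refine ⟨fun j => -⌊x j / (2 * Real.pi)⌋, fun i => ?_⟩
  rw [PiLp.add_apply, int_combination_apply]
  have h1 := Int.floor_le (x i / (2 * Real.pi))
  have h2 := (Int.lt_floor_add_one (x i / (2 * Real.pi))).le
  rw [le_div_iff₀ hpi] at h1
  rw [div_le_iff₀ hpi] at h2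
  push_cast
  constructor <;> linarith

lemma isCompact_cube (d : ℕ) : IsCompact (cube d) := by
  have h : cube d = (EuclideanSpace.equiv (Fin d) ℝ).toHomeomorph ⁻¹'
      (Set.Icc 0 (fun _ => 2 * Real.pi)) := by
    ext x
    simp [cube, Set.mem_Icc, Pi.le_def, forall_and]
  rw [h, Homeomorph.isCompact_preimage]
  exact isCompact_Icc

lemma zero_mem_cube (d : ℕ) : (0 : EuclideanSpace ℝ (Fin d)) ∈ cube d :=
  fun _ => ⟨le_rfl, Real.two_pi_pos.le⟩

lemma IsPeriodic.exists_norm_le {d : ℕ} {F : Type*} [NormedAddCommGroup F]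
    {f : EuclideanSpace ℝ (Fin d) → F} (hp : IsPeriodic f) (hf : Continuous f) :
    ∃ M, 0 ≤ M ∧ ∀ x, ‖f x‖ ≤ M := by
  obtain ⟨M, hM⟩ := (isCompact_cube d).exists_bound_of_continuousOn hf.continuousOn
  refine ⟨M, (norm_nonneg _).trans (hM 0 (zero_mem_cube d)), fun x => ?_⟩
  obtain ⟨n, hn⟩ := exists_mem_cube_congr x
  rw [← hp.add_int_combination n x]
  exact hM _ hn

lemma IsPeriodic.exists_forall_ge {d : ℕ} {g : EuclideanSpace ℝ (Fin d) → ℝ}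
    (hp : IsPeriodic g) (hg : Continuous g) : ∃ x₀, ∀ x, g x ≤ g x₀ := by
  obtain ⟨x₀, -, h⟩ := (isCompact_cube d).exists_isMaxOn ⟨0, zero_mem_cube d⟩ hg.continuousOn
  refine ⟨x₀, fun x => ?_⟩
  obtain ⟨n, hn⟩ := exists_mem_cube_congr x
  rw [← hp.add_int_combination n x]
  exact h hn

/-- The covering map of the torus, normalised to period `2π`. -/
noncomputable def toTorus (d : ℕ) (x : EuclideanSpace ℝ (Fin d)) : UnitAddTorus (Fin d) :=
  fun j => ((x j / (2 * Real.pi) : ℝ) : UnitAddCircle)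

lemma isQuotientMap_toTorus (d : ℕ) : Topology.IsQuotientMap (toTorus d) := by
  have hpi : (2 * Real.pi) ≠ 0 := Real.two_pi_pos.ne'
  have hmk : IsOpenQuotientMap ((↑) : ℝ → UnitAddCircle) := QuotientAddGroup.isOpenQuotientMap_mk
  have hs : Function.Surjective (toTorus d) := by
    intro y
    choose z hz using fun j => hmk.surjective (y j)
    refine ⟨WithLp.toLp 2 fun j => 2 * Real.pi * z j, funext fun j => ?_⟩
    simp only [toTorus]
    rw [mul_div_cancel_left₀ _ hpi, hz]
  have hc : Continuous (toTorus d) := by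
    refine continuous_pi fun j => hmk.continuous.comp ?_
    fun_prop
  have ho : IsOpenMap (toTorus d) := by
    have h1 : IsOpenMap (Pi.map fun _ : Fin d => ((↑) : ℝ → UnitAddCircle)) :=
      IsOpenMap.piMap (fun _ => hmk.isOpenMap) (by simp [hmk.surjective])
    have h2 : toTorus d = (Pi.map fun _ : Fin d => ((↑) : ℝ → UnitAddCircle)) ∘
        ((EuclideanSpace.equiv (Fin d) ℝ).toHomeomorph.trans
          (Homeomorph.piCongrRight fun _ =>
            Homeomorph.mulRight₀ (2 * Real.pi)⁻¹ (by positivity))) := by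
      ext x j
      simp [toTorus, Pi.map, div_eq_mul_inv]
    rw [h2]
    exact h1.comp (Homeomorph.isOpenMap _)
  exact ho.isQuotientMap hc hs

/-- Continuous periodic functions descend to the torus. -/
lemma IsPeriodic.exists_lift {d : ℕ} {g : EuclideanSpace ℝ (Fin d) → ℂ}
    (hp : IsPeriodic g) (hg : Continuous g) :
    ∃ G : C(UnitAddTorus (Fin d), ℂ), ∀ x, G (toTorus d x) = g x := by
  let q : C(EuclideanSpace ℝ (Fin d), UnitAddTorus (Fin d)) :=
    ⟨toTorus d, (isQuotientMap_toTorus d).continuous⟩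
  have hq : Topology.IsQuotientMap q := isQuotientMap_toTorus d
  have hfac : Function.FactorsThrough (⟨g, hg⟩ : C(EuclideanSpace ℝ (Fin d), ℂ)) q := by
    intro x y hxy
    have h : ∀ j, ∃ n : ℤ, x j = y j + n * (2 * Real.pi) := by
      intro j
      have h1 : ((x j / (2 * Real.pi) : ℝ) : UnitAddCircle) = ((y j / (2 * Real.pi) : ℝ) :) :=
        congrFun hxy j
      obtain ⟨n, hn⟩ := (QuotientAddGroup.eq_iff_sub_mem.1 h1)
      refine ⟨n, ?_⟩
      simp only [zsmul_eq_mul, mul_one] at hn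
      have hpi : (2 * Real.pi) ≠ 0 := Real.two_pi_pos.ne'
      field_simp at hn
      linarith
    choose n hn using h
    have hxy' : x = y + ∑ j, n j • ((2 * Real.pi) • stdBasis d j) := by
      ext i
      rw [PiLp.add_apply, int_combination_apply, hn i]
    change g x = g y
    rw [hxy', hp.add_int_combination]
  refine ⟨hq.lift _ hfac, fun x => ?_⟩
  exact DFunLike.congr_fun (hq.lift_comp _ hfac) x

section Calculus

variable {d : ℕ}

lemma hasDerivAt_along_line {F : Type*} [NormedAddCommGroup F] [NormedSpace ℝ F]
    {f : EuclideanSpace ℝ (Fin d) → F} (hf : ContDiff ℝ 1 f)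
    (x v : EuclideanSpace ℝ (Fin d)) (s : ℝ) :
    HasDerivAt (fun s : ℝ => f (x + s • v)) (fderiv ℝ f (x + s • v) v) s := by
  have h1 : HasFDerivAt f (fderiv ℝ f (x + s • v)) (x + s • v) :=
    (hf.differentiable one_ne_zero _).hasFDerivAt
  have h2 : HasDerivAt (fun s : ℝ => x + s • v) v s := by
    simpa using ((hasDerivAt_id s).smul_const v).const_add x
  exact h1.comp_hasDerivAt s h2

lemma contDiff_fderiv_apply {f : EuclideanSpace ℝ (Fin d) → ℂ} (hf : ContDiff ℝ 2 f)
    (v : EuclideanSpace ℝ (Fin d)) : ContDiff ℝ 1 (fun y => fderiv ℝ f y v) :=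
  (hf.fderiv_right (m := 1) (by norm_num)).clm_apply contDiff_const

lemma continuous_laplacian {f : EuclideanSpace ℝ (Fin d) → ℂ} (hf : ContDiff ℝ 2 f) :
    Continuous (laplacian d f) := by
  refine continuous_finsetSum _ fun j _ => ?_
  exact ((contDiff_fderiv_apply hf _).continuous_fderiv one_ne_zero).clm_apply continuous_const

lemma continuous_fderiv_apply_field {f : EuclideanSpace ℝ (Fin d) → ℂ} (hf : ContDiff ℝ 1 f)
    {u : EuclideanSpace ℝ (Fin d) → EuclideanSpace ℝ (Fin d)} (hu : Continuous u) :
    Continuous (fun x => fderiv ℝ f x (u x)) :=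
  (hf.continuous_fderiv one_ne_zero).clm_apply hu

lemma IsPeriodic.fderiv {f : EuclideanSpace ℝ (Fin d) → ℂ} (hp : IsPeriodic f) :
    IsPeriodic (fderiv ℝ f) := by
  intro x j
  have h : (fun y => f (y + (2 * Real.pi) • stdBasis d j)) = f := funext fun y => hp y j
  conv_rhs => rw [← h]
  rw [fderiv_comp_add_right]

lemma IsPeriodic.laplacian {f : EuclideanSpace ℝ (Fin d) → ℂ} (hp : IsPeriodic f) :
    IsPeriodic (laplacian d f) := by
  intro x j
  refine Finset.sum_congr rfl fun i _ => ?_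
  have h : IsPeriodic (fun y => _root_.fderiv ℝ f y (stdBasis d i)) := fun y k => by
    simp only [hp.fderiv y k]
  rw [h.fderiv x j]

lemma laplacian_add {f g : EuclideanSpace ℝ (Fin d) → ℂ} (hf : ContDiff ℝ 2 f)
    (hg : ContDiff ℝ 2 g) (x : EuclideanSpace ℝ (Fin d)) :
    laplacian d (fun y => f y + g y) x = laplacian d f x + laplacian d g x := by
  simp only [laplacian, ← Finset.sum_add_distrib]
  refine Finset.sum_congr rfl fun j _ => ?_
  have h : (fun y => fderiv ℝ (fun y => f y + g y) y (stdBasis d j)) =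
      fun y => fderiv ℝ f y (stdBasis d j) + fderiv ℝ g y (stdBasis d j) := by
    funext y
    rw [fderiv_fun_add (hf.differentiable two_ne_zero y) (hg.differentiable two_ne_zero y)]
    rfl
  rw [h, fderiv_fun_add ((contDiff_fderiv_apply hf _).differentiable one_ne_zero x)
    ((contDiff_fderiv_apply hg _).differentiable one_ne_zero x)]
  rfl

lemma laplacian_const_mul {f : EuclideanSpace ℝ (Fin d) → ℂ} (hf : ContDiff ℝ 2 f) (c : ℂ)
    (x : EuclideanSpace ℝ (Fin d)) :
    laplacian d (fun y => c * f y) x = c * laplacian d f x := by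
  simp only [laplacian, Finset.mul_sum]
  refine Finset.sum_congr rfl fun j _ => ?_
  have h : (fun y => fderiv ℝ (fun y => c * f y) y (stdBasis d j)) =
      fun y => c * fderiv ℝ f y (stdBasis d j) := by
    funext y
    rw [fderiv_const_mul (hf.differentiable two_ne_zero y)]
    rfl
  rw [h, fderiv_const_mul ((contDiff_fderiv_apply hf _).differentiable one_ne_zero x)]
  rfl

lemma laplacian_sub {f g : EuclideanSpace ℝ (Fin d) → ℂ} (hf : ContDiff ℝ 2 f)
    (hg : ContDiff ℝ 2 g) (x : EuclideanSpace ℝ (Fin d)) :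
    laplacian d (fun y => f y - g y) x = laplacian d f x - laplacian d g x := by
  have h : (fun y => f y - g y) = fun y => f y + (-1) * g y := by funext y; ring
  rw [h, laplacian_add hf (contDiff_const.mul hg), laplacian_const_mul hg]
  ring

/-- Necessary first- and second-order conditions at a local maximum of a function on the line. -/
lemma IsLocalMax.second_derivative_nonpos {q q' : ℝ → ℝ} {c s : ℝ} (hmax : IsLocalMax q s)
    (hq : ∀ᶠ r in nhds s, HasDerivAt q (q' r) r) (hq' : HasDerivAt q' c s) : c ≤ 0 := by
  by_contra! hc
  have hd : deriv q =ᶠ[nhds s] q' := hq.mono fun r hr => hr.deriv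
  have h0 : q' s = 0 := by rw [← hd.eq_of_nhds]; exact hmax.deriv_eq_zero
  have hdd : deriv (deriv q) s = c := by rw [hd.deriv_eq, hq'.deriv]
  have hmin : IsLocalMin q s := isLocalMin_of_deriv_deriv_pos (by rw [hdd]; exact hc)
    hmax.deriv_eq_zero hq.self_of_nhds.continuousAt
  have hconst : q =ᶠ[nhds s] fun _ => q s := by
    filter_upwards [hmax, hmin] with r h1 h2 using le_antisymm h1 h2
  have : deriv q =ᶠ[nhds s] fun _ => 0 := by
    simpa using hconst.deriv
  rw [this.deriv_eq] at hdd
  simp at hdd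
  exact hc.ne hdd

lemma HasDerivAt.re_const_mul {q : ℝ → ℂ} {q' : ℂ} {s : ℝ} (h : HasDerivAt q q' s) (θ : ℂ) :
    HasDerivAt (fun s => (θ * q s).re) (θ * q').re s :=
  Complex.reCLM.hasFDerivAt.comp_hasDerivAt s (h.const_mul θ)

/-- The maximum principle at a point: where `Re (θ f)` is maximal, its first derivatives vanish and
its Laplacian is nonpositive. -/
lemma fderiv_eq_zero_and_laplacian_nonpos_of_max {f : EuclideanSpace ℝ (Fin d) → ℂ}
    (hf : ContDiff ℝ 2 f) {θ : ℂ} {x : EuclideanSpace ℝ (Fin d)}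
    (hmax : ∀ y, (θ * f y).re ≤ (θ * f x).re) :
    (∀ v, (θ * fderiv ℝ f x v).re = 0) ∧ (θ * laplacian d f x).re ≤ 0 := by
  have hline : ∀ v : EuclideanSpace ℝ (Fin d),
      IsLocalMax (fun s : ℝ => (θ * f (x + s • v)).re) 0 := fun v =>
    Filter.Eventually.of_forall fun s => by simpa using hmax (x + s • v)
  have hq := fun (v : EuclideanSpace ℝ (Fin d)) (s : ℝ) =>
    (hasDerivAt_along_line (hf.of_le one_le_two) x v s).re_const_mul θ
  constructor
  · intro v
    simpa using (hline v).hasDerivAt_eq_zero (hq v 0)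
  · rw [laplacian, Finset.mul_sum, Complex.re_sum]
    refine Finset.sum_nonpos fun j _ => ?_
    have h2 := (hasDerivAt_along_line (contDiff_fderiv_apply hf (stdBasis d j)) x
      (stdBasis d j) 0).re_const_mul θ
    simpa using (hline (stdBasis d j)).second_derivative_nonpos
      (Filter.Eventually.of_forall (hq (stdBasis d j))) h2

/-- A complex number is bounded in norm as soon as all its rotations have bounded real part. -/
lemma norm_le_of_forall_re_mul_le {z : ℂ} {M : ℝ}
    (h : ∀ θ : ℂ, ‖θ‖ = 1 → (θ * z).re ≤ M) : ‖z‖ ≤ M := by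
  by_cases hz : z = 0
  · simpa [hz] using h 1 (by simp)
  have hn : (‖z‖ : ℂ) ≠ 0 := by simpa using hz
  have h1 := h ((starRingEnd ℂ) z / ‖z‖) (by simp [hz])
  have h2 : (starRingEnd ℂ) z / ‖z‖ * z = (‖z‖ : ℂ) := by
    rw [div_mul_eq_mul_div, mul_comm, Complex.mul_conj, Complex.normSq_eq_norm_sq]
    push_cast
    field_simp
  rwa [h2, Complex.ofReal_re] at h1

lemma re_mul_le_norm {θ : ℂ} (hθ : ‖θ‖ = 1) (z : ℂ) : (θ * z).re ≤ ‖z‖ := by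
  simpa [hθ] using Complex.re_le_norm (θ * z)

lemma neg_norm_le_re_mul {θ : ℂ} (hθ : ‖θ‖ = 1) (z : ℂ) : -‖z‖ ≤ (θ * z).re := by
  have := Complex.abs_re_le_norm (θ * z)
  rw [norm_mul, hθ, one_mul] at this
  exact (abs_le.1 this).1

end Calculus

section Resolvent

variable {d : ℕ}

lemma mFourier_toTorus (k : Fin d → ℤ) (x : EuclideanSpace ℝ (Fin d)) :
    UnitAddTorus.mFourier k (toTorus d x) = Complex.exp (Complex.I * ∑ j, (k j : ℂ) * x j) := by
  have hpi : (Real.pi : ℂ) ≠ 0 := by exact_mod_cast Real.pi_ne_zero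
  simp only [UnitAddTorus.mFourier, ContinuousMap.coe_mk, toTorus, fourier_coe_apply]
  rw [← Complex.exp_sum, Finset.mul_sum]
  congr 1
  refine Finset.sum_congr rfl fun j _ => ?_
  push_cast
  field_simp

lemma isPeriodic_comp_toTorus {α : Type*} (F : UnitAddTorus (Fin d) → α) :
    IsPeriodic (fun x => F (toTorus d x)) := by
  intro x j
  suffices h : toTorus d (x + (2 * Real.pi) • stdBasis d j) = toTorus d x by simp only [h]
  funext i
  have hpi : (2 * Real.pi) ≠ 0 := Real.two_pi_pos.ne'
  simp only [toTorus]
  by_cases hij : i = j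
  · subst hij
    have : (x + (2 * Real.pi) • stdBasis d i) i / (2 * Real.pi) = x i / (2 * Real.pi) + 1 := by
      simp [stdBasis]
      field_simp
    rw [this]
    exact AddCircle.coe_add_period 1 _
  · simp [stdBasis, hij]

lemma contDiff_exp_wave (k : Fin d → ℤ) : ContDiff ℝ 2
    (fun x : EuclideanSpace ℝ (Fin d) => Complex.exp (Complex.I * ∑ j, (k j : ℂ) * x j)) := by
  refine ContDiff.cexp (contDiff_const.mul (ContDiff.sum fun j _ => contDiff_const.mul ?_))
  exact Complex.ofRealCLM.contDiff.comp (EuclideanSpace.proj (𝕜 := ℝ) j).contDiff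

lemma fderiv_exp_wave (k : Fin d → ℤ) (x : EuclideanSpace ℝ (Fin d)) (j : Fin d) :
    fderiv ℝ (fun x : EuclideanSpace ℝ (Fin d) =>
      Complex.exp (Complex.I * ∑ j, (k j : ℂ) * x j)) x (stdBasis d j) =
    (Complex.I * k j) * Complex.exp (Complex.I * ∑ j, (k j : ℂ) * x j) := by
  have h1 := hasDerivAt_along_line ((contDiff_exp_wave k).of_le one_le_two) x (stdBasis d j) 0
  have h2 : HasDerivAt (fun s : ℝ => Complex.exp (Complex.I *
      ∑ i, (k i : ℂ) * ((x + s • stdBasis d j) i : ℝ)))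
      ((Complex.I * k j) * Complex.exp (Complex.I * ∑ i, (k i : ℂ) * x i)) 0 := by
    have h3 : (fun s : ℝ => Complex.exp (Complex.I *
        ∑ i, (k i : ℂ) * ((x + s • stdBasis d j) i : ℝ))) = fun s : ℝ =>
        Complex.exp (Complex.I * (∑ i, (k i : ℂ) * x i + s * k j)) := by
      funext s
      congr 2
      simp [stdBasis, mul_add, Finset.sum_add_distrib, apply_ite Complex.ofReal,
        mul_comm]
    rw [h3]
    have h4 : HasDerivAt (fun s : ℝ => (s : ℂ)) 1 0 := Complex.ofRealCLM.hasDerivAt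
    have h5 := (((h4.mul_const (k j : ℂ)).const_add (∑ i, (k i : ℂ) * x i)).const_mul
      Complex.I).cexp
    convert h5 using 1
    simp
    ring
  simpa using h1.unique h2

lemma laplacian_exp_wave (k : Fin d → ℤ) (x : EuclideanSpace ℝ (Fin d)) :
    laplacian d (fun x => Complex.exp (Complex.I * ∑ j, (k j : ℂ) * x j)) x =
    -((∑ j, (k j : ℝ) ^ 2 : ℝ) : ℂ) * Complex.exp (Complex.I * ∑ j, (k j : ℂ) * x j) := by
  simp only [laplacian, fderiv_exp_wave]
  push_cast
  rw [← Finset.sum_neg_distrib, Finset.sum_mul]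
  refine Finset.sum_congr rfl fun j _ => ?_
  rw [fderiv_const_mul ((contDiff_exp_wave k).differentiable two_ne_zero x)]
  change Complex.I * k j * fderiv ℝ _ x (stdBasis d j) = _
  rw [fderiv_exp_wave]
  linear_combination (k j : ℂ) ^ 2 * Complex.exp (Complex.I * ∑ j, (k j : ℂ) * x j) *
    Complex.I_sq

/-- The operator `1 - hΔ` on `C²` periodic functions has dense range in the continuous periodic
functions. -/
lemma exists_approx_heat_resolvent {g : EuclideanSpace ℝ (Fin d) → ℂ} (hp : IsPeriodic g)
    (hg : Continuous g) {h ε : ℝ} (hh : 0 ≤ h) (hε : 0 < ε) :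
    ∃ f : EuclideanSpace ℝ (Fin d) → ℂ, ContDiff ℝ 2 f ∧ IsPeriodic f ∧
      ∀ x, ‖f x - h * laplacian d f x - g x‖ ≤ ε := by
  obtain ⟨G, hG⟩ := hp.exists_lift hg
  have hmem : G ∈ (Submodule.span ℂ
      (Set.range (UnitAddTorus.mFourier (d := Fin d)))).topologicalClosure := by
    rw [UnitAddTorus.span_mFourier_closure_eq_top]; trivial
  obtain ⟨P, hP, hGP⟩ := Metric.mem_closure_iff.1 hmem ε hε
  have key : ∃ f : EuclideanSpace ℝ (Fin d) → ℂ, ContDiff ℝ 2 f ∧ IsPeriodic f ∧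
      ∀ x, f x - h * laplacian d f x = P (toTorus d x) := by
    clear hGP
    induction hP using Submodule.span_induction with
    | mem P hP =>
      obtain ⟨k, rfl⟩ := hP
      have hpos : (0 : ℝ) < 1 + h * ∑ j, (k j : ℝ) ^ 2 := by positivity
      have hne : (1 + h * ((∑ j, (k j : ℝ) ^ 2 : ℝ) : ℂ)) ≠ 0 := by exact_mod_cast hpos.ne'
      refine ⟨fun x => (1 + h * ((∑ j, (k j : ℝ) ^ 2 : ℝ) : ℂ))⁻¹ *
        Complex.exp (Complex.I * ∑ j, (k j : ℂ) * x j),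
        contDiff_const.mul (contDiff_exp_wave k), ?_, fun x => ?_⟩
      · simp only [← mFourier_toTorus]
        exact isPeriodic_comp_toTorus fun y => _ * UnitAddTorus.mFourier k y
      · rw [laplacian_const_mul (contDiff_exp_wave k), laplacian_exp_wave, mFourier_toTorus]
        field_simp
        ring
    | zero => exact ⟨fun _ => 0, contDiff_const, fun _ _ => rfl, fun x => by simp [laplacian]⟩
    | add P Q _ _ hP hQ =>
      obtain ⟨f₁, h₁, p₁, e₁⟩ := hP
      obtain ⟨f₂, h₂, p₂, e₂⟩ := hQ
      refine ⟨fun x => f₁ x + f₂ x, h₁.add h₂, fun x j => by simp only [p₁ x j, p₂ x j],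
        fun x => ?_⟩
      rw [laplacian_add h₁ h₂, ContinuousMap.add_apply, ← e₁, ← e₂]
      ring
    | smul c P _ hP =>
      obtain ⟨f, h₁, p₁, e₁⟩ := hP
      refine ⟨fun x => c * f x, contDiff_const.mul h₁, fun x j => by simp only [p₁ x j],
        fun x => ?_⟩
      rw [laplacian_const_mul h₁, ContinuousMap.smul_apply, ← e₁, smul_eq_mul]
      ring
  obtain ⟨f, hf, pf, ef⟩ := key
  refine ⟨f, hf, pf, fun x => ?_⟩
  rw [ef, ← hG, ← dist_eq_norm, dist_comm]
  exact (ContinuousMap.dist_apply_le_dist _).trans hGP.le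

end Resolvent

section OneSided

lemma HasDerivWithinAt.nonneg_of_min_right {p : ℝ → ℝ} {p' s r : ℝ} (hsr : s < r)
    (h : HasDerivWithinAt p p' (Set.Ioi s) s) (hp : ∀ y ∈ Set.Ioo s r, p s ≤ p y) : 0 ≤ p' := by
  rw [hasDerivWithinAt_iff_tendsto_slope' (by simp)] at h
  refine ge_of_tendsto h ?_
  filter_upwards [Ioo_mem_nhdsGT hsr] with y hy
  rw [slope_def_field]
  exact div_nonneg (sub_nonneg.2 (hp y hy)) (sub_nonneg.2 hy.1.le)

lemma HasDerivWithinAt.nonneg_of_max_left {p : ℝ → ℝ} {p' s r : ℝ} (hrs : r < s)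
    (h : HasDerivWithinAt p p' (Set.Iio s) s) (hp : ∀ y ∈ Set.Ioo r s, p y ≤ p s) : 0 ≤ p' := by
  rw [hasDerivWithinAt_iff_tendsto_slope' (by simp)] at h
  refine ge_of_tendsto h ?_
  filter_upwards [Ioo_mem_nhdsLT hrs] with y hy
  rw [slope_def_field]
  exact div_nonneg_of_nonpos (sub_nonpos.2 (hp y hy)) (sub_nonpos.2 hy.2.le)

end OneSided

section GradientEstimate

variable {d : ℕ}

/-- The barrier estimate for symmetric differences of a function with bounded Laplacian. -/
lemma re_symm_diff_le_barrier {f : EuclideanSpace ℝ (Fin d) → ℂ} (hf : ContDiff ℝ 2 f)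
    (hp : IsPeriodic f) {M b ℓ : ℝ} (hM : ∀ x, ‖f x‖ ≤ M) (hb : ∀ x, ‖laplacian d f x‖ < b)
    (hℓ : 0 < ℓ) {θ : ℂ} (hθ : ‖θ‖ = 1) (j : Fin d) (x : EuclideanSpace ℝ (Fin d)) {s : ℝ}
    (hs : s ∈ Set.Icc 0 ℓ) :
    (θ * (f (x + s • stdBasis d j) - f (x + s • -stdBasis d j))).re ≤
      (2 * M / ℓ + b * ℓ) * s - b * s ^ 2 := by
  set e := stdBasis d j with he
  set a := 2 * M / ℓ + b * ℓ with ha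
  let W : EuclideanSpace ℝ (Fin d) × ℝ → ℝ := fun z =>
    (θ * (f (z.1 + z.2 • e) - f (z.1 + z.2 • -e))).re - (a * z.2 - b * z.2 ^ 2)
  have hfc := hf.continuous
  have hWc : Continuous W := by fun_prop
  have hWp : ∀ r, IsPeriodic fun y => W (y, r) := fun r y k => by
    simp only [W]
    rw [add_right_comm, hp, add_right_comm y _ (r • -e), hp]
  obtain ⟨⟨x₀, s₀⟩, hmem, hmax⟩ :=
    ((isCompact_cube d).prod (isCompact_Icc (a := 0) (b := ℓ))).exists_isMaxOn
    ⟨(0, 0), zero_mem_cube d, le_rfl, hℓ.le⟩ hWc.continuousOn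
  have hs₀ : s₀ ∈ Set.Icc 0 ℓ := hmem.2
  have hall : ∀ y, ∀ r ∈ Set.Icc 0 ℓ, W (y, r) ≤ W (x₀, s₀) := by
    intro y r hr
    obtain ⟨n, hn⟩ := exists_mem_cube_congr y
    rw [← (hWp r).add_int_combination n y]
    exact hmax (Set.mk_mem_prod hn hr)
  suffices h : W (x₀, s₀) ≤ 0 by
    have := (hall x s hs).trans h
    simp only [W] at this
    linarith
  by_contra! hpos
  have hs0 : s₀ ≠ 0 := by
    rintro rfl
    simp [W] at hpos
  have hsℓ : s₀ ≠ ℓ := by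
    rintro rfl
    have h1 : (θ * (f (x₀ + s₀ • e) - f (x₀ + s₀ • -e))).re ≤ 2 * M := by
      have h2 := re_mul_le_norm hθ (f (x₀ + s₀ • e) - f (x₀ + s₀ • -e))
      have h3 := norm_sub_le (f (x₀ + s₀ • e)) (f (x₀ + s₀ • -e))
      linarith [hM (x₀ + s₀ • e), hM (x₀ + s₀ • -e)]
    have h4 : a * s₀ - b * s₀ ^ 2 = 2 * M := by
      rw [ha]; field_simp; ring
    simp only [W] at hpos
    linarith
  have hmem_Ioo : s₀ ∈ Set.Ioo 0 ℓ := ⟨lt_of_le_of_ne hs₀.1 hs0.symm, lt_of_le_of_ne hs₀.2 hsℓ⟩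
  have hf1 : ContDiff ℝ 1 f := hf.of_le one_le_two
  set xp := x₀ + s₀ • e with hxp
  set xm := x₀ + s₀ • -e with hxm
  let D : Fin d → ℂ := fun i =>
    fderiv ℝ (fun y => fderiv ℝ f y (stdBasis d i)) xp (stdBasis d i) -
      fderiv ℝ (fun y => fderiv ℝ f y (stdBasis d i)) xm (stdBasis d i)
  have hD : ∀ i, (θ * D i).re ≤ 0 := by
    intro i
    have hq := fun r : ℝ => ((hasDerivAt_along_line hf1 xp (stdBasis d i) r).sub
      (hasDerivAt_along_line hf1 xm (stdBasis d i) r)).re_const_mul θ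
    have hq' := ((hasDerivAt_along_line (contDiff_fderiv_apply hf (stdBasis d i)) xp
      (stdBasis d i) 0).sub (hasDerivAt_along_line (contDiff_fderiv_apply hf (stdBasis d i)) xm
      (stdBasis d i) 0)).re_const_mul θ
    have hloc : IsLocalMax (fun r : ℝ => (θ * (f (xp + r • stdBasis d i) -
        f (xm + r • stdBasis d i))).re) 0 := by
      refine Filter.Eventually.of_forall fun r => ?_
      have h1 := hall (x₀ + r • stdBasis d i) s₀ hs₀
      simp only [W] at h1
      simp only [zero_smul, add_zero, hxp, hxm]
      rw [add_right_comm x₀ (s₀ • e), add_right_comm x₀ (s₀ • -e)]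
      linarith
    have h2 := hloc.second_derivative_nonpos (Filter.Eventually.of_forall hq) hq'
    simpa [D] using h2
  have hDj : (θ * D j).re + 2 * b ≤ 0 := by
    have hpoly := fun r : ℝ => (((hasDerivAt_id r).const_mul a).sub
      (((hasDerivAt_id r).pow 2).const_mul b))
    have hq := fun r : ℝ => (((hasDerivAt_along_line hf1 x₀ e r).sub
      (hasDerivAt_along_line hf1 x₀ (-e) r)).re_const_mul θ).sub (hpoly r)
    have hlin := ((hasDerivAt_id s₀).const_mul (2 * b)).const_sub a
    have hq' := (((hasDerivAt_along_line (contDiff_fderiv_apply hf e) x₀ e s₀).sub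
      (hasDerivAt_along_line (contDiff_fderiv_apply hf (-e)) x₀ (-e) s₀)).re_const_mul θ).sub hlin
    have hloc : IsLocalMax (fun r : ℝ => W (x₀, r)) s₀ := by
      filter_upwards [Ioo_mem_nhds hmem_Ioo.1 hmem_Ioo.2] with r hr
      exact hall x₀ r ⟨hr.1.le, hr.2.le⟩
    have h2 := hloc.second_derivative_nonpos (Filter.Eventually.of_forall hq)
      (hq'.congr_of_eventuallyEq
        (Filter.Eventually.of_forall fun r => by
          simp
          ring))
    have h3 : fderiv ℝ (fun y => fderiv ℝ f y (-e)) xm (-e) =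
        fderiv ℝ (fun y => fderiv ℝ f y e) xm e := by
      have : (fun y => fderiv ℝ f y (-e)) = fun y => -fderiv ℝ f y e := by
        funext y; simp
      rw [this, fderiv_fun_neg]
      simp
    rw [h3] at h2
    simp only [D, ← he]
    linarith
  have hsum : (θ * (laplacian d f xp - laplacian d f xm)).re + 2 * b ≤ 0 := by
    have h1 : laplacian d f xp - laplacian d f xm = ∑ i, D i := by
      simp only [laplacian, D, Finset.sum_sub_distrib]
    rw [h1, Finset.mul_sum, Complex.re_sum]
    have h2 : ∑ i, (θ * D i).re ≤ (θ * D j).re := by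
      rw [← Finset.add_sum_erase _ _ (Finset.mem_univ j)]
      linarith [Finset.sum_nonpos fun i (_ : i ∈ Finset.univ.erase j) => hD i]
    linarith
  have h1 := neg_norm_le_re_mul hθ (laplacian d f xp - laplacian d f xm)
  have h2 := norm_sub_le (laplacian d f xp) (laplacian d f xm)
  linarith [hb xp, hb xm]

/-- Interpolation: the gradient is controlled by the function and its Laplacian. -/
lemma norm_fderiv_stdBasis_le {f : EuclideanSpace ℝ (Fin d) → ℂ} (hf : ContDiff ℝ 2 f)
    (hp : IsPeriodic f) {M b ℓ : ℝ} (hM : ∀ x, ‖f x‖ ≤ M) (hb : ∀ x, ‖laplacian d f x‖ < b)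
    (hℓ : 0 < ℓ) (x : EuclideanSpace ℝ (Fin d)) (j : Fin d) :
    ‖fderiv ℝ f x (stdBasis d j)‖ ≤ M / ℓ + b * ℓ / 2 := by
  refine norm_le_of_forall_re_mul_le fun θ hθ => ?_
  have hf1 : ContDiff ℝ 1 f := hf.of_le one_le_two
  have hd := ((((hasDerivAt_id (0 : ℝ)).const_mul (2 * M / ℓ + b * ℓ)).sub
    (((hasDerivAt_id (0 : ℝ)).pow 2).const_mul b))).sub
    (((hasDerivAt_along_line hf1 x (stdBasis d j) 0).sub
      (hasDerivAt_along_line hf1 x (-stdBasis d j) 0)).re_const_mul θ)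
  have h := hd.hasDerivWithinAt.nonneg_of_min_right hℓ fun y hy => by
    have := re_symm_diff_le_barrier hf hp hM hb hℓ hθ j x ⟨hy.1.le, hy.2.le⟩
    simp at this ⊢
    linarith
  simp at h
  have h4 : 2 * M / ℓ = 2 * (M / ℓ) := by ring
  rw [h4] at h
  simp only [Complex.mul_re]
  linarith

end GradientEstimate

section AdvectionDiffusion

variable {d : ℕ}

/-- The advection–diffusion operator `f ↦ Δf - A u·∇f`. -/
noncomputable def advDiff (u : EuclideanSpace ℝ (Fin d) → EuclideanSpace ℝ (Fin d)) (A : ℝ)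
    (f : EuclideanSpace ℝ (Fin d) → ℂ) (x : EuclideanSpace ℝ (Fin d)) : ℂ :=
  laplacian d f x - (A : ℂ) * fderiv ℝ f x (u x)

variable {u : EuclideanSpace ℝ (Fin d) → EuclideanSpace ℝ (Fin d)} {A : ℝ}
  {f g : EuclideanSpace ℝ (Fin d) → ℂ}

lemma advDiff_add (hf : ContDiff ℝ 2 f) (hg : ContDiff ℝ 2 g) (x : EuclideanSpace ℝ (Fin d)) :
    advDiff u A (fun y => f y + g y) x = advDiff u A f x + advDiff u A g x := by
  simp only [advDiff, laplacian_add hf hg]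
  rw [fderiv_fun_add (hf.differentiable two_ne_zero x) (hg.differentiable two_ne_zero x),
    add_apply]
  ring

lemma advDiff_sub (hf : ContDiff ℝ 2 f) (hg : ContDiff ℝ 2 g) (x : EuclideanSpace ℝ (Fin d)) :
    advDiff u A (fun y => f y - g y) x = advDiff u A f x - advDiff u A g x := by
  simp only [advDiff, laplacian_sub hf hg]
  rw [fderiv_fun_sub (hf.differentiable two_ne_zero x) (hg.differentiable two_ne_zero x),
    sub_apply]
  ring

lemma continuous_advDiff (hu : Continuous u) (hf : ContDiff ℝ 2 f) :
    Continuous (advDiff u A f) :=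
  (continuous_laplacian hf).sub
    (continuous_const.mul (continuous_fderiv_apply_field (hf.of_le one_le_two) hu))

lemma IsPeriodic.advDiff (hu : IsPeriodic u) (hp : IsPeriodic f) :
    IsPeriodic (advDiff u A f) := fun x j => by
  simp only [_root_.advDiff, hp.laplacian x j, hp.fderiv x j, hu x j]

lemma re_advDiff_nonpos_of_max (hf : ContDiff ℝ 2 f) {θ : ℂ} {x : EuclideanSpace ℝ (Fin d)}
    (hmax : ∀ y, (θ * f y).re ≤ (θ * f x).re) : (θ * advDiff u A f x).re ≤ 0 := by
  obtain ⟨h1, h2⟩ := fderiv_eq_zero_and_laplacian_nonpos_of_max hf hmax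
  have h3 : θ * advDiff u A f x =
      θ * laplacian d f x - (A : ℂ) * (θ * fderiv ℝ f x (u x)) := by
    simp only [advDiff]; ring
  rw [h3, Complex.sub_re, Complex.re_ofReal_mul, h1]
  linarith

/-- The advection–diffusion operator is dissipative in the sup norm. -/
lemma norm_le_of_resolvent_norm_le (hf : ContDiff ℝ 2 f) (hp : IsPeriodic f) {h M : ℝ}
    (hh : 0 ≤ h) (hM : ∀ x, ‖f x - h * advDiff u A f x‖ ≤ M) (x : EuclideanSpace ℝ (Fin d)) :
    ‖f x‖ ≤ M := by
  refine norm_le_of_forall_re_mul_le fun θ hθ => ?_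
  have hfc := hf.continuous
  obtain ⟨x₀, hx₀⟩ := IsPeriodic.exists_forall_ge (g := fun y => (θ * f y).re)
    (fun y j => by simp only [hp y j]) (by fun_prop)
  have h1 := re_advDiff_nonpos_of_max (u := u) (A := A) hf hx₀
  have h2 := (re_mul_le_norm hθ (f x₀ - h * advDiff u A f x₀)).trans (hM x₀)
  have h3 : θ * (f x₀ - h * advDiff u A f x₀) =
      θ * f x₀ - (h : ℂ) * (θ * advDiff u A f x₀) := by ring
  rw [h3, Complex.sub_re, Complex.re_ofReal_mul] at h2
  nlinarith [hx₀ x]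

lemma norm_fderiv_apply_le {x v : EuclideanSpace ℝ (Fin d)} {B U : ℝ} (hv : ‖v‖ ≤ U)
    (hB : ∀ j, ‖fderiv ℝ f x (stdBasis d j)‖ ≤ B) : ‖fderiv ℝ f x v‖ ≤ d * (U * B) := by
  have hU : 0 ≤ U := (norm_nonneg _).trans hv
  have hv' : v = ∑ j, v j • stdBasis d j := by
    ext i
    simp [stdBasis, Pi.single_apply]
  rw [hv', map_sum]
  calc ‖∑ j, fderiv ℝ f x (v j • stdBasis d j)‖
      ≤ ∑ j : Fin d, U * B := by
        refine norm_sum_le_of_le _ fun j _ => ?_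
        rw [map_smul, norm_smul]
        exact mul_le_mul ((PiLp.norm_apply_le v j).trans hv) (hB j) (norm_nonneg _) hU
    _ = d * (U * B) := by simp

/-- The drift is a small perturbation of the heat resolvent for small time steps. -/
lemma exists_step_drift_le (hu : IsPeriodic u) (huc : Continuous u) (A : ℝ) :
    ∃ h₀ > 0, ∀ h : ℝ, 0 < h → h ≤ h₀ → ∀ f : EuclideanSpace ℝ (Fin d) → ℂ, ContDiff ℝ 2 f →
      IsPeriodic f → ∀ M : ℝ, 0 < M → (∀ x, ‖f x - h * laplacian d f x‖ ≤ M) →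
      ∀ x, ‖(h : ℂ) * ((A : ℂ) * fderiv ℝ f x (u x))‖ ≤ M / 2 := by
  obtain ⟨U, hU0, hU⟩ := hu.exists_norm_le huc
  set K := |A| * (d * U) with hK
  have hK0 : 0 ≤ K := by positivity
  refine ⟨(1 / (5 * (K + 1))) ^ 2, by positivity, fun h hh hle f hf hp M hM hres x => ?_⟩
  set ℓ := Real.sqrt h with hℓ
  have hℓ0 : 0 < ℓ := Real.sqrt_pos.2 hh
  have hhℓ : h = ℓ ^ 2 := (Real.sq_sqrt hh.le).symm
  have hℓle : ℓ ≤ 1 / (5 * (K + 1)) := by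
    rw [hℓ]; exact (Real.sqrt_le_left (by positivity)).2 hle
  have hfM : ∀ y, ‖f y‖ ≤ M := norm_le_of_resolvent_norm_le (u := u) (A := 0) hf hp hh.le
    (fun y => by simpa [advDiff] using hres y)
  have hlap : ∀ y, ‖laplacian d f y‖ < 3 * M / h := fun y => by
    rw [lt_div_iff₀ hh]
    have h1 : ‖(h : ℂ) * laplacian d f y‖ ≤ ‖f y‖ + ‖f y - h * laplacian d f y‖ := by
      have := norm_sub_le (f y) (f y - h * laplacian d f y)
      rwa [sub_sub_cancel] at this
    rw [norm_mul, Complex.norm_real, Real.norm_of_nonneg hh.le] at h1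
    linarith [hfM y, hres y]
  have hgrad := norm_fderiv_apply_le (hU x) fun j =>
    norm_fderiv_stdBasis_le hf hp hfM hlap hℓ0 x j
  rw [norm_mul, norm_mul, Complex.norm_real, Complex.norm_real, Real.norm_of_nonneg hh.le,
    Real.norm_eq_abs]
  calc h * (|A| * ‖fderiv ℝ f x (u x)‖)
      ≤ h * (|A| * (d * (U * (M / ℓ + 3 * M / h * ℓ / 2)))) := by gcongr
    _ = K * ℓ * (5 / 2) * M := by
        rw [hK, hhℓ]
        field_simp
        ring
    _ ≤ M / 2 := by
        have h1 : K * ℓ ≤ 1 / 5 := by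
          calc K * ℓ ≤ (K + 1) * (1 / (5 * (K + 1))) := by gcongr; linarith
            _ = 1 / 5 := by field_simp
        nlinarith

/-- For small time steps, `1 - h (Δ - A u·∇)` has dense range. -/
lemma exists_approx_resolvent (hu : IsPeriodic u) (huc : Continuous u) (A : ℝ) :
    ∃ h₀ > 0, ∀ h : ℝ, 0 < h → h ≤ h₀ → ∀ g : EuclideanSpace ℝ (Fin d) → ℂ, IsPeriodic g →
      Continuous g → ∀ ε : ℝ, 0 < ε → ∃ f : EuclideanSpace ℝ (Fin d) → ℂ, ContDiff ℝ 2 f ∧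
        IsPeriodic f ∧ ∀ x, ‖f x - h * advDiff u A f x - g x‖ ≤ ε := by
  obtain ⟨h₀, hh₀, hstep⟩ := exists_step_drift_le hu huc A
  refine ⟨h₀, hh₀, fun h hh hle => ?_⟩
  have key : ∀ k : ℕ, ∀ M : ℝ, 0 < M → ∀ g : EuclideanSpace ℝ (Fin d) → ℂ, IsPeriodic g →
      Continuous g → (∀ x, ‖g x‖ ≤ M) → ∃ f : EuclideanSpace ℝ (Fin d) → ℂ, ContDiff ℝ 2 f ∧
        IsPeriodic f ∧ ∀ x, ‖f x - h * advDiff u A f x - g x‖ ≤ (3 / 4) ^ k * M := by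
    intro k
    induction k with
    | zero =>
      intro M hM g _ _ hgM
      exact ⟨fun _ => 0, contDiff_const, fun _ _ => rfl,
        fun x => by simpa [advDiff, laplacian] using hgM x⟩
    | succ k ih =>
      intro M hM g hg hgc hgM
      obtain ⟨f₀, hf₀, pf₀, ef₀⟩ := exists_approx_heat_resolvent hg hgc hh.le
        (show 0 < M / 10 by positivity)
      have hheat : ∀ x, ‖f₀ x - h * laplacian d f₀ x‖ ≤ 11 / 10 * M := fun x => by
        have := norm_add_le (f₀ x - h * laplacian d f₀ x - g x) (g x)
        rw [sub_add_cancel] at this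
        linarith [ef₀ x, hgM x]
      have hdrift := hstep h hh hle f₀ hf₀ pf₀ _ (by positivity) hheat
      have hf₀c := hf₀.continuous
      have hLc := continuous_advDiff (A := A) huc hf₀
      obtain ⟨f₁, hf₁, pf₁, ef₁⟩ := ih (3 / 4 * M) (by positivity)
        (fun x => g x - (f₀ x - h * advDiff u A f₀ x))
        (fun x j => by simp only [hg x j, pf₀ x j, (hu.advDiff (A := A) pf₀) x j])
        (by fun_prop) (fun x => by
          have h1 : g x - (f₀ x - h * advDiff u A f₀ x) =
              -(f₀ x - h * laplacian d f₀ x - g x) -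
                (h : ℂ) * ((A : ℂ) * fderiv ℝ f₀ x (u x)) := by
            simp only [advDiff]; ring
          rw [h1]
          have h2 := norm_sub_le (-(f₀ x - h * laplacian d f₀ x - g x))
            ((h : ℂ) * ((A : ℂ) * fderiv ℝ f₀ x (u x)))
          rw [norm_neg] at h2
          linarith [ef₀ x, hdrift x])
      refine ⟨fun x => f₀ x + f₁ x, hf₀.add hf₁, fun x j => by simp only [pf₀ x j, pf₁ x j],
        fun x => ?_⟩
      rw [advDiff_add hf₀ hf₁, pow_succ, mul_assoc]
      convert ef₁ x using 2
      ring
  intro g hg hgc ε hε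
  obtain ⟨M, hM0, hM⟩ := hg.exists_norm_le hgc
  obtain ⟨k, hk⟩ := exists_pow_lt_of_lt_one (show 0 < ε / (M + 1) by positivity)
    (show (3 / 4 : ℝ) < 1 by norm_num)
  obtain ⟨f, hf, pf, ef⟩ := key k (M + 1) (by positivity) g hg hgc
    fun x => (hM x).trans (by linarith)
  refine ⟨f, hf, pf, fun x => (ef x).trans ?_⟩
  rw [lt_div_iff₀ (by positivity)] at hk
  exact hk.le

/-- Approximate implicit Euler schemes exist for small time steps. -/
lemma exists_implicit_euler (hu : IsPeriodic u) (huc : Continuous u) (A : ℝ) :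
    ∃ h₀ > 0, ∀ h : ℝ, 0 < h → h ≤ h₀ → ∀ ε : ℝ, 0 < ε → ∀ f₀ : EuclideanSpace ℝ (Fin d) → ℂ,
      ContDiff ℝ 2 f₀ → IsPeriodic f₀ → ∃ f : ℕ → EuclideanSpace ℝ (Fin d) → ℂ, f 0 = f₀ ∧
        (∀ n, ContDiff ℝ 2 (f n)) ∧ (∀ n, IsPeriodic (f n)) ∧
        ∀ n x, ‖f (n + 1) x - h * advDiff u A (f (n + 1)) x - f n x‖ ≤ h * ε := by
  obtain ⟨h₀, hh₀, H⟩ := exists_approx_resolvent hu huc A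
  refine ⟨h₀, hh₀, fun h hh hle ε hε f₀ hf₀ pf₀ => ?_⟩
  let S := {f : EuclideanSpace ℝ (Fin d) → ℂ // ContDiff ℝ 2 f ∧ IsPeriodic f}
  have hS : ∀ g : S, ∃ f : S, ∀ x,
      ‖f.1 x - h * advDiff u A f.1 x - g.1 x‖ ≤ h * ε := fun g => by
    obtain ⟨f, hf, pf, ef⟩ := H h hh hle g.1 g.2.2 g.2.1.continuous _ (mul_pos hh hε)
    exact ⟨⟨f, hf, pf⟩, ef⟩
  choose F hF using hS
  let s : ℕ → S := fun n => Nat.rec ⟨f₀, hf₀, pf₀⟩ (fun _ g => F g) n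
  exact ⟨fun n => (s n).1, rfl, fun n => (s n).2.1, fun n => (s n).2.2, fun n x => hF (s n) x⟩

/-- Parabolic comparison with a time-independent function, for solutions whose derivatives exist
only pointwise. -/
lemma parabolic_comparison {φ : ℝ → EuclideanSpace ℝ (Fin d) → ℂ}
    (hφ_per : ∀ t, IsPeriodic (φ t)) (hφ_regx : ∀ t, 0 ≤ t → ContDiff ℝ 2 (φ t))
    (hφ_cont : Continuous fun p : ℝ × EuclideanSpace ℝ (Fin d) => φ p.1 p.2)
    (hφ_pde : ∀ x, ∀ t, 0 ≤ t →
      HasDerivWithinAt (fun s => φ s x) (advDiff u A (φ t) x) (Set.Ici 0) t)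
    (hf : ContDiff ℝ 2 f) (hp : IsPeriodic f) {θ : ℂ} {β β' : ℝ → ℝ}
    (hβ : ∀ t, HasDerivAt β (β' t) t) (h0 : ∀ x, (θ * (φ 0 x - f x)).re ≤ β 0)
    (hL : ∀ t, 0 ≤ t → ∀ x, β t < (θ * (φ t x - f x)).re → (θ * advDiff u A f x).re ≤ β' t)
    {t : ℝ} (ht : 0 ≤ t) (x : EuclideanSpace ℝ (Fin d)) :
    (θ * (φ t x - f x)).re ≤ β t := by
  have key : ∀ η > 0, (θ * (φ t x - f x)).re ≤ β t + η * t := by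
    intro η hη
    let W : ℝ × EuclideanSpace ℝ (Fin d) → ℝ := fun z =>
      (θ * (φ z.1 z.2 - f z.2)).re - (β z.1 + η * z.1)
    have hfc := hf.continuous
    have hβc : Continuous β := continuous_iff_continuousAt.2 fun t => (hβ t).continuousAt
    have hWc : Continuous W := by fun_prop
    obtain ⟨⟨t₀, x₀⟩, hmem, hmax⟩ := ((isCompact_Icc (a := 0) (b := t)).prod
      (isCompact_cube d)).exists_isMaxOn ⟨(0, 0), ⟨le_rfl, ht⟩, zero_mem_cube d⟩ hWc.continuousOn
    have ht₀ : t₀ ∈ Set.Icc 0 t := hmem.1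
    have hall : ∀ r ∈ Set.Icc 0 t, ∀ y, W (r, y) ≤ W (t₀, x₀) := by
      intro r hr y
      obtain ⟨n, hn⟩ := exists_mem_cube_congr y
      have hWp : IsPeriodic fun y => W (r, y) := fun y k => by
        simp only [W, hφ_per r y k, hp y k]
      rw [← hWp.add_int_combination n y]
      exact hmax (Set.mk_mem_prod hr hn)
    suffices h : W (t₀, x₀) ≤ 0 by
      have := (hall t ⟨ht, le_rfl⟩ x).trans h
      simp only [W] at this
      linarith
    by_contra! hpos
    have ht₀pos : 0 < t₀ := by
      refine lt_of_le_of_ne ht₀.1 fun h => ?_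
      rw [← h] at hpos
      simp only [W] at hpos
      linarith [h0 x₀]
    have hsp : (θ * advDiff u A (φ t₀) x₀).re ≤ (θ * advDiff u A f x₀).re := by
      have h1 := re_advDiff_nonpos_of_max (u := u) (A := A) (θ := θ) (x := x₀)
        ((hφ_regx t₀ ht₀.1).sub hf) fun y => by
          have := hall t₀ ht₀ y
          simp only [W] at this
          linarith
      have h2 : advDiff u A (fun x => φ t₀ x - f x) x₀ = advDiff u A (φ t₀) x₀ - advDiff u A f x₀ :=
        advDiff_sub (hφ_regx t₀ ht₀.1) hf x₀
      rw [h2, mul_sub, Complex.sub_re] at h1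
      linarith
    have htime : 0 ≤ (θ * advDiff u A (φ t₀) x₀).re - (β' t₀ + η) := by
      have h1 : HasDerivAt (fun s => φ s x₀) (advDiff u A (φ t₀) x₀) t₀ :=
        (hφ_pde x₀ t₀ ht₀.1).hasDerivAt (Ici_mem_nhds ht₀pos)
      have h2 := ((h1.sub_const (f x₀)).re_const_mul θ).sub
        ((hβ t₀).add ((hasDerivAt_id t₀).const_mul η))
      have h3 := h2.hasDerivWithinAt.nonneg_of_max_left ht₀pos fun y hy =>
        hall y ⟨hy.1.le, hy.2.le.trans ht₀.2⟩ x₀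
      rwa [mul_one] at h3
    have hβL := hL t₀ ht₀.1 x₀ (by
      simp only [W] at hpos
      nlinarith)
    linarith
  have hlim : Filter.Tendsto (fun η : ℝ => β t + η * t) (nhdsWithin 0 (Set.Ioi 0))
      (nhds (β t + 0 * t)) := by
    refine Filter.Tendsto.mono_left ?_ nhdsWithin_le_nhds
    exact (Continuous.tendsto (by fun_prop) 0)
  rw [zero_mul, add_zero] at hlim
  exact ge_of_tendsto hlim (by filter_upwards [self_mem_nhdsWithin] with η hη using key η hη)

/-- Quantitative convergence of approximate implicit Euler schemes. -/
lemma norm_sub_implicit_euler_le {φ : ℝ → EuclideanSpace ℝ (Fin d) → ℂ}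
    (hφ_per : ∀ t, IsPeriodic (φ t)) (hφ_regx : ∀ t, 0 ≤ t → ContDiff ℝ 2 (φ t))
    (hφ_cont : Continuous fun p : ℝ × EuclideanSpace ℝ (Fin d) => φ p.1 p.2)
    (hφ_pde : ∀ x, ∀ t, 0 ≤ t →
      HasDerivWithinAt (fun s => φ s x) (advDiff u A (φ t) x) (Set.Ici 0) t)
    {F : ℕ → EuclideanSpace ℝ (Fin d) → ℂ} (hF : ∀ n, ContDiff ℝ 2 (F n))
    (pF : ∀ n, IsPeriodic (F n)) {h ε δ C ρ κ : ℝ} (hh : 0 < h) (hε : 0 ≤ ε) (hκ : 0 ≤ κ)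
    (hC : ∀ x, ‖advDiff u A (F 0) x‖ ≤ C) (hδ : ∀ x, ‖φ 0 x - F 0 x‖ ≤ δ)
    (hstep : ∀ n x, ‖F (n + 1) x - h * advDiff u A (F (n + 1)) x - F n x‖ ≤ h * ε)
    (hρ : ∀ s, 0 ≤ s → (C + ε) * s + δ ≤ ρ + κ * s ^ 2) (n : ℕ) {t : ℝ} (ht : 0 ≤ t)
    (x : EuclideanSpace ℝ (Fin d)) :
    ‖φ t x - F n x‖ ≤ ρ + κ * ((t - n * h) ^ 2 + h * t) + ε * t := by
  have hdist : ∀ n x, ‖F n x - F 0 x‖ ≤ n * h * (C + ε) := by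
    intro n
    induction n with
    | zero => simp
    | succ n ih =>
      refine norm_le_of_resolvent_norm_le (u := u) (A := A) ((hF (n + 1)).sub (hF 0))
        (fun x j => by simp only [pF (n + 1) x j, pF 0 x j]) hh.le fun x => ?_
      have h1 : F (n + 1) x - F 0 x - h * advDiff u A (fun y => F (n + 1) y - F 0 y) x =
          (F (n + 1) x - h * advDiff u A (F (n + 1)) x - F n x) + (F n x - F 0 x) +
            h * advDiff u A (F 0) x := by
        rw [advDiff_sub (hF _) (hF _)]; ring
      rw [h1]
      refine (norm_add₃_le).trans ?_
      rw [norm_mul, Complex.norm_real, Real.norm_of_nonneg hh.le]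
      push_cast
      nlinarith [hstep n x, ih x, mul_le_mul_of_nonneg_left (hC x) hh.le]
  suffices H : ∀ n : ℕ, ∀ θ : ℂ, ‖θ‖ = 1 → ∀ t, 0 ≤ t → ∀ x,
      (θ * (φ t x - F n x)).re ≤ ρ + κ * ((t - n * h) ^ 2 + h * t) + ε * t from
    norm_le_of_forall_re_mul_le fun θ hθ => H n θ hθ t ht x
  intro n
  induction n with
  | zero =>
    intro θ hθ t ht x
    have h1 := parabolic_comparison hφ_per hφ_regx hφ_cont hφ_pde (hF 0) (pF 0) (θ := θ)
      (β := fun t => δ + C * t) (β' := fun _ => C)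
      (fun t => by simpa using ((hasDerivAt_id t).const_mul C).const_add δ)
      (fun x => by simpa using (re_mul_le_norm hθ _).trans (hδ x))
      (fun t _ x _ => (re_mul_le_norm hθ _).trans (hC x)) ht x
    have h2 := hρ t ht
    have h3 : 0 ≤ κ * (h * t) := by positivity
    have h4 : 0 ≤ ε * t := by positivity
    push_cast
    nlinarith
  | succ n ih =>
    intro θ hθ t ht x
    refine parabolic_comparison hφ_per hφ_regx hφ_cont hφ_pde (hF (n + 1)) (pF (n + 1))
      (β := fun t => ρ + κ * ((t - (n + 1 : ℕ) * h) ^ 2 + h * t) + ε * t)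
      (β' := fun t => κ * (2 * (t - (n + 1 : ℕ) * h) + h) + ε) (fun t => ?_) (fun x => ?_)
      (fun t ht x hlt => ?_) ht x
    · have h1 := (((((hasDerivAt_id t).sub_const ((n + 1 : ℕ) * h)).pow 2).add
        ((hasDerivAt_id t).const_mul h)).const_mul κ |>.const_add ρ).add
        ((hasDerivAt_id t).const_mul ε)
      refine (h1.congr_deriv ?_)
      simp
    · refine (re_mul_le_norm hθ _).trans ?_
      have h1 : ‖φ 0 x - F (n + 1) x‖ ≤ ‖φ 0 x - F 0 x‖ + ‖F (n + 1) x - F 0 x‖ := by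
        have := norm_sub_le (φ 0 x - F 0 x) (F (n + 1) x - F 0 x)
        rwa [sub_sub_sub_cancel_right] at this
      have h2 := hρ ((n + 1 : ℕ) * h) (by positivity)
      have h3 := hdist (n + 1) x
      simp only [mul_zero, add_zero, zero_sub, neg_sq]
      linarith [hδ x]
    · have h1 := ih θ hθ t ht x
      have h2 := neg_norm_le_re_mul hθ
        (F (n + 1) x - h * advDiff u A (F (n + 1)) x - F n x)
      have h3 : θ * (F (n + 1) x - h * advDiff u A (F (n + 1)) x - F n x) =
          θ * (φ t x - F n x) - θ * (φ t x - F (n + 1) x) -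
            (h : ℂ) * (θ * advDiff u A (F (n + 1)) x) := by ring
      rw [h3, Complex.sub_re, Complex.sub_re, Complex.re_ofReal_mul] at h2
      have h4 := hstep n x
      refine le_of_mul_le_mul_left ?_ hh
      push_cast at hlt ⊢
      nlinarith

end AdvectionDiffusion

section Energy

open ComplexConjugate

/-- The divergence theorem on the torus. -/
lemma integral_cube_divergence_eq_zero {d : ℕ} {G : Fin d → EuclideanSpace ℝ (Fin d) → ℂ}
    (hG : ∀ j, ContDiff ℝ 1 (G j)) (hp : ∀ j, IsPeriodic (G j)) :
    ∫ x in cube d, ∑ j, fderiv ℝ (G j) x (stdBasis d j) = 0 := by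
  cases d with
  | zero => simp
  | succ n =>
  let e := (PiLp.continuousLinearEquiv 2 ℝ (fun _ : Fin (n + 1) => ℝ)).symm
  have hvol : MeasurePreserving e := PiLp.volume_preserving_toLp (Fin (n + 1))
  have hemb : MeasurableEmbedding e := e.toHomeomorph.measurableEmbedding
  have hpre : e ⁻¹' cube (n + 1) = Set.Icc 0 (fun _ => 2 * Real.pi) := by
    ext x
    simp only [Set.mem_preimage, cube, Set.mem_ofPred_eq, Set.mem_Icc, Pi.le_def, ← forall_and]
    rfl
  have hcont : Continuous fun x => ∑ j, fderiv ℝ (G j) x (stdBasis (n + 1) j) :=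
    continuous_finsetSum _ fun j _ =>
      continuous_fderiv_apply_field (hG j) continuous_const
  have hbasis : ∀ j, e (Pi.single j 1) = stdBasis (n + 1) j := fun j => rfl
  rw [← hvol.setIntegral_preimage_emb hemb, hpre]
  have hdiv := integral_divergence_of_hasFDerivAt_off_countable' (0 : Fin (n + 1) → ℝ)
    (fun _ => 2 * Real.pi) (fun _ => Real.two_pi_pos.le) (fun j x => G j (e x))
    (fun j x => (fderiv ℝ (G j) (e x)).comp (e : (Fin (n + 1) → ℝ) →L[ℝ] _)) ∅
    Set.countable_empty (fun j => ((hG j).continuous.comp e.continuous).continuousOn)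
    (fun x _ j => ((hG j).differentiable one_ne_zero (e x)).hasFDerivAt.comp x e.hasFDerivAt)
    ((hcont.comp e.continuous).continuousOn.integrableOn_compact isCompact_Icc)
  refine hdiv.trans (Finset.sum_eq_zero fun j _ => sub_eq_zero.2 ?_)
  congr 1
  funext x
  have hx : e (j.insertNth (2 * Real.pi) x) =
      e (j.insertNth 0 x) + (2 * Real.pi) • stdBasis (n + 1) j := by
    rw [← hbasis, ← map_smul, ← map_add]
    congr 1
    refine funext fun i => ?_
    refine Fin.succAboveCases j ?_ (fun k => ?_) i
    · simp
    · simp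
  exact (congrArg (G j) hx).trans (hp j _ j)

variable {d : ℕ}

lemma integrableOn_cube {F : Type*} [NormedAddCommGroup F] {g : EuclideanSpace ℝ (Fin d) → F}
    (hg : Continuous g) : IntegrableOn g (cube d) :=
  hg.continuousOn.integrableOn_compact (isCompact_cube d)

lemma contDiff_conj {n : WithTop ℕ∞} {k : EuclideanSpace ℝ (Fin d) → ℂ} (hk : ContDiff ℝ n k) :
    ContDiff ℝ n (fun x => conj (k x)) :=
  Complex.conjCLE.contDiff.comp hk

lemma fderiv_mul_conj_apply {f k : EuclideanSpace ℝ (Fin d) → ℂ} (hf : ContDiff ℝ 1 f)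
    (hk : ContDiff ℝ 1 k) (x v : EuclideanSpace ℝ (Fin d)) :
    fderiv ℝ (fun y => f y * conj (k y)) x v =
      fderiv ℝ f x v * conj (k x) + f x * conj (fderiv ℝ k x v) := by
  have h1 := (hf.differentiable one_ne_zero x).hasFDerivAt
  have h2 : HasFDerivAt (fun y => conj (k y))
      ((Complex.conjCLE : ℂ →L[ℝ] ℂ).comp (fderiv ℝ k x)) x :=
    Complex.conjCLE.hasFDerivAt.comp x (hk.differentiable one_ne_zero x).hasFDerivAt
  rw [(h1.fun_mul h2).fderiv]
  simp
  ring

/-- Green's formula on the torus. -/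
lemma integral_laplacian_mul_conj {f k : EuclideanSpace ℝ (Fin d) → ℂ} (hf : ContDiff ℝ 2 f)
    (pf : IsPeriodic f) (hk : ContDiff ℝ 1 k) (pk : IsPeriodic k) :
    ∫ x in cube d, laplacian d f x * conj (k x) =
      -∫ x in cube d, ∑ j, fderiv ℝ f x (stdBasis d j) * conj (fderiv ℝ k x (stdBasis d j)) := by
  have hfj := fun j => contDiff_fderiv_apply hf (stdBasis d j)
  have hfc := fun j => (hfj j).continuous
  have hkc := hk.continuous
  have hkj := fun j =>
    continuous_fderiv_apply_field hk (continuous_const (y := stdBasis d j))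
  have hLc := continuous_laplacian hf
  have h := integral_cube_divergence_eq_zero
    (G := fun j x => fderiv ℝ f x (stdBasis d j) * conj (k x))
    (fun j => (hfj j).mul (contDiff_conj hk))
    (fun j x i => by simp only [pf.fderiv x i, pk x i])
  simp only [fderiv_mul_conj_apply (hfj _) hk, Finset.sum_add_distrib, ← Finset.sum_mul] at h
  rw [integral_add (integrableOn_cube (by fun_prop)) (integrableOn_cube (by fun_prop))] at h
  exact eq_neg_of_add_eq_zero_left h

/-- Transport by a divergence-free field is skew-adjoint. -/
lemma integral_fderiv_field_mul_conj {u : EuclideanSpace ℝ (Fin d) → EuclideanSpace ℝ (Fin d)}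
    (hu : ContDiff ℝ 1 u) (pu : IsPeriodic u)
    (hdiv : ∀ x, ∑ j, fderiv ℝ u x (stdBasis d j) j = 0)
    {f k : EuclideanSpace ℝ (Fin d) → ℂ} (hf : ContDiff ℝ 1 f)
    (pf : IsPeriodic f) (hk : ContDiff ℝ 1 k) (pk : IsPeriodic k) :
    ∫ x in cube d, fderiv ℝ f x (u x) * conj (k x) =
      -∫ x in cube d, f x * conj (fderiv ℝ k x (u x)) := by
  have huc := hu.continuous
  have hfc := hf.continuous
  have hkc := hk.continuous
  have hfu := continuous_fderiv_apply_field hf huc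
  have hku := continuous_fderiv_apply_field hk huc
  have hG := hf.mul (contDiff_conj hk)
  have hus : ∀ (g : EuclideanSpace ℝ (Fin d) → ℂ) x,
      fderiv ℝ g x (u x) = ∑ j, (u x j : ℂ) * fderiv ℝ g x (stdBasis d j) := fun g x => by
    have hv : u x = ∑ j, u x j • stdBasis d j := by
      ext i
      simp [stdBasis, Pi.single_apply]
    conv_lhs => rw [hv]
    simp
  have huj : ∀ j x, HasFDerivAt (fun y => (u y j : ℂ))
      (Complex.ofRealCLM.comp ((EuclideanSpace.proj (𝕜 := ℝ) j).comp (fderiv ℝ u x))) x :=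
    fun j x => Complex.ofRealCLM.hasFDerivAt.comp x
      ((EuclideanSpace.proj (𝕜 := ℝ) j).hasFDerivAt.comp x
        (hu.differentiable one_ne_zero x).hasFDerivAt)
  have h := integral_cube_divergence_eq_zero
    (G := fun j x => (u x j : ℂ) * (f x * conj (k x)))
    (fun j => ContDiff.mul (Complex.ofRealCLM.contDiff.comp
      ((EuclideanSpace.proj (𝕜 := ℝ) j).contDiff.comp hu)) hG)
    (fun j x i => by simp only [pf x i, pk x i, pu x i])
  have hpt : ∀ x, ∑ j, fderiv ℝ (fun x => (u x j : ℂ) * (f x * conj (k x))) x (stdBasis d j) =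
      fderiv ℝ f x (u x) * conj (k x) + f x * conj (fderiv ℝ k x (u x)) := fun x => by
    have h1 : ∀ j, fderiv ℝ (fun x => (u x j : ℂ) * (f x * conj (k x))) x (stdBasis d j) =
        (u x j : ℂ) * fderiv ℝ (fun x => f x * conj (k x)) x (stdBasis d j) +
          ((fderiv ℝ u x (stdBasis d j) j : ℝ) : ℂ) * (f x * conj (k x)) := fun j => by
      rw [((huj j x).fun_mul (hG.differentiable one_ne_zero x).hasFDerivAt).fderiv]
      simp
      ring
    simp only [h1, Finset.sum_add_distrib, ← Finset.sum_mul]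
    rw [← hus, fderiv_mul_conj_apply hf hk, ← Complex.ofReal_sum, hdiv]
    simp
  simp only [hpt] at h
  rw [integral_add (integrableOn_cube (by fun_prop)) (integrableOn_cube (by fun_prop))] at h
  exact eq_neg_of_add_eq_zero_left h

/-- The squared length of the gradient of `f`. -/
noncomputable def gradSq (f : EuclideanSpace ℝ (Fin d) → ℂ) (x : EuclideanSpace ℝ (Fin d)) : ℝ :=
  ∑ j, ‖fderiv ℝ f x (stdBasis d j)‖ ^ 2

lemma continuous_gradSq {f : EuclideanSpace ℝ (Fin d) → ℂ} (hf : ContDiff ℝ 1 f) :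
    Continuous (gradSq f) :=
  continuous_finsetSum _ fun j _ =>
    (continuous_fderiv_apply_field hf (continuous_const (y := stdBasis d j))).norm.pow 2

lemma integral_cube_le {f : EuclideanSpace ℝ (Fin d) → ℝ} {c : ℝ} (hf : Continuous f)
    (h : ∀ x, f x ≤ c) : ∫ x in cube d, f x ≤ c * volume.real (cube d) := by
  have h1 := integral_mono (μ := volume.restrict (cube d)) (integrableOn_cube hf)
    (integrableOn_cube continuous_const) h
  simpa [mul_comm] using h1

variable {u : EuclideanSpace ℝ (Fin d) → EuclideanSpace ℝ (Fin d)} {A : ℝ}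
  {f g : EuclideanSpace ℝ (Fin d) → ℂ}

/-- The energy inequality for an approximate implicit Euler step. -/
lemma energy_step_le (hu : ContDiff ℝ 1 u) (pu : IsPeriodic u)
    (hdiv : ∀ x, ∑ j, fderiv ℝ u x (stdBasis d j) j = 0) (hf : ContDiff ℝ 2 f)
    (pf : IsPeriodic f) (hg : Continuous g) {h e S : ℝ} (he : 0 ≤ e)
    (hS : ∀ x, ‖f x‖ ≤ S) (hres : ∀ x, ‖f x - h * advDiff u A f x - g x‖ ≤ e) :
    (∫ x in cube d, ‖f x‖ ^ 2) / 2 + h * ∫ x in cube d, gradSq f x ≤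
      (∫ x in cube d, ‖g x‖ ^ 2) / 2 + e * S * volume.real (cube d) := by
  have hf1 := hf.of_le one_le_two
  have hfc := hf.continuous
  have hLc := continuous_laplacian hf
  have hfu := continuous_fderiv_apply_field hf1 hu.continuous
  have hAc := continuous_advDiff (A := A) hu.continuous hf
  have hgr := continuous_gradSq hf1
  have h1 : (∫ x in cube d, fderiv ℝ f x (u x) * conj (f x)).re = 0 := by
    have h2 := integral_fderiv_field_mul_conj hu pu hdiv hf1 pf hf1 pf
    have h3 : ∫ x in cube d, f x * conj (fderiv ℝ f x (u x)) =
        conj (∫ x in cube d, fderiv ℝ f x (u x) * conj (f x)) := by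
      rw [← integral_conj]
      congr 1
      funext x
      simp [mul_comm]
    rw [h3] at h2
    have := congrArg Complex.re h2
    simp only [Complex.neg_re, Complex.conj_re] at this
    linarith
  have h2 : (∫ x in cube d, laplacian d f x * conj (f x)).re = -∫ x in cube d, gradSq f x := by
    rw [integral_laplacian_mul_conj hf pf hf1 pf]
    have : ∀ x, ∑ j, fderiv ℝ f x (stdBasis d j) * conj (fderiv ℝ f x (stdBasis d j)) =
        ((gradSq f x : ℝ) : ℂ) := fun x => by
      simp [gradSq, Complex.mul_conj, Complex.normSq_eq_norm_sq]
    simp only [this, integral_complex_ofReal]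
    simp
  have h3 : (∫ x in cube d, advDiff u A f x * conj (f x)).re = -∫ x in cube d, gradSq f x := by
    have : ∀ x, advDiff u A f x * conj (f x) = laplacian d f x * conj (f x) -
        (A : ℂ) * (fderiv ℝ f x (u x) * conj (f x)) := fun x => by
      simp only [advDiff]; ring
    simp only [this]
    rw [integral_sub (integrableOn_cube (by fun_prop)) (integrableOn_cube (by fun_prop)),
      integral_const_mul, Complex.sub_re, Complex.re_ofReal_mul, h1, h2]
    simp
  have h4 : ∫ x in cube d, (advDiff u A f x * conj (f x)).re = -∫ x in cube d, gradSq f x := by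
    rw [← h3]
    exact integral_re (integrableOn_cube (g := fun x => advDiff u A f x * conj (f x)) (by fun_prop))
  have hpt : ∀ x, ‖f x‖ ^ 2 / 2 - h * (advDiff u A f x * conj (f x)).re - ‖g x‖ ^ 2 / 2
      ≤ e * S := fun x => by
    have h5 : ((f x - h * advDiff u A f x - g x) * conj (f x)).re ≤ e * S := by
      refine (Complex.re_le_norm _).trans ?_
      rw [norm_mul, RCLike.norm_conj]
      exact mul_le_mul (hres x) (hS x) (norm_nonneg _) he
    have h6 : (g x * conj (f x)).re ≤ ‖g x‖ * ‖f x‖ := by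
      simpa using Complex.re_le_norm (g x * conj (f x))
    have h7 : (f x - h * advDiff u A f x - g x) * conj (f x) =
        ((‖f x‖ ^ 2 : ℝ) : ℂ) - (h : ℂ) * (advDiff u A f x * conj (f x)) - g x * conj (f x) := by
      rw [← Complex.normSq_eq_norm_sq, ← Complex.mul_conj]
      ring
    rw [h7, Complex.sub_re, Complex.sub_re, Complex.re_ofReal_mul, Complex.ofReal_re] at h5
    nlinarith [sq_nonneg (‖g x‖ - ‖f x‖)]
  have h_le := integral_cube_le (by fun_prop) hpt
  rw [integral_sub (integrableOn_cube (by fun_prop)) (integrableOn_cube (by fun_prop)),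
    integral_sub (integrableOn_cube (by fun_prop)) (integrableOn_cube (by fun_prop)),
    integral_const_mul, integral_div, integral_div, h4] at h_le
  linarith

lemma norm_one_add_I_mul_le (s : ℝ) : ‖1 + Complex.I * (s : ℂ)‖ ≤ 1 + s ^ 2 / 2 := by
  rw [mul_comm, Complex.norm_eq_sqrt_sq_add_sq]
  refine Real.sqrt_le_iff.2 ⟨by positivity, ?_⟩
  simp
  nlinarith [sq_nonneg (s ^ 2)]

/-- The decay of the projection on an eigenfunction of the drift in an approximate implicit Euler
step is controlled by gradients, independently of the drift to leading order. -/
lemma norm_pairing_step_le (hu : ContDiff ℝ 1 u) (pu : IsPeriodic u)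
    (hdiv : ∀ x, ∑ j, fderiv ℝ u x (stdBasis d j) j = 0) {k : EuclideanSpace ℝ (Fin d) → ℂ}
    (hk : ContDiff ℝ 1 k) (pk : IsPeriodic k) {lam : ℝ}
    (heig : ∀ x, fderiv ℝ k x (u x) = Complex.I * lam * k x) (hf : ContDiff ℝ 2 f)
    (pf : IsPeriodic f) (hg : Continuous g) {h e M : ℝ} (hh : 0 ≤ h) (he : 0 ≤ e)
    (hM : ∀ x, ‖k x‖ ≤ M) (hres : ∀ x, ‖f x - h * advDiff u A f x - g x‖ ≤ e) :
    ‖∫ x in cube d, g x * conj (k x)‖ ≤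
      ‖∫ x in cube d, f x * conj (k x)‖ * (1 + (h * (A * lam)) ^ 2 / 2) +
        h * ((∫ x in cube d, gradSq f x) / 2 + (∫ x in cube d, gradSq k x) / 2) +
        e * M * volume.real (cube d) := by
  have hf1 := hf.of_le one_le_two
  have hfc := hf.continuous
  have hkc := hk.continuous
  have hLc := continuous_laplacian hf
  have hfu := continuous_fderiv_apply_field hf1 hu.continuous
  have hAc := continuous_advDiff (A := A) hu.continuous hf
  have hfj := fun j =>
    continuous_fderiv_apply_field hf1 (continuous_const (y := stdBasis d j))
  have hkj := fun j =>
    continuous_fderiv_apply_field hk (continuous_const (y := stdBasis d j))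
  have hgf := continuous_gradSq hf1
  have hgk := continuous_gradSq hk
  set b := ∫ x in cube d, f x * conj (k x) with hb
  set P := ∫ x in cube d,
    ∑ j, fderiv ℝ f x (stdBasis d j) * conj (fderiv ℝ k x (stdBasis d j)) with hP
  set R := ∫ x in cube d, (f x - h * advDiff u A f x - g x) * conj (k x) with hR
  have h1 : ∫ x in cube d, fderiv ℝ f x (u x) * conj (k x) = Complex.I * lam * b := by
    rw [integral_fderiv_field_mul_conj hu pu hdiv hf1 pf hk pk, hb, ← integral_const_mul,
      ← integral_neg]
    congr 1
    funext x
    rw [heig]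
    simp
    ring
  have h2 : ∫ x in cube d, advDiff u A f x * conj (k x) = -P - A * (Complex.I * lam * b) := by
    have : ∀ x, advDiff u A f x * conj (k x) = laplacian d f x * conj (k x) -
        (A : ℂ) * (fderiv ℝ f x (u x) * conj (k x)) := fun x => by
      simp only [advDiff]; ring
    simp only [this]
    rw [integral_sub (integrableOn_cube (by fun_prop)) (integrableOn_cube (by fun_prop)),
      integral_const_mul, h1, integral_laplacian_mul_conj hf pf hk pk]
  have h3 : ∫ x in cube d, g x * conj (k x) =
      b * (1 + Complex.I * ((h * (A * lam) : ℝ) : ℂ)) + h * P - R := by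
    have : ∀ x, g x * conj (k x) = f x * conj (k x) - (h : ℂ) * (advDiff u A f x * conj (k x)) -
        (f x - h * advDiff u A f x - g x) * conj (k x) := fun x => by ring
    conv_lhs => simp only [this]
    rw [integral_sub (integrableOn_cube (by fun_prop)) (integrableOn_cube (by fun_prop)),
      integral_sub (integrableOn_cube (by fun_prop)) (integrableOn_cube (by fun_prop)),
      integral_const_mul, h2]
    push_cast
    ring
  have hPle : ‖P‖ ≤ (∫ x in cube d, gradSq f x) / 2 + (∫ x in cube d, gradSq k x) / 2 := by
    rw [← integral_div, ← integral_div,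
      ← integral_add (integrableOn_cube (by fun_prop)) (integrableOn_cube (by fun_prop))]
    refine norm_integral_le_of_norm_le (integrableOn_cube (by fun_prop))
      (Filter.Eventually.of_forall fun x => ?_)
    rw [gradSq, gradSq, Finset.sum_div, Finset.sum_div, ← Finset.sum_add_distrib]
    refine norm_sum_le_of_le _ fun j _ => ?_
    rw [norm_mul, RCLike.norm_conj]
    nlinarith [sq_nonneg (‖fderiv ℝ f x (stdBasis d j)‖ - ‖fderiv ℝ k x (stdBasis d j)‖)]
  have hRle : ‖R‖ ≤ e * M * volume.real (cube d) := by
    refine (norm_integral_le_integral_norm _).trans (integral_cube_le (by fun_prop) fun x => ?_)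
    rw [norm_mul, RCLike.norm_conj]
    exact mul_le_mul (hres x) (hM x) (norm_nonneg _) he
  rw [h3]
  refine (norm_sub_le _ _).trans (add_le_add ((norm_add_le _ _).trans (add_le_add ?_ ?_)) hRle)
  · rw [norm_mul]
    exact mul_le_mul_of_nonneg_left (norm_one_add_I_mul_le _) (norm_nonneg _)
  · rw [norm_mul, Complex.norm_real, Real.norm_of_nonneg hh]
    exact mul_le_mul_of_nonneg_left hPle hh

end Energy

section Conclusion

open ComplexConjugate

variable {d : ℕ} {u : EuclideanSpace ℝ (Fin d) → EuclideanSpace ℝ (Fin d)} {A : ℝ}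

lemma norm_integral_mul_conj_le {f k : EuclideanSpace ℝ (Fin d) → ℂ} (hf : Continuous f)
    (hk : Continuous k) {S M : ℝ} (hS : ∀ x, ‖f x‖ ≤ S) (hM : ∀ x, ‖k x‖ ≤ M) :
    ‖∫ x in cube d, f x * conj (k x)‖ ≤ S * M * volume.real (cube d) := by
  refine (norm_integral_le_integral_norm _).trans (integral_cube_le (by fun_prop) fun x => ?_)
  rw [norm_mul, RCLike.norm_conj]
  exact mul_le_mul (hS x) (hM x) (norm_nonneg _) ((norm_nonneg _).trans (hS x))

/-- Along approximate implicit Euler schemes, `|⟨F n, k⟩| - ‖F n‖² / 4` decreases at a rate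
controlled by the gradient of the eigenfunction `k`. -/
lemma norm_pairing_implicit_euler_le (hu : ContDiff ℝ 1 u) (pu : IsPeriodic u)
    (hdiv : ∀ x, ∑ j, fderiv ℝ u x (stdBasis d j) j = 0) {k : EuclideanSpace ℝ (Fin d) → ℂ}
    (hk : ContDiff ℝ 1 k) (pk : IsPeriodic k) {lam : ℝ}
    (heig : ∀ x, fderiv ℝ k x (u x) = Complex.I * lam * k x)
    {F : ℕ → EuclideanSpace ℝ (Fin d) → ℂ} (hF : ∀ n, ContDiff ℝ 2 (F n))
    (pF : ∀ n, IsPeriodic (F n)) {h ε M S₀ T : ℝ} (hh : 0 < h) (hε : 0 ≤ ε)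
    (hM : ∀ x, ‖k x‖ ≤ M) (hS₀ : ∀ x, ‖F 0 x‖ ≤ S₀)
    (hstep : ∀ n x, ‖F (n + 1) x - h * advDiff u A (F (n + 1)) x - F n x‖ ≤ h * ε)
    (n : ℕ) (hn : n * h ≤ T) :
    ‖∫ x in cube d, F 0 x * conj (k x)‖ - (∫ x in cube d, ‖F 0 x‖ ^ 2) / 4 ≤
      ‖∫ x in cube d, F n x * conj (k x)‖ - (∫ x in cube d, ‖F n x‖ ^ 2) / 4 +
        n * h * (h * ((A * lam) ^ 2 * ((S₀ + T * ε) * M * volume.real (cube d)) / 2) +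
          (∫ x in cube d, gradSq k x) / 2 +
          ε * (M + (S₀ + T * ε) / 2) * volume.real (cube d)) := by
  have hsup : ∀ (n : ℕ) x, ‖F n x‖ ≤ S₀ + n * h * ε := by
    intro n
    induction n with
    | zero => simpa using hS₀
    | succ n ih =>
      refine norm_le_of_resolvent_norm_le (u := u) (A := A) (hF (n + 1)) (pF (n + 1)) hh.le
        fun x => ?_
      have h1 := norm_add_le (F (n + 1) x - h * advDiff u A (F (n + 1)) x - F n x) (F n x)
      rw [sub_add_cancel] at h1
      push_cast
      linarith [hstep n x, ih x]
  induction n with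
  | zero => simp
  | succ n ih =>
    push_cast at hn ⊢
    have ih := ih (by linarith)
    have hS : ∀ x, ‖F (n + 1) x‖ ≤ S₀ + T * ε := fun x => by
      have h1 := hsup (n + 1) x
      push_cast at h1
      linarith [mul_le_mul_of_nonneg_right hn hε]
    have hFc := (hF n).continuous
    have h1 := norm_pairing_step_le hu pu hdiv hk pk heig (hF (n + 1)) (pF (n + 1)) hFc hh.le
      (mul_nonneg hh.le hε) hM (hstep n)
    have h2 := energy_step_le hu pu hdiv (hF (n + 1)) (pF (n + 1)) hFc (mul_nonneg hh.le hε) hS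
      (hstep n)
    have h3 := mul_le_mul_of_nonneg_right
      (norm_integral_mul_conj_le (hF (n + 1)).continuous hk.continuous hS hM)
      (show 0 ≤ (h * (A * lam)) ^ 2 / 2 by positivity)
    linarith

/-- The correlation with an eigenfunction of the drift, with an arbitrarily small loss. -/
lemma exists_half_le_norm_pairing_add (hu : ContDiff ℝ 1 u) (pu : IsPeriodic u)
    (hdiv : ∀ x, ∑ j, fderiv ℝ u x (stdBasis d j) j = 0) {lam : ℝ}
    {φ : ℝ → EuclideanSpace ℝ (Fin d) → ℂ} (hφ₀_reg : ContDiff ℝ 1 (φ 0))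
    (hφ₀_norm : ∫ x in cube d, ‖φ 0 x‖ ^ 2 = 1)
    (heig : ∀ x, fderiv ℝ (φ 0) x (u x) = Complex.I * lam * φ 0 x)
    (hφ_per : ∀ t, IsPeriodic (φ t)) (hφ_regx : ∀ t, 0 ≤ t → ContDiff ℝ 2 (φ t))
    (hφ_cont : Continuous fun p : ℝ × EuclideanSpace ℝ (Fin d) => φ p.1 p.2)
    (hφ_pde : ∀ x, ∀ t, 0 ≤ t →
      HasDerivWithinAt (fun s => φ s x) (advDiff u A (φ t) x) (Set.Ici 0) t)
    {t : ℝ} (ht : 0 < t) (htG : t * ∫ x in cube d, gradSq (φ 0) x ≤ 1 / 2) :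
    ∃ W : ℝ, ∀ η : ℝ, 0 < η → η ≤ 1 →
      1 / 2 ≤ ‖∫ x in cube d, φ t x * conj (φ 0 x)‖ + W * η := by
  have hkc := hφ₀_reg.continuous
  have htc := (hφ_regx t ht.le).continuous
  obtain ⟨M, hM0, hM⟩ := (hφ_per 0).exists_norm_le hkc
  obtain ⟨h₀, hh₀, hEuler⟩ := exists_implicit_euler pu hu.continuous A
  set V := volume.real (cube d) with hV
  have hV0 : 0 ≤ V := measureReal_nonneg
  set S := M + 1 + t with hS
  set Q := (A * lam) ^ 2 * (S * M * V) / 2 with hQ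
  have hQ0 : 0 ≤ Q := by positivity
  refine ⟨(3 + t) * M * V + M * V + (2 * M + 1) * V / 4 + t * (1 + (M + S / 2) * V),
    fun η hη hη1 => ?_⟩
  obtain ⟨f₀, hf₀, pf₀, ef₀⟩ := exists_approx_heat_resolvent (hφ_per 0) hkc le_rfl hη
  replace ef₀ : ∀ x, ‖f₀ x - φ 0 x‖ ≤ η := fun x => by simpa using ef₀ x
  obtain ⟨C, hC0, hC⟩ := (pu.advDiff (A := A) pf₀).exists_norm_le
    (continuous_advDiff hu.continuous hf₀)
  set κ := (C + η) ^ 2 / (2 * η) with hκ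
  have hκ0 : 0 ≤ κ := by positivity
  obtain ⟨N, hN⟩ := exists_nat_gt (t / h₀ + κ * t ^ 2 / η + t * Q / η)
  have hq1 : 0 < t / h₀ := by positivity
  have hq2 : 0 ≤ κ * t ^ 2 / η := by positivity
  have hq3 : 0 ≤ t * Q / η := by positivity
  have hN0 : (0 : ℝ) < N := by linarith
  set h := t / N with hh
  have hpos : 0 < h := by positivity
  have hNh : N * h = t := by rw [hh]; field_simp
  have hb1 : h ≤ h₀ := by
    rw [hh, div_le_iff₀ hN0]
    have : t / h₀ ≤ N := by linarith
    rw [div_le_iff₀ hh₀] at this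
    linarith
  have hb2 : κ * (h * t) ≤ η := by
    have h1 : κ * t ^ 2 / η ≤ N := by linarith
    rw [div_le_iff₀ hη] at h1
    rw [hh, show κ * (t / N * t) = κ * t ^ 2 / N by ring, div_le_iff₀ hN0]
    linarith
  have hb3 : h * Q ≤ η := by
    have h1 : t * Q / η ≤ N := by linarith
    rw [div_le_iff₀ hη] at h1
    rw [hh, show t / N * Q = t * Q / N by ring, div_le_iff₀ hN0]
    linarith
  obtain ⟨F, hF0, hF, pF, hstep⟩ := hEuler h hpos hb1 η hη f₀ hf₀ pf₀
  have hFc := (hF N).continuous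
  have hf₀c := hf₀.continuous
  have hconv : ∀ x, ‖φ t x - F N x‖ ≤ (3 + t) * η := fun x => by
    have h1 := norm_sub_implicit_euler_le hφ_per hφ_regx hφ_cont hφ_pde hF pF (C := C) (δ := η)
      (ρ := 3 / 2 * η) hpos hη.le hκ0 (by rw [hF0]; exact hC)
      (fun x => by rw [hF0, norm_sub_rev]; exact ef₀ x) hstep
      (fun s _ => by
        have h2 : κ * s ^ 2 = ((C + η) * s) ^ 2 / (2 * η) := by rw [hκ]; ring
        have h3 : (C + η) * s ≤ η / 2 + ((C + η) * s) ^ 2 / (2 * η) := by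
          have h4 : η / 2 + ((C + η) * s) ^ 2 / (2 * η) - (C + η) * s =
              ((C + η) * s - η) ^ 2 / (2 * η) := by field_simp; ring
          have h5 : 0 ≤ ((C + η) * s - η) ^ 2 / (2 * η) := by positivity
          linarith
        linarith) N ht.le x
    rw [hNh, sub_self, mul_add] at h1
    linarith
  have hpair : ‖∫ x in cube d, F N x * conj (φ 0 x)‖ ≤
      ‖∫ x in cube d, φ t x * conj (φ 0 x)‖ + (3 + t) * η * M * V := by
    have h1 := norm_integral_mul_conj_le (htc.sub hFc) hkc hconv hM
    have h2 : ∫ x in cube d, (φ t - F N) x * conj (φ 0 x) =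
        (∫ x in cube d, φ t x * conj (φ 0 x)) - ∫ x in cube d, F N x * conj (φ 0 x) := by
      simp only [Pi.sub_apply, sub_mul]
      exact integral_sub (integrableOn_cube (by fun_prop)) (integrableOn_cube (by fun_prop))
    rw [h2] at h1
    have h3 := norm_sub_norm_le (∫ x in cube d, F N x * conj (φ 0 x))
      (∫ x in cube d, φ t x * conj (φ 0 x))
    rw [norm_sub_rev] at h3
    linarith
  have hf₀M : ∀ x, ‖f₀ x‖ ≤ ‖φ 0 x‖ + η := fun x => by
    have h1 := norm_add_le (f₀ x - φ 0 x) (φ 0 x)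
    rw [sub_add_cancel] at h1
    linarith [ef₀ x]
  have hdec := norm_pairing_implicit_euler_le (A := A) (T := t) hu pu hdiv hφ₀_reg (hφ_per 0)
    heig hF pF hpos hη.le hM (S₀ := M + 1) (fun x => by rw [hF0]; linarith [hf₀M x, hM x])
    hstep N hNh.le
  rw [hNh, hF0] at hdec
  have hself : ∫ x in cube d, φ 0 x * conj (φ 0 x) = 1 := by
    simp only [Complex.mul_conj, Complex.normSq_eq_norm_sq, integral_complex_ofReal, hφ₀_norm]
    simp
  have hpair0 : 1 - η * M * V ≤ ‖∫ x in cube d, f₀ x * conj (φ 0 x)‖ := by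
    have h1 := norm_integral_mul_conj_le (hf₀c.sub hkc) hkc ef₀ hM
    have h2 : ∫ x in cube d, (f₀ - φ 0) x * conj (φ 0 x) =
        (∫ x in cube d, f₀ x * conj (φ 0 x)) - ∫ x in cube d, φ 0 x * conj (φ 0 x) := by
      simp only [Pi.sub_apply, sub_mul]
      exact integral_sub (integrableOn_cube (by fun_prop)) (integrableOn_cube (by fun_prop))
    rw [h2, hself] at h1
    have h3 := norm_sub_norm_le 1 (∫ x in cube d, f₀ x * conj (φ 0 x))
    rw [norm_sub_rev, norm_one] at h3
    linarith
  have hmass0 : ∫ x in cube d, ‖f₀ x‖ ^ 2 ≤ 1 + (2 * M + 1) * η * V := by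
    have h1 := integral_cube_le (d := d) (f := fun x => ‖f₀ x‖ ^ 2 - ‖φ 0 x‖ ^ 2)
      (c := (2 * M + 1) * η) (by fun_prop) fun x => by
        have h2 := hf₀M x
        have h3 := hM x
        have h4 := norm_nonneg (f₀ x)
        have h5 : ‖f₀ x‖ ^ 2 ≤ (‖φ 0 x‖ + η) ^ 2 := by gcongr
        nlinarith
    rw [integral_sub (integrableOn_cube (by fun_prop)) (integrableOn_cube (by fun_prop)),
      hφ₀_norm] at h1
    linarith
  have hSη : M + 1 + t * η ≤ S := by rw [hS]; nlinarith
  have hloss : h * ((A * lam) ^ 2 * ((M + 1 + t * η) * M * V) / 2) +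
      (∫ x in cube d, gradSq (φ 0) x) / 2 + η * (M + (M + 1 + t * η) / 2) * V ≤
      η + (∫ x in cube d, gradSq (φ 0) x) / 2 + η * (M + S / 2) * V := by
    have h1 : h * ((A * lam) ^ 2 * ((M + 1 + t * η) * M * V) / 2) ≤ h * Q := by
      rw [hQ]; gcongr
    have h2 : η * (M + (M + 1 + t * η) / 2) * V ≤ η * (M + S / 2) * V := by gcongr
    linarith
  have hloss' := mul_le_mul_of_nonneg_left hloss ht.le
  have hmassN : 0 ≤ ∫ x in cube d, ‖F N x‖ ^ 2 := integral_nonneg fun x => by positivity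
  linarith

end Conclusion

/-- If the incompressible drift `u` has a nonconstant `H¹` eigenfunction `φ₀`
(`u·∇φ₀ = iλφ₀`, normalized in `L²`), then the solution of
`∂ₜφ + A u·∇φ = Δφ`, `φ(0) = φ₀`, satisfies
`|⟨φ(t), φ₀⟩| ≥ 1/2` (hence `‖φ(t)‖_{L²} ≥ 1/2`) for all
`0 ≤ t ≤ τ = (2‖∇φ₀‖²_{L²})⁻¹`, uniformly in `A`: `u` is not relaxation
enhancing. -/
theorem stmt_3 (d : ℕ) (hd : 1 ≤ d)
    (u : EuclideanSpace ℝ (Fin d) → EuclideanSpace ℝ (Fin d))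
    (hu_reg : ContDiff ℝ 1 u)
    (hu_per : ∀ x j, u (x + (2 * Real.pi) • stdBasis d j) = u x)
    (hu_div : ∀ x, ∑ j, fderiv ℝ u x (stdBasis d j) j = 0)
    (lam : ℝ) (φ₀ : EuclideanSpace ℝ (Fin d) → ℂ)
    (hφ₀_reg : ContDiff ℝ 1 φ₀)
    (hφ₀_per : ∀ x j, φ₀ (x + (2 * Real.pi) • stdBasis d j) = φ₀ x)
    (hφ₀_nonconst : ¬ ∃ c : ℂ, ∀ x, φ₀ x = c)
    (hφ₀_norm : ∫ x in cube d, ‖φ₀ x‖ ^ 2 = 1)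
    (hφ₀_eig : ∀ x, fderiv ℝ φ₀ x (u x) = Complex.I * lam * φ₀ x)
    (A : ℝ) (φ : ℝ → EuclideanSpace ℝ (Fin d) → ℂ)
    (hφ_per : ∀ t x j, φ t (x + (2 * Real.pi) • stdBasis d j) = φ t x)
    (hφ_regx : ∀ t, 0 ≤ t → ContDiff ℝ 2 (φ t))
    (hφ_cont : Continuous fun p : ℝ × EuclideanSpace ℝ (Fin d) => φ p.1 p.2)
    (hφ_pde : ∀ x, ∀ t, 0 ≤ t → HasDerivWithinAt (fun s => φ s x)
      (laplacian d (φ t) x - (A : ℂ) * fderiv ℝ (φ t) x (u x)) (Set.Ici 0) t)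
    (hφ_init : φ 0 = φ₀)
    (τ : ℝ)
    (hτ : τ = (2 * ∫ x in cube d, ∑ j, ‖fderiv ℝ φ₀ x (stdBasis d j)‖ ^ 2)⁻¹) :
    ∀ t, 0 ≤ t → t ≤ τ →
      1 / 2 ≤ ‖∫ x in cube d, φ t x * (starRingEnd ℂ) (φ₀ x)‖ ∧
      1 / 2 ≤ Real.sqrt (∫ x in cube d, ‖φ t x‖ ^ 2) := by
  intro t ht htτ
  subst hφ_init
  have hkc := hφ₀_reg.continuous
  have htc := (hφ_regx t ht).continuous
  have hself : ∫ x in cube d, φ 0 x * (starRingEnd ℂ) (φ 0 x) = 1 := by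
    simp only [Complex.mul_conj, Complex.normSq_eq_norm_sq, integral_complex_ofReal, hφ₀_norm]
    simp
  have hpair : 1 / 2 ≤ ‖∫ x in cube d, φ t x * (starRingEnd ℂ) (φ 0 x)‖ := by
    rcases ht.eq_or_lt with rfl | htpos
    · rw [hself]; norm_num
    have htG : t * ∫ x in cube d, gradSq (φ 0) x ≤ 1 / 2 := by
      have hτ' : τ = (2 * ∫ x in cube d, gradSq (φ 0) x)⁻¹ := hτ
      have hG : 0 < 2 * ∫ x in cube d, gradSq (φ 0) x := by
        rw [← inv_pos, ← hτ']
        exact htpos.trans_le htτ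
      rw [hτ', ← one_div, le_div_iff₀ hG] at htτ
      linarith
    obtain ⟨W, hW⟩ := exists_half_le_norm_pairing_add hu_reg hu_per hu_div hφ₀_reg hφ₀_norm
      hφ₀_eig hφ_per hφ_regx hφ_cont hφ_pde htpos htG
    refine le_of_forall_pos_le_add fun ε hε => ?_
    have hη : 0 < min 1 (ε / (|W| + 1)) := lt_min one_pos (by positivity)
    refine (hW _ hη (min_le_left _ _)).trans ?_
    gcongr
    calc W * min 1 (ε / (|W| + 1)) ≤ (|W| + 1) * (ε / (|W| + 1)) := by
          gcongr
          · linarith [le_abs_self W]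
          · exact min_le_right _ _
      _ = ε := by field_simp
  refine ⟨hpair, Real.le_sqrt_of_sq_le ?_⟩
  have hle : ‖∫ x in cube d, φ t x * (starRingEnd ℂ) (φ 0 x)‖ ≤
      (∫ x in cube d, ‖φ t x‖ ^ 2) + (∫ x in cube d, ‖φ 0 x‖ ^ 2) / 4 := by
    rw [← integral_div,
      ← integral_add (integrableOn_cube (by fun_prop)) (integrableOn_cube (by fun_prop))]
    refine norm_integral_le_of_norm_le (integrableOn_cube (by fun_prop))
      (Filter.Eventually.of_forall fun x => ?_)
    rw [norm_mul, RCLike.norm_conj]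
    nlinarith [sq_nonneg (2 * ‖φ t x‖ - ‖φ 0 x‖)]
  rw [hφ₀_norm] at hle
  linarith
end

section
/- Let u : ℝ → ℝ be continuous and 2π-periodic, and define μ = Ψ₀(u) = inf{ (∫₀^{2π} |−f''(y) + i u(y) f(y)|² dy)^{1/2} : f : ℝ → ℂ twice continuously differentiable, 2π-periodic, ∫₀^{2π} |f(y)|² dy = 1 }. Then there exists a twice continuously differentiable 2π-periodic function f : ℝ → ℂ, not identically zero, such that −f''(y) + i u(y) f(y) = μ \overline{f(y)} for all y ∈ ℝ. -/
/-- The `L²(0, 2π)` norm of a (`2π`-periodic) function `f : ℝ → ℂ`. -/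
noncomputable def l2norm (f : ℝ → ℂ) : ℝ :=
  Real.sqrt (∫ y in (0 : ℝ)..(2 * Real.pi), ‖f y‖ ^ 2)

open MeasureTheory Real

theorem contDiff_two_of_hasDerivAt {f f' f'' : ℝ → ℂ} (hf : ∀ x, HasDerivAt f (f' x) x)
    (hf' : ∀ x, HasDerivAt f' (f'' x) x) (hc : Continuous f'') :
    ContDiff ℝ 2 f ∧ deriv (deriv f) = f'' := by
  have h1 : deriv f = f' := funext fun x => (hf x).deriv
  have h2 : deriv f' = f'' := funext fun x => (hf' x).deriv
  refine ⟨?_, by rw [h1, h2]⟩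
  rw [show (2 : WithTop ℕ∞) = 1 + 1 by norm_num, contDiff_succ_iff_deriv]
  refine ⟨fun x => (hf x).differentiableAt, by simp, ?_⟩
  rw [h1, contDiff_one_iff_deriv]
  exact ⟨fun x => (hf' x).differentiableAt, by rwa [h2]⟩

theorem hasDerivAt_of_contDiff_two {f : ℝ → ℂ} (hf : ContDiff ℝ 2 f) :
    (∀ x, HasDerivAt f (deriv f x) x) ∧ (∀ x, HasDerivAt (deriv f) (deriv (deriv f) x) x) ∧
      Continuous (deriv (deriv f)) := by
  rw [show (2 : WithTop ℕ∞) = 1 + 1 by norm_num, contDiff_succ_iff_deriv] at hf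
  obtain ⟨h1, -, h2⟩ := hf
  rw [contDiff_one_iff_deriv] at h2
  exact ⟨fun x => (h1 x).hasDerivAt, fun x => (h2.1 x).hasDerivAt, h2.2⟩

theorem Function.Periodic.deriv' {f : ℝ → ℂ} {T : ℝ} (hf : Function.Periodic f T) :
    Function.Periodic (deriv f) T := fun x => by
  rw [← deriv_comp_add_const, hf.funext]

/-- A linear first order equation with periodic source has a periodic solution. -/
theorem exists_periodic_hasDerivAt {T a : ℝ} (hT : 0 < T) (ha : a ≠ 0) {h : ℝ → ℂ}
    (hc : Continuous h) (hp : Function.Periodic h T) :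
    ∃ g : ℝ → ℂ, Function.Periodic g T ∧ ∀ x, HasDerivAt g (h x - a * g x) x := by
  set k : ℝ → ℂ := fun s => Complex.exp (a * s) * h s with hk
  have hkc : Continuous k := by fun_prop
  set I : ℝ → ℂ := fun x => ∫ s in (0 : ℝ)..x, k s with hI
  have hId : ∀ x, HasDerivAt I (k x) x := fun x =>
    intervalIntegral.integral_hasDerivAt_right (hkc.intervalIntegrable _ _)
      hkc.stronglyMeasurable.stronglyMeasurableAtFilter hkc.continuousAt
  have hIT : ∀ x, I (x + T) = I T + Complex.exp (a * T) * I x := fun x => by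
    rw [hI]
    simp only
    rw [← intervalIntegral.integral_add_adjacent_intervals
      (hkc.intervalIntegrable 0 T) (hkc.intervalIntegrable T (x + T)),
      ← intervalIntegral.integral_const_mul]
    congr 1
    have := intervalIntegral.integral_comp_add_right (a := 0) (b := x) k T
    rw [zero_add] at this
    rw [← this]
    refine intervalIntegral.integral_congr fun s _ => ?_
    simp only [hk]
    rw [hp s, Complex.ofReal_add, mul_add, Complex.exp_add]
    ring
  have hE : Complex.exp (a * T) ≠ 1 := by
    rw [← Complex.ofReal_mul, ← Complex.ofReal_exp]
    norm_cast
    rw [Real.exp_eq_one_iff]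
    positivity
  set c : ℂ := I T / (Complex.exp (a * T) - 1) with hcdef
  have hcT : c + I T = Complex.exp (a * T) * c := by
    have : Complex.exp (a * T) - 1 ≠ 0 := sub_ne_zero.2 hE
    rw [hcdef]; field_simp; ring
  refine ⟨fun x => Complex.exp (-(a * x)) * (c + I x), fun x => ?_, fun x => ?_⟩
  · simp only
    rw [hIT, ← add_assoc, hcT, ← mul_add, Complex.ofReal_add, mul_add, neg_add, Complex.exp_add,
      Complex.exp_neg (a * T)]
    field_simp [Complex.exp_ne_zero]
  · have h1 : HasDerivAt (fun x : ℝ => Complex.exp (-(a * x)))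
        (Complex.exp (-(a * x)) * -(a * 1)) x := by
      have : HasDerivAt (fun x : ℝ => (x : ℂ)) 1 x := Complex.ofRealCLM.hasDerivAt
      exact ((this.const_mul (a : ℂ)).neg).cexp
    refine (h1.mul ((hId x).const_add c)).congr_deriv ?_
    simp only [hk]
    rw [← mul_assoc (Complex.exp (-(a * x))) (Complex.exp (a * x)), ← Complex.exp_add]
    simp
    ring

/-- The equation `f - ∂²f = h` with periodic source `h` has a periodic solution. -/
theorem exists_periodic_resolvent {T : ℝ} (hT : 0 < T) {h : ℝ → ℂ}
    (hc : Continuous h) (hp : Function.Periodic h T) :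
    ∃ f : ℝ → ℂ, ContDiff ℝ 2 f ∧ Function.Periodic f T ∧ ∀ x, deriv (deriv f) x = f x - h x := by
  obtain ⟨g, hgp, hg⟩ := exists_periodic_hasDerivAt hT one_ne_zero hc hp
  have hgc : Continuous g := continuous_iff_continuousAt.2 fun x => (hg x).continuousAt
  obtain ⟨f, hfp, hf⟩ := exists_periodic_hasDerivAt hT (neg_ne_zero.2 (one_ne_zero (α := ℝ)))
    hgc.neg (fun x => congrArg Neg.neg (hgp x))
  have hfc : Continuous f := continuous_iff_continuousAt.2 fun x => (hf x).continuousAt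
  obtain ⟨h1, h2⟩ := contDiff_two_of_hasDerivAt (f := f) (f' := fun x => f x - g x)
    (f'' := fun x => f x - h x) (fun x => (hf x).congr_deriv (by simp; ring))
    (fun x => ((hf x).sub (hg x)).congr_deriv (by simp; ring)) (hfc.sub hc)
  exact ⟨f, h1, hfp, fun x => by rw [h2]⟩

/-- The Green kernel of `1 - ∂²` on the circle of length `2π`, on the period `[0, 2π]`. -/
noncomputable def greenKernel (t : ℝ) : ℝ := cosh (π - t) / (2 * sinh π)

theorem integral_greenKernel_mul {f : ℝ → ℂ} (hf : ContDiff ℝ 2 f)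
    (hp : Function.Periodic f (2 * π)) (x : ℝ) :
    ∫ t in (0 : ℝ)..(2 * π), (greenKernel t : ℂ) * (f (x + t) - deriv (deriv f) (x + t)) = f x := by
  obtain ⟨h1, h2, h3⟩ := hasDerivAt_of_contDiff_two hf
  have hs : sinh π ≠ 0 := (sinh_pos_iff.2 pi_pos).ne'
  set G' : ℝ → ℝ := fun t => -sinh (π - t) / (2 * sinh π)
  have hG : ∀ t, HasDerivAt greenKernel (G' t) t := fun t => by
    have := (((hasDerivAt_id t).const_sub π).cosh).div_const (2 * sinh π)
    simpa [G', greenKernel] using! this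
  have hG' : ∀ t, HasDerivAt G' (greenKernel t) t := fun t => by
    have := (((hasDerivAt_id t).const_sub π).sinh.neg).div_const (2 * sinh π)
    simpa [G', greenKernel] using! this
  have hd : ∀ t, HasDerivAt
      (fun t => (G' t : ℂ) * f (x + t) - (greenKernel t : ℂ) * deriv f (x + t))
      ((greenKernel t : ℂ) * (f (x + t) - deriv (deriv f) (x + t))) t := fun t => by
    refine (((hG' t).ofReal_comp.mul ((h1 (x + t)).comp_const_add x t)).sub
      ((hG t).ofReal_comp.mul ((h2 (x + t)).comp_const_add x t))).congr_deriv ?_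
    ring
  have hGc : Continuous greenKernel := continuous_iff_continuousAt.2 fun t => (hG t).continuousAt
  have hfc := hf.continuous
  rw [intervalIntegral.integral_eq_sub_of_hasDerivAt (fun t _ => hd t)
    (Continuous.intervalIntegrable (by fun_prop) _ _)]
  have e1 : f (x + 2 * π) = f x := hp x
  have e2 : deriv f (x + 2 * π) = deriv f x := hp.deriv' x
  have e3 : greenKernel (2 * π) = greenKernel 0 := by
    rw [greenKernel, greenKernel, show π - 2 * π = - (π - 0) by ring, cosh_neg]
  have e4 : G' (2 * π) = 1 / 2 := by
    simp only [G']; rw [show π - 2 * π = - π by ring, sinh_neg]; field_simp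
  have e5 : G' 0 = -1 / 2 := by
    simp only [G']; rw [sub_zero]; field_simp
  rw [e1, e2, e3, e4, e5, add_zero]
  push_cast
  ring
/-- A continuous family of operators into a proper space, read as an operator into continuous
functions, is compact. -/
theorem exists_compact_evaluation {X E F : Type*} [TopologicalSpace X] [CompactSpace X]
    [NormedAddCommGroup E] [NormedSpace ℝ E] [NormedAddCommGroup F] [NormedSpace ℝ F]
    [ProperSpace F] (Φ : C(X, E →L[ℝ] F)) :
    ∃ K : E →L[ℝ] C(X, F), (∀ h x, K h x = Φ x h) ∧ IsCompactOperator K := by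
  let K : E →L[ℝ] C(X, F) := LinearMap.mkContinuous
    { toFun := fun h => ⟨fun x => Φ x h, by fun_prop⟩
      map_add' := fun a b => by ext x; simp
      map_smul' := fun c a => by ext x; simp } ‖Φ‖ (fun h => by
        rw [ContinuousMap.norm_le _ (by positivity)]
        intro x
        exact ((Φ x).le_opNorm h).trans (by gcongr; exact Φ.norm_coe_le_norm x))
  have hK : ∀ h x, K h x = Φ x h := fun h x => rfl
  refine ⟨K, hK, ?_⟩
  refine (isCompactOperator_iff_isCompact_closure_image_closedBall
    (K : E →ₗ[ℝ] C(X, F)) zero_lt_one).2 ?_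
  let A : Set (BoundedContinuousFunction X F) :=
    (ContinuousMap.equivBoundedOfCompact X F) '' (K '' Metric.closedBall 0 1)
  have hA : IsCompact (closure A) := by
    apply BoundedContinuousFunction.arzela_ascoli (Metric.closedBall 0 ‖Φ‖) (isCompact_closedBall _ _)
    · rintro _ x ⟨_, ⟨h, hh, rfl⟩, rfl⟩
      rw [mem_closedBall_zero_iff] at hh ⊢
      change ‖Φ x h‖ ≤ _
      calc ‖Φ x h‖ ≤ ‖Φ x‖ * ‖h‖ := (Φ x).le_opNorm h
        _ ≤ ‖Φ‖ * 1 := by gcongr; exact Φ.norm_coe_le_norm x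
        _ = _ := mul_one _
    · intro x
      rw [Metric.equicontinuousAt_iff_right]
      intro ε hε
      have := Metric.continuousAt_iff'.1 (Φ.continuous.continuousAt (x := x)) ε hε
      filter_upwards [this] with y hy
      rintro ⟨_, ⟨_, ⟨h, hh, rfl⟩, rfl⟩⟩
      rw [mem_closedBall_zero_iff] at hh
      change dist (Φ x h) (Φ y h) < ε
      rw [dist_comm, dist_eq_norm, ← sub_apply]
      rw [dist_eq_norm] at hy
      calc _ ≤ ‖Φ y - Φ x‖ * ‖h‖ := (Φ y - Φ x).le_opNorm h
        _ ≤ ‖Φ y - Φ x‖ * 1 := by gcongr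
        _ < ε := by simpa using hy
  have := hA.image (ContinuousMap.isometryEquivBoundedOfCompact X F).symm.continuous
  refine this.of_isClosed_subset isClosed_closure (closure_minimal ?_ this.isClosed)
  intro k hk
  exact ⟨_, subset_closure ⟨k, hk, rfl⟩, rfl⟩

/-- A nonzero compact symmetric operator has an eigenvalue of absolute value its norm. -/
theorem exists_eigenvector_abs_eq_norm {E : Type*} [NormedAddCommGroup E]
    [InnerProductSpace ℝ E] [CompleteSpace E]
    (T : E →L[ℝ] E) (hT : IsCompactOperator T) (hs : (T : E →ₗ[ℝ] E).IsSymmetric) (h0 : T ≠ 0) :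
    ∃ (c : ℝ) (e : E), |c| = ‖T‖ ∧ e ≠ 0 ∧ T e = c • e := by
  obtain ⟨c₀, hc₀, hc₀'⟩ : ∃ c, Module.End.HasEigenvalue (T : Module.End ℝ E) c ∧ c ≠ 0 := by
    by_contra! h
    exact h0 ((ContinuousLinearMap.eq_zero_of_forall_hasEigenvalue_eq_zero hT hs).1 h)
  have hne : (spectrum ℝ T).Nonempty := ⟨c₀, (hT.hasEigenvalue_iff_mem_spectrum hc₀').1 hc₀⟩
  obtain ⟨c, hc, hcn⟩ := spectrum.exists_nnnorm_eq_spectralRadius_of_nonempty hne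
  have hs' : IsSelfAdjoint T := hs.isSelfAdjoint
  rw [T.spectralRadius_eq_nnnorm hs'] at hcn
  have hcn' : |c| = ‖T‖ := congrArg NNReal.toReal (ENNReal.coe_injective hcn)
  have hc' : c ≠ 0 := by
    rintro rfl
    exact h0 (norm_eq_zero.1 (by simpa using hcn'.symm))
  obtain ⟨e, he⟩ := ((hT.hasEigenvalue_iff_mem_spectrum hc').2 hc).exists_hasEigenvector
  exact ⟨c, e, hcn', he.2, he.apply_eq_smul⟩

local instance : Fact (0 < 2 * π) := ⟨two_pi_pos⟩

/-- `L²` of the circle of length `2π`. -/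
local notation "CircleLp" => Lp ℂ 2 (volume : Measure (AddCircle (2 * π)))

/-- Continuous functions on the circle of length `2π`. -/
local notation "CircleMap" => C(AddCircle (2 * π), ℂ)

/-- The embedding of continuous functions into `L²`. -/
local notation "ι" => (ContinuousMap.toLp (α := AddCircle (2 * π)) (E := ℂ) 2 volume ℝ)

/-- The compact inverse of `1 - ∂²` on the circle. -/
theorem exists_green_operator :
    ∃ K : CircleLp →L[ℝ] CircleMap, IsCompactOperator K ∧
      ∀ (f : ℝ → ℂ) (h : CircleMap), ContDiff ℝ 2 f → Function.Periodic f (2 * π) →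
        (∀ x : ℝ, h x = f x - deriv (deriv f) x) → ∀ x : ℝ, K (ι h) x = f x := by
  have hG0 : greenKernel 0 = greenKernel (2 * π) := by
    rw [greenKernel, greenKernel, show π - 2 * π = - (π - 0) by ring, cosh_neg]
  have hGc : Continuous greenKernel := by unfold greenKernel; fun_prop
  have hlc := AddCircle.liftIco_zero_continuous hG0 hGc.continuousOn
  let G : CircleMap := ⟨fun t => ((AddCircle.liftIco (2 * π) 0 greenKernel t : ℝ) : ℂ),
    Complex.continuous_ofReal.comp hlc⟩
  let D : C(AddCircle (2 * π), CircleMap) := ContinuousMap.curry ⟨fun p => G (p.2 - p.1), by fun_prop⟩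
  let Φ : C(AddCircle (2 * π), CircleLp →L[ℝ] ℂ) :=
    ⟨fun x => (innerSL ℂ (ContinuousMap.toLp 2 volume ℂ (D x))).restrictScalars ℝ, by fun_prop⟩
  obtain ⟨K, hK, hKc⟩ := exists_compact_evaluation Φ
  refine ⟨K, hKc, fun f h hf hp hh x => ?_⟩
  have h1 : K (ι h) x = ∫ t, h t * (starRingEnd ℂ) (D x t) :=
    (hK _ _).trans (ContinuousMap.inner_toLp volume (D x) h)
  rw [h1, ← integral_greenKernel_mul hf hp x, ← integral_add_right_eq_self _ (x : AddCircle (2 * π)),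
    ← AddCircle.intervalIntegral_preimage (2 * π) 0, zero_add]
  refine intervalIntegral.integral_congr_ae ?_
  have : ∀ᵐ t : ℝ, t ≠ 2 * π := by simp [ae_iff]
  filter_upwards [this] with t ht htm
  rw [Set.uIoc_of_le two_pi_pos.le] at htm
  have h2 : D x (t + x) = greenKernel t := by
    change G (t + x - x) = _
    rw [add_sub_cancel_right]
    change ((AddCircle.liftIco (2 * π) 0 greenKernel t : ℝ) : ℂ) = _
    rw [AddCircle.liftIco_zero_coe_apply ⟨htm.1.le, htm.2.lt_of_ne ht⟩]
  rw [h2, Complex.conj_ofReal, ← AddCircle.coe_add, hh, mul_comm, add_comm x t]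


/-- A continuous periodic function descends to the circle. -/
theorem exists_circle_lift {E : Type*} [TopologicalSpace E] {f : ℝ → E} (hf : Continuous f)
    (hp : Function.Periodic f (2 * π)) :
    ∃ F : C(AddCircle (2 * π), E), ∀ x : ℝ, F x = f x :=
  ⟨⟨hp.lift, continuous_coinduced_dom.2 hf⟩, fun _ => rfl⟩

theorem continuous_periodic_coe {E : Type*} [TopologicalSpace E] (F : C(AddCircle (2 * π), E)) :
    Continuous (fun x : ℝ => F x) ∧ Function.Periodic (fun x : ℝ => F x) (2 * π) :=
  ⟨F.continuous.comp (AddCircle.continuous_mk' _), fun x => by simp⟩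

theorem circle_map_ext {E : Type*} [TopologicalSpace E] {F G : C(AddCircle (2 * π), E)}
    (h : ∀ x : ℝ, F x = G x) : F = G :=
  ContinuousMap.ext fun x => QuotientAddGroup.induction_on x h

theorem inner_toLp_eq (F G : CircleMap) :
    inner ℝ (ι F) (ι G) = (∫ x in (0 : ℝ)..(2 * π), G x * (starRingEnd ℂ) (F x)).re := by
  have h1 : inner ℂ (ι F) (ι G) = ∫ x, G x * (starRingEnd ℂ) (F x) :=
    ContinuousMap.inner_toLp volume F G
  have h2 : inner ℝ (ι F) (ι G) = (inner ℂ (ι F) (ι G)).re := by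
    rw [L2.inner_def, L2.inner_def]
    exact integral_re (L2.integrable_inner (𝕜 := ℂ) (ι F) (ι G))
  rw [h2, h1, ← AddCircle.intervalIntegral_preimage (2 * π) 0, zero_add]

theorem norm_toLp_eq (F : CircleMap) : ‖ι F‖ = l2norm fun x => F x := by
  have h : ∀ z : ℂ, z * (starRingEnd ℂ) z = ((‖z‖ ^ 2 : ℝ) : ℂ) := fun z => by
    rw [Complex.mul_conj, Complex.normSq_eq_norm_sq]
  rw [l2norm, ← Real.sqrt_sq (norm_nonneg (ι F)), ← real_inner_self_eq_norm_sq, inner_toLp_eq]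
  simp only [h]
  rw [intervalIntegral.integral_ofReal, Complex.ofReal_re]

theorem integral_deriv_deriv_mul_comm {f g : ℝ → ℂ} (hf : ContDiff ℝ 2 f) (hg : ContDiff ℝ 2 g)
    (hfp : Function.Periodic f (2 * π)) (hgp : Function.Periodic g (2 * π)) :
    ∫ x in (0 : ℝ)..(2 * π), (deriv (deriv f) x * g x - f x * deriv (deriv g) x) = 0 := by
  obtain ⟨f1, f2, f3⟩ := hasDerivAt_of_contDiff_two hf
  obtain ⟨g1, g2, g3⟩ := hasDerivAt_of_contDiff_two hg
  have hd : ∀ x, HasDerivAt (fun x => deriv f x * g x - f x * deriv g x)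
      (deriv (deriv f) x * g x - f x * deriv (deriv g) x) x := fun x => by
    refine (((f2 x).mul (g1 x)).sub ((f1 x).mul (g2 x))).congr_deriv ?_
    ring
  have hfc := hf.continuous
  have hgc := hg.continuous
  rw [intervalIntegral.integral_eq_sub_of_hasDerivAt (fun t _ => hd t)
    (Continuous.intervalIntegrable (by fun_prop) _ _)]
  have e1 := hfp 0
  have e2 := hgp 0
  have e3 := hfp.deriv' 0
  have e4 := hgp.deriv' 0
  rw [zero_add] at e1 e2 e3 e4
  rw [e1, e2, e3, e4, sub_self]

/-- Pointwise conjugation on `L²`. -/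
local notation "J" => (ContinuousLinearMap.compLpL 2 (volume : Measure (AddCircle (2 * π))) (Complex.conjCLE : ℂ →L[ℝ] ℂ))

theorem conj_toLp (F : CircleMap) : J (ι F) = ι (star F) := by
  apply Lp.ext
  filter_upwards [(Complex.conjCLE : ℂ →L[ℝ] ℂ).coeFn_compLpL (p := 2) (ι F),
    F.coeFn_toLp (p := 2) (𝕜 := ℝ) volume,
    (star F).coeFn_toLp (p := 2) (𝕜 := ℝ) volume] with x h1 h2 h3
  rw [h1, h2, h3]
  simp

/-- Twice continuously differentiable `2π`-periodic functions. -/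
def IsPeriodicC2 (f : ℝ → ℂ) : Prop := ContDiff ℝ 2 f ∧ Function.Periodic f (2 * π)

/-- The operator `H = -∂² + iu`. -/
noncomputable def schrodinger (u : ℝ → ℝ) (f : ℝ → ℂ) (y : ℝ) : ℂ :=
  -(deriv (deriv f)) y + Complex.I * (u y : ℂ) * f y

theorem continuous_periodic_schrodinger {u : ℝ → ℝ} (hu : Continuous u)
    (hup : Function.Periodic u (2 * π)) {f : ℝ → ℂ} (hf : IsPeriodicC2 f) :
    Continuous (schrodinger u f) ∧ Function.Periodic (schrodinger u f) (2 * π) := by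
  obtain ⟨-, -, h⟩ := hasDerivAt_of_contDiff_two hf.1
  have := hf.1.continuous
  refine ⟨by unfold schrodinger; fun_prop, fun x => ?_⟩
  simp only [schrodinger, hf.2.deriv'.deriv' x, hup x, hf.2 x]

theorem schrodinger_const_mul (u : ℝ → ℝ) {f : ℝ → ℂ} (hf : IsPeriodicC2 f) (c : ℂ) :
    IsPeriodicC2 (fun y => c * f y) ∧
      ∀ y, schrodinger u (fun y => c * f y) y = c * schrodinger u f y := by
  obtain ⟨h1, h2, h3⟩ := hasDerivAt_of_contDiff_two hf.1
  obtain ⟨e1, e2⟩ := contDiff_two_of_hasDerivAt (fun x => (h1 x).const_mul c)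
    (fun x => (h2 x).const_mul c) (h3.const_mul c)
  refine ⟨⟨e1, fun x => by simp only [hf.2 x]⟩, fun y => ?_⟩
  simp only [schrodinger, e2]
  ring

theorem integral_schrodinger_mul_comm {u : ℝ → ℝ} (hu : Continuous u)
    {f g : ℝ → ℂ} (hf : IsPeriodicC2 f) (hg : IsPeriodicC2 g) :
    ∫ y in (0 : ℝ)..(2 * π), schrodinger u f y * g y =
      ∫ y in (0 : ℝ)..(2 * π), f y * schrodinger u g y := by
  obtain ⟨-, -, f3⟩ := hasDerivAt_of_contDiff_two hf.1
  obtain ⟨-, -, g3⟩ := hasDerivAt_of_contDiff_two hg.1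
  have hfc := hf.1.continuous
  have hgc := hg.1.continuous
  rw [← sub_eq_zero, ← intervalIntegral.integral_sub
    (Continuous.intervalIntegrable (by unfold schrodinger; fun_prop) _ _)
    (Continuous.intervalIntegrable (by unfold schrodinger; fun_prop) _ _), ← neg_eq_zero,
    ← intervalIntegral.integral_neg, ← integral_deriv_deriv_mul_comm hf.1 hg.1 hf.2 hg.2]
  refine intervalIntegral.integral_congr fun y _ => ?_
  simp only [schrodinger]
  ring

theorem resolvent_regularity {K : CircleLp →L[ℝ] CircleMap}
    (hK : ∀ (f : ℝ → ℂ) (h : CircleMap), ContDiff ℝ 2 f → Function.Periodic f (2 * π) →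
      (∀ x : ℝ, h x = f x - deriv (deriv f) x) → ∀ x : ℝ, K (ι h) x = f x) (h : CircleMap) :
    IsPeriodicC2 (fun x : ℝ => K (ι h) x) ∧
      ∀ x : ℝ, deriv (deriv fun x : ℝ => K (ι h) x) x = K (ι h) x - h x := by
  obtain ⟨hc, hp⟩ := continuous_periodic_coe h
  obtain ⟨f, hf, hfp, hd⟩ := exists_periodic_resolvent two_pi_pos hc hp
  have := hK f h hf hfp fun x => by rw [hd]; ring
  rw [show (fun x : ℝ => K (ι h) x) = f from funext this]
  exact ⟨⟨hf, hfp⟩, fun x => by rw [hd, this]⟩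

/-- Either `H` has a nontrivial kernel, or it has a compact inverse; in the second case `T` is the
inverse of the antilinear operator `f ↦ conj (H f)`. -/
theorem exists_kernel_or_inverse {u : ℝ → ℝ} (hu : Continuous u)
    (hup : Function.Periodic u (2 * π)) :
    (∃ f, IsPeriodicC2 f ∧ (∃ y, f y ≠ 0) ∧ ∀ y, schrodinger u f y = 0) ∨
    ∃ (T : CircleLp →L[ℝ] CircleLp), IsCompactOperator T ∧ (∀ h, ∃ F : CircleMap, T h = ι F) ∧
      (∀ g : CircleMap, ∃ F : CircleMap, T (ι g) = ι F ∧ IsPeriodicC2 (fun y : ℝ => F y) ∧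
        ∀ y : ℝ, schrodinger u (fun y : ℝ => F y) y = (starRingEnd ℂ) (g y)) ∧
      ∀ F g : CircleMap, IsPeriodicC2 (fun y : ℝ => F y) →
        (∀ y : ℝ, schrodinger u (fun y : ℝ => F y) y = (starRingEnd ℂ) (g y)) →
        T (ι g) = ι F := by
  obtain ⟨K, hKc, hK⟩ := exists_green_operator
  obtain ⟨U, hU⟩ := exists_circle_lift (f := fun y => 1 - Complex.I * (u y : ℂ)) (by fun_prop)
    (fun x => by simp only [hup x])
  let C : CircleLp →L[ℝ] CircleLp := ι ∘L (ContinuousLinearMap.mul ℝ CircleMap U) ∘L K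
  have hC : ∀ h, C h = ι (U * K h) := fun h => rfl
  have hCc : IsCompactOperator C := hKc.clm_comp (ι ∘L ContinuousLinearMap.mul ℝ CircleMap U)
  rcases hCc.hasEigenvalue_or_mem_resolventSet one_ne_zero with h | h
  · left
    obtain ⟨h, hh⟩ := h.exists_hasEigenvector
    have h1 : ι (U * K h) = h := by simpa [hC] using hh.apply_eq_smul
    obtain ⟨r1, r2⟩ := resolvent_regularity hK (U * K h)
    rw [h1] at r1 r2
    refine ⟨_, r1, ?_, fun y => ?_⟩
    · by_contra! h0
      have : K h = 0 := circle_map_ext h0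
      exact hh.2 (by rw [← h1, this, mul_zero, map_zero])
    · rw [schrodinger, r2, ContinuousMap.mul_apply, hU]
      ring
  · right
    rw [spectrum.mem_resolventSet_iff, map_one] at h
    obtain ⟨S, hS⟩ := h
    have hS1 : ∀ h, (S⁻¹.1 : CircleLp →L[ℝ] CircleLp) h = C ((S⁻¹.1 : CircleLp →L[ℝ] CircleLp) h) + h := fun h => by
      have := congrArg (fun A : CircleLp →L[ℝ] CircleLp => A h) S.mul_inv
      rw [hS] at this
      have e : (S⁻¹.1 : CircleLp →L[ℝ] CircleLp) h - C ((S⁻¹.1 : CircleLp →L[ℝ] CircleLp) h) = h := this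
      exact sub_eq_iff_eq_add'.1 e
    have hS2 : ∀ h, (S⁻¹.1 : CircleLp →L[ℝ] CircleLp) (h - C h) = h := fun h => by
      have := congrArg (fun A : CircleLp →L[ℝ] CircleLp => A h) S.inv_mul
      rw [hS] at this
      exact this
    have key : ∀ g, ∃ h' : CircleMap, (S⁻¹.1 : CircleLp →L[ℝ] CircleLp) (J (ι g)) = ι h' ∧
        h' = U * K (ι h') + star g := fun g => by
      have := hS1 (J (ι g))
      refine ⟨U * K ((S⁻¹.1 : CircleLp →L[ℝ] CircleLp) (J (ι g))) + star g, ?_, ?_⟩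
      · rw [map_add, ← hC, ← conj_toLp]; exact this
      · rw [map_add, ← hC, ← conj_toLp, ← this]
    refine ⟨ι ∘L K ∘L (S⁻¹.1 : CircleLp →L[ℝ] CircleLp) ∘L J, ?_, fun h => ⟨_, rfl⟩, fun g => ?_,
      fun F g hF hFg => ?_⟩
    · exact (hKc.comp_clm ((S⁻¹.1 : CircleLp →L[ℝ] CircleLp) ∘L J)).clm_comp ι
    · obtain ⟨h', h1, h2⟩ := key g
      obtain ⟨r1, r2⟩ := resolvent_regularity hK h'
      refine ⟨K (ι h'), by rw [← h1]; rfl, r1, fun y => ?_⟩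
      have h3 := congrArg (fun A : CircleMap => A y) h2
      simp only [ContinuousMap.add_apply, ContinuousMap.mul_apply, hU, ContinuousMap.star_apply] at h3
      rw [schrodinger, r2, h3, starRingEnd_apply]
      ring
    · have h1 : K (ι (U * F + star g)) = F := circle_map_ext fun x => by
        refine hK _ _ hF.1 hF.2 (fun x => ?_) x
        simp only [ContinuousMap.add_apply, ContinuousMap.mul_apply, hU, ContinuousMap.star_apply]
        have := hFg x
        rw [schrodinger, starRingEnd_apply] at this
        rw [← this]
        ring
      have h2 := hS2 (ι (U * F + star g))
      rw [hC, h1, map_add, add_sub_cancel_left, ← conj_toLp] at h2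
      change ι (K ((S⁻¹.1 : CircleLp →L[ℝ] CircleLp) (J (ι g)))) = ι F
      rw [h2, conj_toLp, ← map_add, h1]

theorem exists_conj_eigenfunction {u : ℝ → ℝ} (hu : Continuous u)
    (hup : Function.Periodic u (2 * π)) :
    ∃ (ν : ℝ) (f : ℝ → ℂ), 0 ≤ ν ∧ IsPeriodicC2 f ∧ (∃ y, f y ≠ 0) ∧
      (∀ y, schrodinger u f y = ν * (starRingEnd ℂ) (f y)) ∧
      ∀ g, IsPeriodicC2 g → ν * l2norm g ≤ l2norm (schrodinger u g) := by
  rcases exists_kernel_or_inverse hu hup with ⟨f, hf, hf0, hfe⟩ | ⟨T, hTc, hTr, hT1, hT2⟩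
  · refine ⟨0, f, le_rfl, hf, hf0, fun y => by simp [hfe], fun g _ => ?_⟩
    rw [zero_mul]
    exact Real.sqrt_nonneg _
  have hsurj : ∀ g : ℝ → ℂ, IsPeriodicC2 g → ∃ F G : CircleMap, (∀ y : ℝ, F y = g y) ∧
      (∀ y : ℝ, G y = (starRingEnd ℂ) (schrodinger u g y)) ∧ T (ι G) = ι F := fun g hg => by
    obtain ⟨F, hF⟩ := exists_circle_lift hg.1.continuous hg.2
    obtain ⟨hc, hp⟩ := continuous_periodic_schrodinger hu hup hg
    obtain ⟨G, hG⟩ := exists_circle_lift (f := fun y => (starRingEnd ℂ) (schrodinger u g y))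
      (Complex.continuous_conj.comp hc) (fun x => by simp only [hp x])
    have hFg : (fun y : ℝ => F y) = g := funext hF
    refine ⟨F, G, hF, hG, hT2 F G (by rwa [hFg]) fun y => ?_⟩
    rw [hFg, hG, Complex.conj_conj]
  have hT0 : T ≠ 0 := by
    rintro rfl
    obtain ⟨F, G, hF, -, h⟩ := hsurj (fun _ => 1) ⟨contDiff_const, fun _ => rfl⟩
    have : F = 0 := ContinuousMap.toLp_injective (𝕜 := ℝ) (p := 2) volume (by simpa using h.symm)
    have h0 := hF 0
    rw [this] at h0
    simp at h0
  have hsymm : (T : CircleLp →ₗ[ℝ] CircleLp).IsSymmetric := by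
    have hd : DenseRange ι := ContinuousMap.toLp_denseRange ℂ volume ℝ (by simp)
    have hdd := hd.prodMap hd
    intro a b
    refine hdd.induction_on (p := fun q => inner ℝ (T q.1) q.2 = inner ℝ q.1 (T q.2)) (a, b)
      (isClosed_eq (by fun_prop) (by fun_prop)) ?_
    rintro ⟨g₁, g₂⟩
    obtain ⟨F₁, e₁, p₁, s₁⟩ := hT1 g₁
    obtain ⟨F₂, e₂, p₂, s₂⟩ := hT1 g₂
    simp only [Prod.map_apply]
    rw [e₁, e₂, real_inner_comm, inner_toLp_eq, inner_toLp_eq]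
    simp only [← s₁, ← s₂]
    rw [← integral_schrodinger_mul_comm hu p₁ p₂]
    simp only [mul_comm]
  obtain ⟨c, e, hc, he, hTe⟩ := exists_eigenvector_abs_eq_norm T hTc hsymm hT0
  have hTn : 0 < ‖T‖ := norm_pos_iff.2 hT0
  have hc0 : c ≠ 0 := abs_pos.1 (hc ▸ hTn)
  obtain ⟨F₀, hF₀⟩ := hTr e
  obtain ⟨G, rfl⟩ : ∃ G : CircleMap, ι G = e :=
    ⟨c⁻¹ • F₀, by rw [map_smul, ← hF₀, hTe, smul_smul, inv_mul_cancel₀ hc0, one_smul]⟩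
  obtain ⟨F, hF, hFp, hFs⟩ := hT1 G
  have hFG : F = c • G := ContinuousMap.toLp_injective (𝕜 := ℝ) (p := 2) volume <| by
    rw [map_smul, ← hTe, hF]
  have hFG' : ∀ y : ℝ, F y = c * G y := fun y => by rw [hFG]; simp
  have hc0' : (c : ℂ) ≠ 0 := by exact_mod_cast hc0
  have hF0 : ∃ y : ℝ, F y ≠ 0 := by
    by_contra! h
    refine he ?_
    have : G = 0 := circle_map_ext fun y => by simpa [hFG', hc0'] using h y
    rw [this, map_zero]
  have hFs' : ∀ y : ℝ, schrodinger u (fun y : ℝ => F y) y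
      = (c⁻¹ : ℝ) * (starRingEnd ℂ) (F y) := fun y => by
    rw [hFs, hFG', map_mul, Complex.conj_ofReal, Complex.ofReal_inv, inv_mul_cancel_left₀ hc0']
  obtain ⟨f, hfp, hf0, hf⟩ : ∃ f : ℝ → ℂ, IsPeriodicC2 f ∧ (∃ y, f y ≠ 0) ∧
      ∀ y, schrodinger u f y = (‖T‖⁻¹ : ℝ) * (starRingEnd ℂ) (f y) := by
    rw [← hc]
    rcases abs_choice c with h | h <;> rw [h]
    · exact ⟨_, hFp, hF0, hFs'⟩
    · obtain ⟨h1, h2⟩ := schrodinger_const_mul u hFp Complex.I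
      obtain ⟨y, hy⟩ := hF0
      refine ⟨_, h1, ⟨y, mul_ne_zero Complex.I_ne_zero hy⟩, fun y => ?_⟩
      rw [h2, hFs', map_mul, Complex.conj_I, inv_neg, Complex.ofReal_neg]
      ring
  refine ⟨‖T‖⁻¹, f, by positivity, hfp, hf0, hf, fun g hg => ?_⟩
  obtain ⟨F₁, G₁, h1, h2, h3⟩ := hsurj g hg
  have n1 : l2norm g = ‖ι F₁‖ := by rw [norm_toLp_eq]; simp only [h1]
  have n2 : l2norm (schrodinger u g) = ‖ι G₁‖ := by
    rw [norm_toLp_eq]; simp only [h2, l2norm, RCLike.norm_conj]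
  rw [n1, n2, ← h3, inv_mul_le_iff₀ hTn]
  exact T.le_opNorm _

theorem l2norm_const_mul (c : ℂ) (f : ℝ → ℂ) : l2norm (fun y => c * f y) = ‖c‖ * l2norm f := by
  simp only [l2norm, norm_mul, mul_pow]
  rw [intervalIntegral.integral_const_mul, Real.sqrt_mul (by positivity),
    Real.sqrt_sq (norm_nonneg c)]

theorem l2norm_pos {f : ℝ → ℂ} (hf : IsPeriodicC2 f) (h0 : ∃ y, f y ≠ 0) : 0 < l2norm f := by
  obtain ⟨F, hF⟩ := exists_circle_lift hf.1.continuous hf.2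
  have : l2norm f = ‖ι F‖ := by rw [norm_toLp_eq]; simp only [hF]
  rw [this, norm_pos_iff]
  intro h
  obtain ⟨y, hy⟩ := h0
  have hF0 : F = 0 := ContinuousMap.toLp_injective (𝕜 := ℝ) (p := 2) volume (by rw [h, map_zero])
  exact hy (by rw [← hF, hF0]; rfl)

theorem stmt_6 (u : ℝ → ℝ) (hu : Continuous u) (huper : Function.Periodic u (2 * Real.pi))
    (μ : ℝ)
    (hμ : μ = sInf {r : ℝ | ∃ f : ℝ → ℂ, ContDiff ℝ 2 f ∧ Function.Periodic f (2 * Real.pi) ∧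
      l2norm f = 1 ∧
      r = l2norm fun y => -(deriv (deriv f)) y + Complex.I * (u y : ℂ) * f y}) :
    ∃ f : ℝ → ℂ, ContDiff ℝ 2 f ∧ Function.Periodic f (2 * Real.pi) ∧ (∃ y, f y ≠ 0) ∧
      ∀ y, -(deriv (deriv f)) y + Complex.I * (u y : ℂ) * f y =
        (μ : ℂ) * (starRingEnd ℂ) (f y) := by
  obtain ⟨ν, f, hν, hf, hf0, hfe, hle⟩ := exists_conj_eigenfunction hu huper
  have hpos := l2norm_pos hf hf0
  have hleast : IsLeast {r : ℝ | ∃ f : ℝ → ℂ, ContDiff ℝ 2 f ∧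
      Function.Periodic f (2 * Real.pi) ∧ l2norm f = 1 ∧
      r = l2norm fun y => -(deriv (deriv f)) y + Complex.I * (u y : ℂ) * f y} ν := by
    constructor
    · obtain ⟨h1, h2⟩ := schrodinger_const_mul u hf ((l2norm f)⁻¹ : ℝ)
      have hn : ‖(((l2norm f)⁻¹ : ℝ) : ℂ)‖ = (l2norm f)⁻¹ := by
        rw [Complex.norm_real, Real.norm_of_nonneg (by positivity)]
      refine ⟨_, h1.1, h1.2, ?_, ?_⟩
      · rw [l2norm_const_mul, hn, inv_mul_cancel₀ hpos.ne']
      · change ν = l2norm (schrodinger u _)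
        rw [funext h2, l2norm_const_mul, hn, funext hfe, l2norm_const_mul, Complex.norm_real,
          Real.norm_of_nonneg hν]
        have : l2norm (fun y => (starRingEnd ℂ) (f y)) = l2norm f := by
          simp only [l2norm, RCLike.norm_conj]
        rw [this]
        field_simp
    · rintro r ⟨g, hg, hgp, hg1, rfl⟩
      have := hle g ⟨hg, hgp⟩
      rwa [hg1, mul_one] at this
  rw [hμ, hleast.csInf_eq]
  exact ⟨f, hf.1, hf.2, hf0, hfe⟩
end

section
/- Let u : ℝ → ℝ be continuous and 2π-periodic, let ψ : ℝ → ℝ be differentiable with ψ' = u, and define ω₀(δ,u) = inf over x, c ∈ ℝ of ∫_{x−δ}^{x+δ} |ψ(y) − c|² dy. Suppose f : ℝ → ℂ is twice continuously differentiable, 2π-periodic, not identically zero, μ ≥ 0, and −f''(y) + i u(y) f(y) = μ \overline{f(y)} for all y. Then for every δ > 0, either √μ ≥ π/(2δ) or 36 √μ tan(√μ δ) ≥ ω₀(δ,u). -/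
/-- `ω₀(δ, u) = inf_{x, c} ∫_{x-δ}^{x+δ} |ψ(y) - c|² dy`, where `ψ' = u`. -/
noncomputable def omega0 (δ : ℝ) (ψ : ℝ → ℝ) : ℝ :=
  sInf {r : ℝ | ∃ x c : ℝ, r = ∫ y in (x - δ)..(x + δ), (ψ y - c) ^ 2}

open Real Set Filter Topology

/-- Sturm comparison: a solution of `g'' + k² g ≥ 0` dominates, within distance `π / k` of `y`,
the solution of `h'' + k² h = 0` with the same Cauchy data at `y`. -/
theorem sturm_comparison {g g' g'' : ℝ → ℝ} {k : ℝ} (hk : 0 < k)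
    (hg : ∀ t, HasDerivAt g (g' t) t) (hg' : ∀ t, HasDerivAt g' (g'' t) t)
    (hnn : ∀ t, 0 ≤ g'' t + k ^ 2 * g t) {x y : ℝ} (hxy : |k * (x - y)| ≤ π) :
    g' y * sin (k * (x - y)) + k * g y * cos (k * (x - y)) ≤ k * g x := by
  set h : ℝ → ℝ := fun t => g' t * sin (k * (x - t)) + k * g t * cos (k * (x - t)) with hh
  have hlin : ∀ t, HasDerivAt (fun t : ℝ => k * (x - t)) (-k) t := fun t => by
    simpa using ((hasDerivAt_id t).const_sub x).const_mul k
  have hd : ∀ t, HasDerivAt h ((g'' t + k ^ 2 * g t) * sin (k * (x - t))) t := fun t => by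
    have := ((hg' t).mul (hlin t).sin).add (((hg t).const_mul k).mul (hlin t).cos)
    refine this.congr_deriv ?_
    ring
  have hcont : Continuous h := continuous_iff_continuousAt.2 fun t => (hd t).continuousAt
  have hx : h x = k * g x := by simp [hh]
  change h y ≤ k * g x
  rw [← hx]
  rw [abs_le] at hxy
  rcases le_total y x with hle | hle
  · refine monotoneOn_of_hasDerivWithinAt_nonneg (convex_Icc y x) hcont.continuousOn
      (fun t _ => (hd t).hasDerivWithinAt) (fun t ht => ?_) (left_mem_Icc.2 hle)
      (right_mem_Icc.2 hle) hle
    rw [interior_Icc] at ht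
    refine mul_nonneg (hnn t) (sin_nonneg_of_nonneg_of_le_pi ?_ ?_)
    · exact mul_nonneg hk.le (by linarith [ht.2])
    · nlinarith [ht.1]
  · refine antitoneOn_of_hasDerivWithinAt_nonpos (convex_Icc x y) hcont.continuousOn
      (fun t _ => (hd t).hasDerivWithinAt) (fun t ht => ?_) (left_mem_Icc.2 hle)
      (right_mem_Icc.2 hle) hle
    rw [interior_Icc] at ht
    refine mul_nonpos_of_nonneg_of_nonpos (hnn t) (sin_nonpos_of_nonpos_of_neg_pi_le ?_ ?_)
    · exact mul_nonpos_of_nonneg_of_nonpos hk.le (by linarith [ht.1])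
    · nlinarith [ht.2]

/-- Near a global maximum `x₀` of a function `g` with `g'' + k² g ≥ 0`, the function `g` is bounded
below by a cosine and its logarithmic derivative is bounded by a tangent. -/
theorem cos_le_and_abs_deriv_le_tan {g g' g'' : ℝ → ℝ} {k : ℝ} (hk : 0 < k)
    (hg : ∀ t, HasDerivAt g (g' t) t) (hg' : ∀ t, HasDerivAt g' (g'' t) t)
    (hnn : ∀ t, 0 ≤ g'' t + k ^ 2 * g t) {x₀ : ℝ}
    (hmax : ∀ t, g t ≤ g x₀) {y : ℝ} (hy : k * |y - x₀| < π / 2) :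
    g x₀ * cos (k * |y - x₀|) ≤ g y ∧ |g' y| ≤ k * tan (k * |y - x₀|) * g y := by
  have h0 : g' x₀ = 0 :=
    IsLocalMax.hasDerivAt_eq_zero (Eventually.of_forall hmax) (hg x₀)
  set s := |y - x₀| with hs
  have hs0 : 0 ≤ s := abs_nonneg _
  have hks0 : 0 ≤ k * s := mul_nonneg hk.le hs0
  have hcos : 0 < cos (k * s) := cos_pos_of_mem_Ioo ⟨by linarith [pi_pos], hy⟩
  have hlow : g x₀ * cos (k * s) ≤ g y := by
    have habs : |k * (y - x₀)| = k * s := by rw [abs_mul, abs_of_pos hk]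
    have := sturm_comparison hk hg hg' hnn (x := y) (y := x₀) (by rw [habs]; linarith [pi_pos])
    rw [h0, ← cos_abs (k * (y - x₀)), habs, zero_mul, zero_add, mul_assoc] at this
    exact le_of_mul_le_mul_left this hk
  refine ⟨hlow, ?_⟩
  rcases hs0.eq_or_lt with h | h
  · have : y = x₀ := by rw [eq_comm, hs, abs_eq_zero] at h; linarith
    rw [← h, this, h0]; simp
  have hsin : 0 < sin (k * s) := sin_pos_of_pos_of_lt_pi (by positivity) (by linarith [pi_pos])
  have hplus := sturm_comparison hk hg hg' hnn (x := y + s) (y := y)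
    (by rw [add_sub_cancel_left, abs_of_nonneg hks0]; linarith [pi_pos])
  have hminus := sturm_comparison hk hg hg' hnn (x := y - s) (y := y)
    (by rw [show k * (y - s - y) = -(k * s) by ring, abs_neg, abs_of_nonneg hks0]
        linarith [pi_pos])
  rw [show k * (y - s - y) = -(k * s) by ring, sin_neg, cos_neg] at hminus
  rw [add_sub_cancel_left] at hplus
  have key : ∀ P : ℝ, P * sin (k * s) + k * g y * cos (k * s) ≤ k * g x₀ →
      P ≤ k * tan (k * s) * g y := by
    intro P hP
    rw [tan_eq_sin_div_cos, show k * (sin (k * s) / cos (k * s)) * g y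
      = k * sin (k * s) * g y / cos (k * s) by ring, le_div_iff₀ hcos]
    refine le_of_mul_le_mul_left ?_ hsin
    have h1 := mul_le_mul_of_nonneg_right hP hcos.le
    have h2 := mul_le_mul_of_nonneg_left hlow hk.le
    have h3 := sin_sq_add_cos_sq (k * s)
    calc sin (k * s) * (P * cos (k * s))
        ≤ k * g y - k * g y * cos (k * s) ^ 2 := by nlinarith
      _ = k * g y * (1 - cos (k * s) ^ 2) := by ring
      _ = sin (k * s) * (k * sin (k * s) * g y) := by rw [← h3]; ring
  rw [abs_le]
  constructor
  · have := key (-g' y) (by nlinarith [hmax (y - s)])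
    linarith
  · exact key _ (by nlinarith [hmax (y + s)])

/-- The equation `-f'' + i u f = μ f̄` for `f = p + i q`, written as a real system: near a maximum
`x₀` of `p² + q²` the function `f` does not vanish, and `Re (f' / f)` is bounded by a tangent. -/
theorem norm_sq_pos_and_abs_le_tan {u p q p' q' : ℝ → ℝ} {μ k : ℝ} (hk : 0 < k)
    (hμ : 0 ≤ μ) (hμk : μ ≤ k ^ 2)
    (hp : ∀ t, HasDerivAt p (p' t) t) (hq : ∀ t, HasDerivAt q (q' t) t)
    (hp' : ∀ t, HasDerivAt p' (-(u t * q t) - μ * p t) t)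
    (hq' : ∀ t, HasDerivAt q' (u t * p t + μ * q t) t) {x₀ : ℝ}
    (hmax : ∀ t, p t ^ 2 + q t ^ 2 ≤ p x₀ ^ 2 + q x₀ ^ 2)
    (hpos : 0 < p x₀ ^ 2 + q x₀ ^ 2) {y : ℝ} (hy : k * |y - x₀| < π / 2) :
    0 < p y ^ 2 + q y ^ 2 ∧
      |p y * p' y + q y * q' y| ≤ k * tan (k * |y - x₀|) * (p y ^ 2 + q y ^ 2) := by
  have hcos : 0 < cos (k * |y - x₀|) :=
    cos_pos_of_mem_Ioo ⟨by linarith [pi_pos, mul_nonneg hk.le (abs_nonneg (y - x₀))], hy⟩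
  set N : ℝ → ℝ := fun t => p t ^ 2 + q t ^ 2 with hN
  set D : ℝ → ℝ := fun t => p t * p' t + q t * q' t with hD
  have hN0 : ∀ t, 0 ≤ N t := fun t => by positivity
  have hNd : ∀ t, HasDerivAt N (2 * D t) t := fun t => by
    refine (((hp t).pow 2).add ((hq t).pow 2)).congr_deriv ?_
    simp only [hD]; push_cast; ring
  have hDd : ∀ t, HasDerivAt D (p' t ^ 2 + q' t ^ 2 - μ * (p t ^ 2 - q t ^ 2)) t := fun t => by
    refine (((hp t).mul (hp' t)).add ((hq t).mul (hq' t))).congr_deriv ?_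
    ring
  have reg : ∀ ε : ℝ, 0 < ε → N x₀ * cos (k * |y - x₀|) ^ 2 ≤ N y + ε ∧
      |D y| ≤ k * tan (k * |y - x₀|) * (N y + ε) := by
    intro ε hε
    set g : ℝ → ℝ := fun t => √(N t + ε) with hg
    have hgpos : ∀ t, 0 < g t := fun t => sqrt_pos.2 (by linarith [hN0 t])
    have hgsq : ∀ t, g t ^ 2 = N t + ε := fun t => sq_sqrt (by linarith [hN0 t])
    have hgd : ∀ t, HasDerivAt g (D t / g t) t := fun t => by
      refine (((hNd t).add_const ε).sqrt (by linarith [hN0 t])).congr_deriv ?_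
      rw [mul_div_mul_left _ _ two_ne_zero]
    have hgd' := fun t => (hDd t).div (hgd t) (hgpos t).ne'
    obtain ⟨h1, h2⟩ := cos_le_and_abs_deriv_le_tan hk hgd hgd' (fun t => by
      have hgt := hgpos t
      have hkey : (p' t ^ 2 + q' t ^ 2 - μ * (p t ^ 2 - q t ^ 2)) * g t - D t * (D t / g t)
          + k ^ 2 * g t * g t ^ 2 =
          ((p' t ^ 2 + q' t ^ 2 - μ * (p t ^ 2 - q t ^ 2)) * g t ^ 2 - D t ^ 2
          + k ^ 2 * (g t ^ 2) ^ 2) / g t := by field_simp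
      have hrw : ((p' t ^ 2 + q' t ^ 2 - μ * (p t ^ 2 - q t ^ 2)) * g t - D t * (D t / g t))
          / g t ^ 2 + k ^ 2 * g t = ((p' t ^ 2 + q' t ^ 2 - μ * (p t ^ 2 - q t ^ 2)) * g t ^ 2
          - D t ^ 2 + k ^ 2 * (g t ^ 2) ^ 2) / g t / g t ^ 2 := by
        rw [← hkey]; field_simp
      rw [hrw]
      refine div_nonneg (div_nonneg ?_ hgt.le) (by positivity)
      have hcs : D t ^ 2 ≤ (p' t ^ 2 + q' t ^ 2) * N t := by
        simp only [hD, hN]; nlinarith [sq_nonneg (p t * q' t - q t * p' t)]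
      have hμN : μ * (p t ^ 2 - q t ^ 2) ≤ k ^ 2 * g t ^ 2 := by
        have h : p t ^ 2 - q t ^ 2 ≤ N t := by simp only [hN]; nlinarith [sq_nonneg (q t)]
        refine (mul_le_mul_of_nonneg_left h hμ).trans
          (mul_le_mul hμk ?_ (hN0 t) (by positivity))
        rw [hgsq]; linarith
      have h3 : (p' t ^ 2 + q' t ^ 2) * N t ≤ (p' t ^ 2 + q' t ^ 2) * g t ^ 2 := by
        rw [hgsq]; exact mul_le_mul_of_nonneg_left (by linarith) (by positivity)
      nlinarith [mul_le_mul_of_nonneg_right hμN (sq_nonneg (g t))])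
      (fun t => sqrt_le_sqrt (by linarith [hmax t])) hy
    constructor
    · have := pow_le_pow_left₀ (mul_nonneg (hgpos x₀).le hcos.le) h1 2
      rw [mul_pow, hgsq, hgsq] at this
      nlinarith [mul_nonneg hε.le (sq_nonneg (cos (k * |y - x₀|)))]
    · rw [abs_div, abs_of_pos (hgpos y), div_le_iff₀ (hgpos y)] at h2
      rw [← hgsq]; linarith
  constructor
  · refine lt_of_lt_of_le (mul_pos hpos (pow_pos hcos 2)) ?_
    exact le_of_forall_pos_le_add fun ε hε => (reg ε hε).1
  · have hlim : Tendsto (fun ε : ℝ => k * tan (k * |y - x₀|) * (N y + ε)) (𝓝[>] 0)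
        (𝓝 (k * tan (k * |y - x₀|) * (N y + 0))) :=
      ((by fun_prop : Continuous fun ε : ℝ => k * tan (k * |y - x₀|) * (N y + ε)).tendsto
        0).mono_left nhdsWithin_le_nhds
    rw [add_zero] at hlim
    exact ge_of_tendsto hlim (eventually_mem_nhdsWithin.mono fun ε hε => (reg ε hε).2)

/-- One-sided bound for a primitive `ψ` of `u`, where `a` and `b` are the real and imaginary parts
of a logarithmic derivative `f' / f`. -/
theorem integral_sq_le_tan {a b ψ u v w : ℝ → ℝ} {k δ : ℝ} (hk : 0 < k) (hδ : 0 ≤ δ)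
    (hkδ : k * δ < π / 2) (hψc : Continuous ψ)
    (ha : ∀ s ∈ Icc 0 δ, HasDerivAt a (b s ^ 2 - a s ^ 2 - v s) s)
    (hb : ∀ s ∈ Icc 0 δ, HasDerivAt b (u s - 2 * a s * b s + w s) s)
    (hψ : ∀ s ∈ Icc 0 δ, HasDerivAt ψ (u s) s)
    (hv : ∀ s ∈ Icc 0 δ, |v s| ≤ k ^ 2) (hw : ∀ s ∈ Icc 0 δ, |w s| ≤ k ^ 2)
    (hat : ∀ s ∈ Icc 0 δ, |a s| ≤ k * tan (k * s)) :
    ∫ s in (0 : ℝ)..δ, (ψ s - (ψ 0 - b 0)) ^ 2 ≤ 18 * (k * tan (k * δ)) := by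
  have hT : ∀ s ∈ Icc 0 δ, HasDerivAt (fun s => k * tan (k * s))
      (k ^ 2 + (k * tan (k * s)) ^ 2) s := by
    intro s hs
    have hcos : cos (k * s) ≠ 0 := (cos_pos_of_mem_Ioo
      ⟨by nlinarith [hs.1, pi_pos], by nlinarith [hs.2]⟩).ne'
    have h1 : HasDerivAt (fun s : ℝ => k * s) k s := by
      simpa using (hasDerivAt_id s).const_mul k
    refine (((hasDerivAt_tan hcos).comp s h1).const_mul k).congr_deriv ?_
    rw [one_div, ← inv_one_add_tan_sq hcos, inv_inv]
    ring
  have mono : ∀ {g g' : ℝ → ℝ}, (∀ s ∈ Icc 0 δ, HasDerivAt g (g' s) s) →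
      (∀ s ∈ Icc 0 δ, 0 ≤ g' s) → ∀ s ∈ Icc 0 δ, g 0 ≤ g s := by
    intro g g' hg hg' s hs
    exact monotoneOn_of_hasDerivWithinAt_nonneg (convex_Icc 0 δ)
      (fun t ht => (hg t ht).continuousAt.continuousWithinAt)
      (fun t ht => (hg t (interior_subset ht)).hasDerivWithinAt)
      (fun t ht => hg' t (interior_subset ht)) (left_mem_Icc.2 hδ) hs hs.1
  have ha0 : a 0 = 0 := by simpa using hat 0 (left_mem_Icc.2 hδ)
  have hasq : ∀ s ∈ Icc 0 δ, a s ^ 2 ≤ (k * tan (k * s)) ^ 2 := fun s hs =>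
    sq_le_sq' (abs_le.1 (hat s hs)).1 (abs_le.1 (hat s hs)).2
  have hr2 : √2 ^ 2 = 2 := sq_sqrt zero_le_two
  have hr0 : 0 < √2 := sqrt_pos.2 two_pos
  have hr1 : 1 ≤ √2 := one_le_sqrt.2 one_le_two
  have hpt : ∀ s ∈ Icc 0 δ, |√2 * (2 * a s * b s - w s)| ≤
      (b s ^ 2 - a s ^ 2 - v s) + 3 * (k ^ 2 + (k * tan (k * s)) ^ 2) := by
    intro s hs
    have h1 := hasq s hs
    have h2 := abs_le.1 (hv s hs)
    have h3 := abs_le.1 (hw s hs)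
    have h4 : √2 ≤ 2 := by nlinarith
    have h5 : √2 * |w s| ≤ 2 * k ^ 2 := mul_le_mul h4 (hw s hs) (abs_nonneg _) (by norm_num)
    have h6 : |√2 * (2 * a s * b s)| ≤ 2 * a s ^ 2 + b s ^ 2 := by
      rw [abs_le]
      constructor <;> nlinarith [sq_nonneg (√2 * a s + b s), sq_nonneg (√2 * a s - b s)]
    rw [mul_sub]
    refine (abs_sub _ _).trans ?_
    rw [abs_mul √2 (w s), abs_of_pos hr0]
    linarith
  set R : ℝ → ℝ := fun s => ψ s - (ψ 0 - b 0) - b s with hR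
  have hRd : ∀ s ∈ Icc 0 δ, HasDerivAt R (2 * a s * b s - w s) s := fun s hs => by
    refine (((hψ s hs).sub_const _).sub (hb s hs)).congr_deriv ?_
    ring
  have hR0 : R 0 = 0 := by simp [hR]
  have hRb : ∀ s ∈ Icc 0 δ, |√2 * R s| ≤ 4 * (k * tan (k * s)) := by
    intro s hs
    have h1 := mono (fun s hs => ((ha s hs).add ((hT s hs).const_mul 3)).sub
      ((hRd s hs).const_mul √2)) (fun s hs => by linarith [(abs_le.1 (hpt s hs)).2]) s hs
    have h2 := mono (fun s hs => ((ha s hs).add ((hT s hs).const_mul 3)).add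
      ((hRd s hs).const_mul √2)) (fun s hs => by linarith [(abs_le.1 (hpt s hs)).1]) s hs
    simp only [Pi.add_apply, Pi.sub_apply, ha0, hR0, mul_zero, tan_zero, add_zero, sub_zero]
      at h1 h2
    have h3 := abs_le.1 (hat s hs)
    rw [abs_le]
    constructor <;> linarith
  have hcont : Continuous fun s => (ψ s - (ψ 0 - b 0)) ^ 2 := by fun_prop
  have hfin := mono (g := fun s => 3 * a s + 15 * (k * tan (k * s))
      - ∫ t in (0 : ℝ)..s, (ψ t - (ψ 0 - b 0)) ^ 2)
    (fun s hs => (((ha s hs).const_mul 3).add ((hT s hs).const_mul 15)).sub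
      (intervalIntegral.integral_hasDerivAt_right (hcont.intervalIntegrable _ _)
        (hcont.stronglyMeasurableAtFilter _ _) hcont.continuousAt))
    (fun s hs => by
      have h1 := hasq s hs
      have h2 := abs_le.1 (hv s hs)
      have h3 := sq_le_sq' (abs_le.1 (hRb s hs)).1 (abs_le.1 (hRb s hs)).2
      rw [mul_pow, hr2] at h3
      have h4 : ψ s - (ψ 0 - b 0) = b s + R s := by simp only [hR]; ring
      rw [h4]
      nlinarith [sq_nonneg (2 * b s - R s), sq_nonneg k]) δ (right_mem_Icc.2 hδ)
  simp only [ha0, mul_zero, tan_zero, add_zero, intervalIntegral.integral_same, sub_zero] at hfin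
  linarith [(abs_le.1 (hat δ (right_mem_Icc.2 hδ))).2]

theorem omega0_le {δ : ℝ} (hδ : 0 ≤ δ) (ψ : ℝ → ℝ) (x c : ℝ) :
    omega0 δ ψ ≤ ∫ y in (x - δ)..(x + δ), (ψ y - c) ^ 2 := by
  refine csInf_le ⟨0, ?_⟩ ⟨x, c, rfl⟩
  rintro r ⟨x, c, rfl⟩
  exact intervalIntegral.integral_nonneg (by linarith) fun _ _ => sq_nonneg _

theorem omega0_le_tan {u p q p' q' ψ : ℝ → ℝ} {μ k δ : ℝ} (hk : 0 < k)
    (hμ : 0 ≤ μ) (hμk : μ ≤ k ^ 2) (hδ : 0 ≤ δ) (hkδ : k * δ < π / 2)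
    (hψ : ∀ y, HasDerivAt ψ (u y) y)
    (hp : ∀ t, HasDerivAt p (p' t) t) (hq : ∀ t, HasDerivAt q (q' t) t)
    (hp' : ∀ t, HasDerivAt p' (-(u t * q t) - μ * p t) t)
    (hq' : ∀ t, HasDerivAt q' (u t * p t + μ * q t) t) {x₀ : ℝ}
    (hmax : ∀ t, p t ^ 2 + q t ^ 2 ≤ p x₀ ^ 2 + q x₀ ^ 2)
    (hpos : 0 < p x₀ ^ 2 + q x₀ ^ 2) :
    omega0 δ ψ ≤ 36 * k * tan (k * δ) := by
  set N : ℝ → ℝ := fun t => p t ^ 2 + q t ^ 2 with hN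
  set a : ℝ → ℝ := fun t => (p t * p' t + q t * q' t) / N t with ha
  set b : ℝ → ℝ := fun t => (p t * q' t - q t * p' t) / N t with hb
  set v : ℝ → ℝ := fun t => μ * (p t ^ 2 - q t ^ 2) / N t with hv
  set w : ℝ → ℝ := fun t => μ * (2 * p t * q t) / N t with hw
  have hbound : ∀ t, |t - x₀| ≤ δ → 0 < N t ∧ |a t| ≤ k * tan (k * |t - x₀|) := by
    intro t ht
    obtain ⟨h1, h2⟩ := norm_sq_pos_and_abs_le_tan hk hμ hμk hp hq hp' hq' hmax hpos (y := t)
      ((mul_le_mul_of_nonneg_left ht hk.le).trans_lt hkδ)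
    refine ⟨h1, ?_⟩
    simp only [ha]
    rwa [abs_div, abs_of_pos h1, div_le_iff₀ h1]
  have hNd : ∀ t, HasDerivAt N (2 * (p t * p' t + q t * q' t)) t := fun t => by
    refine (((hp t).pow 2).add ((hq t).pow 2)).congr_deriv ?_
    push_cast; ring
  have had : ∀ t, |t - x₀| ≤ δ → HasDerivAt a (b t ^ 2 - a t ^ 2 - v t) t := by
    intro t ht
    have h0 := (hbound t ht).1.ne'
    refine ((((hp t).mul (hp' t)).add ((hq t).mul (hq' t))).div (hNd t) h0).congr_deriv ?_
    simp only [ha, hb, hv, Pi.add_apply, Pi.mul_apply]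
    field_simp
    simp only [hN]; ring
  have hbd : ∀ t, |t - x₀| ≤ δ → HasDerivAt b (u t - 2 * a t * b t + w t) t := by
    intro t ht
    have h0 := (hbound t ht).1.ne'
    refine ((((hp t).mul (hq' t)).sub ((hq t).mul (hp' t))).div (hNd t) h0).congr_deriv ?_
    simp only [ha, hb, hw, Pi.sub_apply, Pi.mul_apply]
    field_simp
    simp only [hN]; ring
  have hvb : ∀ t, |t - x₀| ≤ δ → |v t| ≤ k ^ 2 := by
    intro t ht
    have h0 := (hbound t ht).1
    simp only [hv]
    rw [abs_div, abs_of_pos h0, div_le_iff₀ h0, abs_mul, abs_of_nonneg hμ]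
    refine mul_le_mul hμk ?_ (abs_nonneg _) (sq_nonneg k)
    rw [abs_le]; simp only [hN]
    constructor <;> nlinarith [sq_nonneg (p t), sq_nonneg (q t)]
  have hwb : ∀ t, |t - x₀| ≤ δ → |w t| ≤ k ^ 2 := by
    intro t ht
    have h0 := (hbound t ht).1
    simp only [hw]
    rw [abs_div, abs_of_pos h0, div_le_iff₀ h0, abs_mul, abs_of_nonneg hμ]
    refine mul_le_mul hμk ?_ (abs_nonneg _) (sq_nonneg k)
    rw [abs_le]; simp only [hN]
    constructor <;> nlinarith [sq_nonneg (p t + q t), sq_nonneg (p t - q t)]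
  have hψc : Continuous ψ := continuous_iff_continuousAt.2 fun t => (hψ t).continuousAt
  have hr : ∀ s ∈ Icc 0 δ, |x₀ + s - x₀| = s := fun s hs => by
    rw [add_sub_cancel_left, abs_of_nonneg hs.1]
  have hl : ∀ s ∈ Icc 0 δ, |x₀ - s - x₀| = s := fun s hs => by
    rw [show x₀ - s - x₀ = -s by ring, abs_neg, abs_of_nonneg hs.1]
  have hright := integral_sq_le_tan (a := fun s => a (x₀ + s)) (b := fun s => b (x₀ + s))
    (ψ := fun s => ψ (x₀ + s)) (u := fun s => u (x₀ + s)) (v := fun s => v (x₀ + s))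
    (w := fun s => w (x₀ + s)) hk hδ hkδ (by fun_prop)
    (fun s hs => (had _ ((hr s hs).trans_le hs.2)).comp_const_add x₀ s)
    (fun s hs => (hbd _ ((hr s hs).trans_le hs.2)).comp_const_add x₀ s)
    (fun s _ => (hψ _).comp_const_add x₀ s)
    (fun s hs => hvb _ ((hr s hs).trans_le hs.2)) (fun s hs => hwb _ ((hr s hs).trans_le hs.2))
    (fun s hs => by
      have := (hbound _ ((hr s hs).trans_le hs.2)).2
      rwa [hr s hs] at this)
  have hleft := integral_sq_le_tan (a := fun s => -a (x₀ - s)) (b := fun s => -b (x₀ - s))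
    (ψ := fun s => -ψ (x₀ - s)) (u := fun s => u (x₀ - s)) (v := fun s => v (x₀ - s))
    (w := fun s => w (x₀ - s)) hk hδ hkδ (by fun_prop)
    (fun s hs => by
      refine ((had _ ((hl s hs).trans_le hs.2)).comp_const_sub x₀ s).neg.congr_deriv ?_
      ring)
    (fun s hs => by
      refine ((hbd _ ((hl s hs).trans_le hs.2)).comp_const_sub x₀ s).neg.congr_deriv ?_
      ring)
    (fun s _ => by
      refine ((hψ _).comp_const_sub x₀ s).neg.congr_deriv ?_
      ring)
    (fun s hs => hvb _ ((hl s hs).trans_le hs.2)) (fun s hs => hwb _ ((hl s hs).trans_le hs.2))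
    (fun s hs => by
      have := (hbound _ ((hl s hs).trans_le hs.2)).2
      rwa [hl s hs, ← abs_neg] at this)
  set c := ψ x₀ - b x₀ with hc
  have hi : ∀ x y, IntervalIntegrable (fun t => (ψ t - c) ^ 2) MeasureTheory.volume x y :=
    fun x y => (by fun_prop : Continuous fun t => (ψ t - c) ^ 2).intervalIntegrable x y
  have hright' : ∫ t in x₀..(x₀ + δ), (ψ t - c) ^ 2 ≤ 18 * (k * tan (k * δ)) := by
    have := intervalIntegral.integral_comp_add_left (a := 0) (b := δ)
      (fun t => (ψ t - c) ^ 2) x₀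
    rw [add_zero] at this
    rw [← this]
    simpa only [add_zero] using hright
  have hleft' : ∫ t in (x₀ - δ)..x₀, (ψ t - c) ^ 2 ≤ 18 * (k * tan (k * δ)) := by
    have := intervalIntegral.integral_comp_sub_left (a := 0) (b := δ)
      (fun t => (ψ t - c) ^ 2) x₀
    rw [sub_zero] at this
    rw [← this]
    refine le_of_eq_of_le (intervalIntegral.integral_congr fun s _ => ?_) hleft
    simp only [sub_zero, hc]
    ring
  calc omega0 δ ψ ≤ ∫ t in (x₀ - δ)..(x₀ + δ), (ψ t - c) ^ 2 := omega0_le hδ ψ x₀ c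
    _ = (∫ t in (x₀ - δ)..x₀, (ψ t - c) ^ 2) + ∫ t in x₀..(x₀ + δ), (ψ t - c) ^ 2 :=
      (intervalIntegral.integral_add_adjacent_intervals (hi _ _) (hi _ _)).symm
    _ ≤ 36 * k * tan (k * δ) := by linarith

theorem Function.Periodic.exists_forall_le {g : ℝ → ℝ} {T : ℝ} (hper : Function.Periodic g T)
    (hT : 0 < T) (hg : Continuous g) : ∃ x₀, ∀ t, g t ≤ g x₀ := by
  obtain ⟨x₀, -, h⟩ := isCompact_Icc.exists_isMaxOn (nonempty_Icc.2 hT.le) hg.continuousOn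
  refine ⟨x₀, fun t => ?_⟩
  obtain ⟨s, hs, hts⟩ := hper.exists_mem_Ico₀ hT t
  rw [hts]
  exact h (Ico_subset_Icc_self hs)

/-- Key lemma for the resolvent estimate of `H = -∂_y² + iu(y)`: if a nonzero
C² `2π`-periodic `f` satisfies `-f'' + iuf = μ f̄` with `μ ≥ 0`, then for every
`δ > 0` either `√μ ≥ π/(2δ)` or `36 √μ tan(√μ δ) ≥ ω₀(δ, u)`. -/
theorem stmt_7 (u : ℝ → ℝ) (hu : Continuous u) (huper : Function.Periodic u (2 * Real.pi))
    (ψ : ℝ → ℝ) (hψ : ∀ y, HasDerivAt ψ (u y) y)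
    (f : ℝ → ℂ) (hf : ContDiff ℝ 2 f) (hfper : Function.Periodic f (2 * Real.pi))
    (hfne : ∃ y, f y ≠ 0) (μ : ℝ) (hμ : 0 ≤ μ)
    (heq : ∀ y, -(deriv (deriv f)) y + Complex.I * (u y : ℂ) * f y =
      (μ : ℂ) * (starRingEnd ℂ) (f y)) :
    ∀ δ : ℝ, 0 < δ →
      Real.pi / (2 * δ) ≤ Real.sqrt μ ∨
        omega0 δ ψ ≤ 36 * Real.sqrt μ * Real.tan (Real.sqrt μ * δ) := by
  intro δ hδ
  refine or_iff_not_imp_left.2 fun hlt => ?_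
  rw [not_le, lt_div_iff₀ (by positivity)] at hlt
  have hf1 : ∀ t, HasDerivAt f (deriv f t) t := fun t =>
    (hf.differentiable (by norm_num) t).hasDerivAt
  have hf2 : ∀ t, HasDerivAt (deriv f) (deriv (deriv f) t) t := fun t => by
    have : ContDiff ℝ 1 (deriv f) := ((contDiff_succ_iff_deriv (n := 1)).1 hf).2.2
    exact (this.differentiable (by norm_num) t).hasDerivAt
  have hre : ∀ {g : ℝ → ℂ} {g' : ℂ} {t : ℝ}, HasDerivAt g g' t →
      HasDerivAt (fun t => (g t).re) g'.re t := fun h =>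
    Complex.reCLM.hasFDerivAt.comp_hasDerivAt _ h
  have him : ∀ {g : ℝ → ℂ} {g' : ℂ} {t : ℝ}, HasDerivAt g g' t →
      HasDerivAt (fun t => (g t).im) g'.im t := fun h =>
    Complex.imCLM.hasFDerivAt.comp_hasDerivAt _ h
  obtain ⟨x₀, hx₀⟩ := Function.Periodic.exists_forall_le
    (g := fun t => (f t).re ^ 2 + (f t).im ^ 2) (fun t => by simp only [hfper t])
    two_pi_pos (by have := hf.continuous; fun_prop)
  obtain ⟨y, hy⟩ := hfne
  have hpos : 0 < (f x₀).re ^ 2 + (f x₀).im ^ 2 := by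
    refine lt_of_lt_of_le ?_ (hx₀ y)
    have := Complex.normSq_pos.2 hy
    rw [Complex.normSq_apply] at this
    simpa only [sq] using this
  have hcos : cos (√μ * δ) ≠ 0 :=
    (cos_pos_of_mem_Ioo ⟨by linarith [pi_pos, mul_nonneg (sqrt_nonneg μ) hδ.le],
      by linarith⟩).ne'
  have hcont : ContinuousAt (fun k : ℝ => 36 * k * tan (k * δ)) (√μ) :=
    (by fun_prop : ContinuousAt (fun k : ℝ => 36 * k) (√μ)).mul
      (ContinuousAt.comp (f := fun k : ℝ => k * δ) (continuousAt_tan.2 hcos) (by fun_prop))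
  refine ge_of_tendsto (hcont.tendsto.mono_left (nhdsWithin_le_nhds (s := Ioi (√μ)))) ?_
  have hsmall : ∀ᶠ k : ℝ in 𝓝[>] (√μ), k * (2 * δ) < π :=
    nhdsWithin_le_nhds ((by fun_prop : Continuous fun k : ℝ => k * (2 * δ)).continuousAt.eventually
      (gt_mem_nhds hlt))
  filter_upwards [hsmall, eventually_mem_nhdsWithin] with k hk hkμ
  have hkpos : 0 < k := (sqrt_nonneg μ).trans_lt hkμ
  refine omega0_le_tan hkpos hμ (sqrt_le_left hkpos.le |>.1 hkμ.le) hδ.le (by linarith) hψ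
    (fun t => hre (hf1 t)) (fun t => him (hf1 t))
    (fun t => (hre (hf2 t)).congr_deriv ?_) (fun t => (him (hf2 t)).congr_deriv ?_) hx₀ hpos
  · have := congrArg Complex.re (heq t)
    simp at this
    linarith
  · have := congrArg Complex.im (heq t)
    simp at this
    linarith
end

section
/- Let u : ℝ → ℝ be continuous and 2π-periodic, μ > 0, and let f : ℝ → ℂ be twice continuously differentiable, 2π-periodic, satisfying −f''(y) + i u(y) f(y) = μ \overline{f(y)} for all y, with sup_y |f(y)| = 1 and |f(y₀)| = 1 for some y₀ ∈ ℝ. Then for every y with |y − y₀| < π/(2√μ) one has |f(y)| ≥ cos(√μ (y − y₀)); in particular f(y) ≠ 0 on the interval (y₀ − π/(2√μ), y₀ + π/(2√μ)). -/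
/-- Sturm comparison to the right of a critical point: if `r'' + k² r ≥ 0`, `r' a = 0` and
`r a ≥ 1`, then `r` stays above `cos (k (x - a))` up to the first zero of the cosine. -/
theorem cos_le_of_deriv2_add_nonneg_right {r r' r'' : ℝ → ℝ} {k a : ℝ} (hk : 0 < k)
    (hr : ∀ x, HasDerivAt r (r' x) x) (hr' : ∀ x, HasDerivAt r' (r'' x) x)
    (hineq : ∀ x, 0 ≤ r'' x + k ^ 2 * r x) (ha' : r' a = 0) (ha : 1 ≤ r a)
    {x : ℝ} (hax : a ≤ x) (hx : x - a < Real.pi / (2 * k)) :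
    Real.cos (k * (x - a)) ≤ r x := by
  have hcos : ∀ t ∈ Set.Icc a x, 0 < Real.cos (k * (t - a)) := by
    intro t ht
    have h1 : k * (t - a) < Real.pi / 2 := by
      have h2 : k * (t - a) ≤ k * (x - a) := by
        have := ht.2
        gcongr
      have h3 : k * (x - a) < k * (Real.pi / (2 * k)) := by gcongr
      have h4 : k * (Real.pi / (2 * k)) = Real.pi / 2 := by field_simp
      linarith
    have h0 : 0 ≤ k * (t - a) := mul_nonneg hk.le (sub_nonneg.2 ht.1)
    exact Real.cos_pos_of_mem_Ioo ⟨by linarith [Real.pi_pos], h1⟩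
  have hlin : ∀ t, HasDerivAt (fun s => k * (s - a)) k t := fun t => by
    simpa using ((hasDerivAt_id t).sub_const a).const_mul k
  have hdc : ∀ t, HasDerivAt (fun s => Real.cos (k * (s - a))) (-Real.sin (k * (t - a)) * k) t :=
    fun t => (hlin t).cos
  have hds : ∀ t, HasDerivAt (fun s => Real.sin (k * (s - a))) (Real.cos (k * (t - a)) * k) t :=
    fun t => (hlin t).sin
  have hdW : ∀ t, HasDerivAt
      (fun s => r' s * Real.cos (k * (s - a)) + k * (r s * Real.sin (k * (s - a))))
      ((r'' t + k ^ 2 * r t) * Real.cos (k * (t - a))) t := fun t =>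
    (((hr' t).mul (hdc t)).add (((hr t).mul (hds t)).const_mul k)).congr_deriv (by ring)
  have hW : ∀ t ∈ Set.Icc a x,
      0 ≤ r' t * Real.cos (k * (t - a)) + k * (r t * Real.sin (k * (t - a))) := by
    have hmono := monotoneOn_of_deriv_nonneg (convex_Icc a x)
      (fun t _ => (hdW t).continuousAt.continuousWithinAt)
      (fun t _ => (hdW t).differentiableAt.differentiableWithinAt)
      (fun t ht => by
        rw [(hdW t).deriv]
        exact mul_nonneg (hineq t) (hcos t (interior_subset ht)).le)
    intro t ht
    simpa [ha'] using hmono (Set.left_mem_Icc.2 hax) ht ht.1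
  have hdq : ∀ t ∈ Set.Icc a x, HasDerivAt (fun s => r s / Real.cos (k * (s - a)))
      ((r' t * Real.cos (k * (t - a)) + k * (r t * Real.sin (k * (t - a)))) /
        Real.cos (k * (t - a)) ^ 2) t := fun t ht =>
    ((hr t).div (hdc t) (hcos t ht).ne').congr_deriv (by ring)
  have hmono := monotoneOn_of_deriv_nonneg (convex_Icc a x)
    (fun t ht => (hdq t ht).continuousAt.continuousWithinAt)
    (fun t ht => (hdq t (interior_subset ht)).differentiableAt.differentiableWithinAt)
    (fun t ht => by
      rw [(hdq t (interior_subset ht)).deriv]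
      exact div_nonneg (hW t (interior_subset ht)) (sq_nonneg _))
  have hle := hmono (Set.left_mem_Icc.2 hax) (Set.right_mem_Icc.2 hax) hax
  have hone : 1 ≤ r x / Real.cos (k * (x - a)) := ha.trans (by simpa using hle)
  simpa using (le_div_iff₀ (hcos x (Set.right_mem_Icc.2 hax))).1 hone

/-- Two-sided Sturm comparison with the cosine around a critical point. -/
theorem cos_le_of_deriv2_add_nonneg {r r' r'' : ℝ → ℝ} {k a : ℝ} (hk : 0 < k)
    (hr : ∀ x, HasDerivAt r (r' x) x) (hr' : ∀ x, HasDerivAt r' (r'' x) x)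
    (hineq : ∀ x, 0 ≤ r'' x + k ^ 2 * r x) (ha' : r' a = 0) (ha : 1 ≤ r a)
    {x : ℝ} (hx : |x - a| < Real.pi / (2 * k)) :
    Real.cos (k * (x - a)) ≤ r x := by
  rcases le_total a x with hax | hxa
  · exact cos_le_of_deriv2_add_nonneg_right hk hr hr' hineq ha' ha hax
      ((le_abs_self _).trans_lt hx)
  · have hneg : ∀ t : ℝ, HasDerivAt (fun s : ℝ => -s) (-1) t := fun t => hasDerivAt_neg t
    have h := cos_le_of_deriv2_add_nonneg_right (r := fun s => r (-s)) (r' := fun s => -r' (-s))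
      (r'' := fun s => r'' (-s)) (a := -a) (x := -x) hk
      (fun t => ((hr (-t)).comp t (hneg t)).congr_deriv (by ring))
      (fun t => ((hr' (-t)).comp t (hneg t)).neg.congr_deriv (by ring))
      (fun t => hineq (-t)) (by simpa using ha') (by simpa using ha) (neg_le_neg hxa)
      (by linarith [neg_abs_le (x - a)])
    have harg : k * (-x - -a) = -(k * (x - a)) := by ring
    simpa only [harg, Real.cos_neg, neg_neg] using h

/-- If `⟪g, g''⟫ ≥ -k² ‖g‖²` and `‖g‖` has a critical point at `a` with `‖g a‖ ≥ 1`, then `‖g‖`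
dominates `cos (k (x - a))` on the quarter periods around `a`. The norm is regularized to
`√(‖g‖² + ε)`, which is smooth across the zeros of `g`. -/
theorem cos_le_norm_of_inner_deriv2 {E : Type*} [NormedAddCommGroup E] [InnerProductSpace ℝ E]
    {g g' g'' : ℝ → E} {k a : ℝ} (hk : 0 < k)
    (hg : ∀ x, HasDerivAt g (g' x) x) (hg' : ∀ x, HasDerivAt g' (g'' x) x)
    (hineq : ∀ x, -(k ^ 2 * ‖g x‖ ^ 2) ≤ inner ℝ (g x) (g'' x))
    (ha' : inner ℝ (g a) (g' a) = 0) (ha : 1 ≤ ‖g a‖)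
    {x : ℝ} (hx : |x - a| < Real.pi / (2 * k)) :
    Real.cos (k * (x - a)) ≤ ‖g x‖ := by
  have hreg : ∀ ε : ℝ, 0 < ε → Real.cos (k * (x - a)) ≤ Real.sqrt (‖g x‖ ^ 2 + ε) := by
    intro ε hε
    have hpos : ∀ t, 0 < ‖g t‖ ^ 2 + ε := fun t => by positivity
    have hspos : ∀ t, 0 < Real.sqrt (‖g t‖ ^ 2 + ε) := fun t => Real.sqrt_pos.2 (hpos t)
    have hr : ∀ t, HasDerivAt (fun s => Real.sqrt (‖g s‖ ^ 2 + ε))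
        (inner ℝ (g t) (g' t) / Real.sqrt (‖g t‖ ^ 2 + ε)) t := fun t => by
      convert ((hg t).norm_sq.add_const ε).sqrt (hpos t).ne' using 1
      have := hspos t
      field_simp
    refine cos_le_of_deriv2_add_nonneg hk hr
      (fun t => ((hg t).inner ℝ (hg' t)).div (hr t) (hspos t).ne') (fun t => ?_)
      (by simp [ha']) ?_ hx
    · have hs := hspos t
      have hsq := Real.sq_sqrt (hpos t).le
      set s := Real.sqrt (‖g t‖ ^ 2 + ε)
      set q := inner ℝ (g t) (g' t)
      have hcs : q ^ 2 ≤ ‖g t‖ ^ 2 * ‖g' t‖ ^ 2 := by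
        rw [← mul_pow, ← sq_abs]
        exact pow_le_pow_left₀ (abs_nonneg _) (abs_real_inner_le_norm _ _) 2
      have hi := hineq t
      have hcs' : q ^ 2 ≤ s ^ 2 * ‖g' t‖ ^ 2 := by
        rw [hsq]
        nlinarith [mul_nonneg hε.le (sq_nonneg ‖g' t‖)]
      have hlow : -(k ^ 2 * s ^ 2) ≤ inner ℝ (g t) (g'' t) := by
        rw [hsq]
        nlinarith [mul_nonneg hε.le (sq_nonneg k)]
      rw [real_inner_self_eq_norm_sq]
      have hrw : ((inner ℝ (g t) (g'' t) + ‖g' t‖ ^ 2) * s - q * (q / s)) / s ^ 2 + k ^ 2 * s =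
          ((inner ℝ (g t) (g'' t) + k ^ 2 * s ^ 2) * s ^ 2 + (s ^ 2 * ‖g' t‖ ^ 2 - q ^ 2)) /
            s ^ 3 := by
        field_simp
        ring
      rw [hrw]
      have h1 := mul_nonneg (neg_le_iff_add_nonneg.1 hlow) (sq_nonneg s)
      exact div_nonneg (add_nonneg h1 (sub_nonneg.2 hcs')) (by positivity)
    · exact Real.one_le_sqrt.2 (by nlinarith)
  have hlim : Filter.Tendsto (fun ε : ℝ => Real.sqrt (‖g x‖ ^ 2 + ε))
      (nhdsWithin 0 (Set.Ioi 0)) (nhds ‖g x‖) := by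
    have hc : Continuous fun ε : ℝ => Real.sqrt (‖g x‖ ^ 2 + ε) := by fun_prop
    simpa using (hc.tendsto 0).mono_left nhdsWithin_le_nhds
  exact ge_of_tendsto hlim (eventually_nhdsWithin_of_forall hreg)

/-- Lower bound on `|f|` near a maximum point: if `-f'' + iuf = μ f̄` with
`μ > 0`, `sup |f| = 1` and `|f(y₀)| = 1`, then `|f(y)| ≥ cos(√μ (y - y₀))` for
`|y - y₀| < π/(2√μ)`; in particular `f` has no zero in that interval. -/
theorem stmt_8 (u : ℝ → ℝ) (hu : Continuous u) (huper : Function.Periodic u (2 * Real.pi))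
    (μ : ℝ) (hμ : 0 < μ)
    (f : ℝ → ℂ) (hf : ContDiff ℝ 2 f) (hfper : Function.Periodic f (2 * Real.pi))
    (heq : ∀ y, -(deriv (deriv f)) y + Complex.I * (u y : ℂ) * f y =
      (μ : ℂ) * (starRingEnd ℂ) (f y))
    (hsup : ∀ y, ‖f y‖ ≤ 1) (y₀ : ℝ) (hy₀ : ‖f y₀‖ = 1) :
    ∀ y : ℝ, |y - y₀| < Real.pi / (2 * Real.sqrt μ) →
      Real.cos (Real.sqrt μ * (y - y₀)) ≤ ‖f y‖ ∧ f y ≠ 0 := by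
  intro y hy
  have hk : 0 < Real.sqrt μ := Real.sqrt_pos.2 hμ
  have hf' : ∀ x, HasDerivAt f (deriv f x) x := fun x =>
    (hf.differentiable (by norm_num) x).hasDerivAt
  have hf'' : ∀ x, HasDerivAt (deriv f) (deriv (deriv f) x) x := fun x =>
    (hf.differentiable_deriv_two x).hasDerivAt
  have hcrit : inner ℝ (f y₀) (deriv f y₀) = 0 := by
    have hmax : IsLocalMax (fun s => ‖f s‖ ^ 2) y₀ := Filter.Eventually.of_forall fun s => by
      simpa [hy₀] using hsup s
    simpa using hmax.hasDerivAt_eq_zero (hf' y₀).norm_sq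
  have hineq : ∀ x, -(Real.sqrt μ ^ 2 * ‖f x‖ ^ 2) ≤ inner ℝ (f x) (deriv (deriv f) x) := by
    intro x
    have hd : deriv (deriv f) x =
        Complex.I * (u x : ℂ) * f x - (μ : ℂ) * (starRingEnd ℂ) (f x) := by
      linear_combination -heq x
    rw [hd, Real.sq_sqrt hμ.le, Complex.sq_norm, Complex.normSq_apply, Complex.inner]
    simp
    nlinarith [mul_nonneg hμ.le (sq_nonneg (f x).im)]
  have hle := cos_le_norm_of_inner_deriv2 hk hf' hf'' hineq hcrit hy₀.ge hy
  refine ⟨hle, norm_pos_iff.1 (lt_of_lt_of_le ?_ hle)⟩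
  have habs : |Real.sqrt μ * (y - y₀)| < Real.pi / 2 := by
    rw [abs_mul, abs_of_pos hk]
    calc Real.sqrt μ * |y - y₀| < Real.sqrt μ * (Real.pi / (2 * Real.sqrt μ)) := by gcongr
      _ = Real.pi / 2 := by field_simp
  exact Real.cos_pos_of_mem_Ioo (abs_lt.1 habs)
end
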